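/- For all k ≥ 3 and 1 ≤ ℓ ≤ k−1 such that (k−ℓ) does not divide k, and for every η > 0, there exists n₀ such that: if n > n₀, (k−ℓ) divides n, and H is a k-graph on n vertices with minimum degree δ(H) ≥ (1/(⌈k/(k−ℓ)⌉(k−ℓ)) + η)·n, then H contains a Hamilton ℓ-cycle. -/

import Mathlib

open Finset

/-- `H` is (the edge set of) a `k`-uniform hypergraph on vertex set `Fin n`. -/
def IsKGraph (n k : ℕ) (H : Finset (Finset (Fin n))) : Prop := ∀ e ∈ H, e.card = k

/-- The degree of a vertex set `A` in `H`: the number of edges containing `A`. -/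
def degree (n : ℕ) (H : Finset (Finset (Fin n))) (A : Finset (Fin n)) : ℕ :=
  (H.filter (fun e => A ⊆ e)).card

/-- The minimum `(k-1)`-degree of `H` is at least `x`. -/
def MinDegreeGe (n k : ℕ) (H : Finset (Finset (Fin n))) (x : ℝ) : Prop :=
  ∀ A : Finset (Fin n), A.card = k - 1 → x ≤ (degree n H A : ℝ)

/-- `⌈k / d⌉` for natural numbers. -/
def ceilQuot (k d : ℕ) : ℕ := (k + d - 1) / d

/-- The edge of a Hamilton `ℓ`-cycle starting at position `j * (k - ℓ)` in the
cyclic ordering `f` of the vertices: it consists of the `k` consecutive vertices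
from that position on. -/
def cycleEdge (n k ℓ : ℕ) (f : ZMod n ≃ Fin n) (j : ℕ) : Finset (Fin n) :=
  (Finset.range k).image (fun t => f ((j * (k - ℓ) + t : ℕ) : ZMod n))

/-- `H` contains a Hamilton `ℓ`-cycle: there is a cyclic ordering of all `n`
vertices and `m` edges of `H`, each consisting of `k` consecutive vertices, with
consecutive edges (in the natural ordering of the edges) sharing exactly `ℓ`
vertices, i.e. successive starting positions differ by `k - ℓ`, going around the
whole cycle exactly once (so `m * (k - ℓ) = n`). -/
def HasHamiltonLCycle (n k ℓ : ℕ) (H : Finset (Finset (Fin n))) : Prop :=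
  ∃ (f : ZMod n ≃ Fin n) (m : ℕ), 0 < m ∧ m * (k - ℓ) = n ∧
    ∀ j < m, cycleEdge n k ℓ f j ∈ H ∧ (cycleEdge n k ℓ f j).card = k

section
namespace HC

/-- every aligned window of length `k` satisfies `P` -/
def WinP {V : Type*} (k d : ℕ) (P : List V → Prop) (w : List V) : Prop :=
  ∀ a b c : List V, w = a ++ b ++ c → d ∣ a.length → b.length = k → P b

/-- every aligned window of length `k` is an edge -/
def Win {V : Type*} [DecidableEq V] (k d : ℕ) (H : Finset (Finset V)) (w : List V) : Prop :=
  WinP k d (fun b => b.toFinset ∈ H) w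

theorem WinP.short {V : Type*} {k d : ℕ} {P : List V → Prop} {w : List V} (h : w.length < k) :
    WinP k d P w := by
  intro a b c hw _ hb
  have := congrArg List.length hw
  simp at this
  omega

theorem WinP.initial {V : Type*} {k d : ℕ} {P : List V → Prop} {a b : List V}
    (h : WinP k d P (a ++ b)) : WinP k d P a := by
  intro x y z hw hx hy
  exact h x y (z ++ b) (by rw [hw]; simp) hx hy

theorem WinP.suffix {V : Type*} {k d : ℕ} {P : List V → Prop} {a b : List V}
    (h : WinP k d P (a ++ b)) (ha : d ∣ a.length) : WinP k d P b := by
  intro x y z hw hx hy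
  exact h (a ++ x) y z (by rw [hw]; simp) (by simpa using dvd_add ha hx) hy

theorem WinP.glue {V : Type*} {k d l : ℕ} {P : List V → Prop} {A B C : List V}
    (hk : k = l + d) (hB : B.length = l) (hA : d ∣ A.length)
    (h1 : WinP k d P (A ++ B)) (h2 : WinP k d P (B ++ C)) : WinP k d P (A ++ B ++ C) := by
  intro x y z hw hx hy
  by_cases hlt : x.length < A.length
  · have h3 : x.length + d ≤ A.length := by
      obtain ⟨p, hp⟩ := hA
      obtain ⟨q, hq⟩ := hx
      rw [hp, hq] at hlt ⊢
      have : q < p := lt_of_mul_lt_mul_left hlt (Nat.zero_le _)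
      calc d * q + d = d * (q + 1) := by ring
        _ ≤ d * p := Nat.mul_le_mul_left _ this
    have hp1 : (x ++ y) <+: (A ++ B ++ C) := ⟨z, hw.symm⟩
    have hp2 : (A ++ B) <+: (A ++ B ++ C) := ⟨C, rfl⟩
    obtain ⟨t, ht⟩ := List.prefix_of_prefix_length_le hp1 hp2 (by simp; omega)
    exact h1 x y t ht.symm hx hy
  · have hp1 : A <+: (A ++ B ++ C) := ⟨B ++ C, by simp⟩
    have hp2 : x <+: (A ++ B ++ C) := ⟨y ++ z, by simp [hw]⟩
    obtain ⟨t, ht⟩ := List.prefix_of_prefix_length_le hp1 hp2 (by omega)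
    subst ht
    have : B ++ C = t ++ y ++ z := by
      have h5 : A ++ (B ++ C) = A ++ (t ++ y ++ z) := by simpa using hw
      exact List.append_cancel_left h5
    refine h2 t y z this ?_ hy
    simp at hx
    exact (Nat.dvd_add_right hA).1 hx

theorem WinP.mono {V : Type*} {k d : ℕ} {P Q : List V → Prop} {w : List V}
    (h : WinP k d P w) (hPQ : ∀ b, P b → Q b) : WinP k d Q w :=
  fun a b c hw ha hb => hPQ b (h a b c hw ha hb)

theorem WinP.map {V W : Type*} {k d : ℕ} {P : List V → Prop} {Q : List W → Prop} {w : List V}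
    (f : V → W) (h : WinP k d P w) (hPQ : ∀ b, P b → Q (b.map f)) : WinP k d Q (w.map f) := by
  intro a b c hw ha hb
  obtain ⟨ab', c', h1, h2, h3⟩ := List.map_eq_append_iff.1 hw
  obtain ⟨a', b', h4, h5, h6⟩ := List.map_eq_append_iff.1 h2
  subst h1 h4 h5 h6 h3
  exact hPQ b' (h a' b' c' rfl (by simpa using ha) (by simpa using hb))

/-- windows of a list given by a function -/
theorem WinP.ofFun {V : Type*} {k d : ℕ} {P : List V → Prop} (f : ℕ → V) (L : ℕ)
    (h : ∀ j, j * d + k ≤ L → P ((List.range' (j * d) k).map f)) :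
    WinP k d P ((List.range L).map f) := by
  intro a b c hw ha hb
  obtain ⟨j, hj⟩ := ha
  have hlen : L = a.length + b.length + c.length := by
    simpa [add_assoc] using congrArg List.length hw
  have hb' : b = (((List.range L).map f).drop a.length).take k := by
    rw [hw]; simp [hb]
  have : (List.range' (j * d) k).map f = b := by
    rw [hb']
    apply List.ext_getElem
    · simp; omega
    · intro i h1 h2
      simp [hj, mul_comm]
  rw [← this]
  apply h
  rw [mul_comm, ← hj]; omega

/-- From a cyclic list to a Hamilton cycle. -/
theorem cycle_of_list {n k l : ℕ} (hn : k ≤ n) (hlk : l < k) (hd : (k - l) ∣ n)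
    (H : Finset (Finset (Fin n))) (hH : IsKGraph n k H) (w : List (Fin n)) (hw : w.Nodup)
    (hlen : w.length = n) (hwin : Win k (k - l) H (w ++ w.take l)) :
    HasHamiltonLCycle n k l H := by
  have hn0 : n ≠ 0 := by omega
  have : NeZero n := ⟨hn0⟩
  obtain ⟨m, hm⟩ := hd
  have hdpos : 0 < k - l := by omega
  have hmpos : 0 < m := by
    rcases Nat.eq_zero_or_pos m with h | h
    · subst h; simp at hm; omega
    · exact h
  let g : ZMod n → Fin n := fun i => w[i.val]'(by rw [hlen]; exact ZMod.val_lt i)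
  have hg : Function.Injective g := by
    intro i j hij
    exact ZMod.val_injective n ((List.Nodup.getElem_inj_iff hw).1 hij)
  have hg2 : Function.Bijective g :=
    (Fintype.bijective_iff_injective_and_card g).2 ⟨hg, by simp [ZMod.card]⟩
  let f : ZMod n ≃ Fin n := Equiv.ofBijective g hg2
  have hf : ∀ i : ℕ, f (i : ZMod n) = w[i % n]'(by rw [hlen]; exact Nat.mod_lt _ (by omega)) := by
    intro i
    show g (i : ZMod n) = _
    simp [g, ZMod.val_natCast]
  refine ⟨f, m, hmpos, by rw [hm, mul_comm], ?_⟩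
  intro j hj
  have hjd : j * (k - l) + (k - l) ≤ n := by
    rw [hm]
    calc j * (k - l) + (k - l) = (k - l) * (j + 1) := by ring
      _ ≤ _ := Nat.mul_le_mul_left _ hj
  have hmem : cycleEdge n k l f j ∈ H := by
    set W := w ++ w.take l with hW
    have hWl : W.length = n + l := by rw [hW]; simp [hlen]; omega
    have h1 := hwin (W.take (j * (k - l))) ((W.drop (j * (k - l))).take k)
      ((W.drop (j * (k - l))).drop k) (by simp [List.take_append_drop]) (by
        rw [List.length_take, min_eq_left (by omega)]; exact dvd_mul_left _ _) (by
        rw [List.length_take, List.length_drop]; omega)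
    convert h1 using 1
    ext v
    simp only [cycleEdge, mem_image, mem_range, List.mem_toFinset, List.mem_iff_getElem]
    have key : ∀ t, t < k → ∀ h, f ((j * (k - l) + t : ℕ) : ZMod n) =
        ((W.drop (j * (k - l))).take k)[t]'h := by
      intro t ht h
      rw [hf, List.getElem_take, List.getElem_drop]
      have hidx : j * (k - l) + t < n + l := by omega
      by_cases hc : j * (k - l) + t < n
      · simp only [hW]
        rw [List.getElem_append_left (by omega)]
        congr 1
        exact Nat.mod_eq_of_lt hc
      · simp only [hW]
        rw [List.getElem_append_right (by omega), List.getElem_take]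
        congr 1
        rw [hlen, Nat.mod_eq_sub_mod (by omega), Nat.mod_eq_of_lt (by omega)]
    have hl2 : ((W.drop (j * (k - l))).take k).length = k := by
      rw [List.length_take, List.length_drop]; omega
    constructor
    · rintro ⟨t, ht, rfl⟩
      exact ⟨t, by omega, (key t ht _).symm⟩
    · rintro ⟨t, ht, rfl⟩
      exact ⟨t, by omega, key t (by omega) _⟩
  exact ⟨hmem, hH _ hmem⟩

end HC
end

section
namespace HC

theorem jensen_pow {ι : Type*} (s : Finset ι) (f : ι → ℝ) (hf : ∀ i ∈ s, 0 ≤ f i) (q : ℕ)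
    (hq : 0 < q) (A : ℝ) (hA : 0 ≤ A) (hs : 0 < s.card) (h : A * s.card ≤ ∑ i ∈ s, f i) :
    A ^ q * s.card ≤ ∑ i ∈ s, f i ^ q := by
  obtain ⟨q, rfl⟩ : ∃ p, q = p + 1 := ⟨q - 1, by omega⟩
  have hs' : (0 : ℝ) < s.card := by exact_mod_cast hs
  have h1 := pow_sum_div_card_le_sum_pow (s := s) (f := f) hf q
  refine le_trans ?_ h1
  rw [le_div_iff₀ (by positivity)]
  calc A ^ (q + 1) * s.card * (s.card : ℝ) ^ q = (A * s.card) ^ (q + 1) := by ring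
    _ ≤ _ := pow_le_pow_left₀ (by positivity) h _

open Classical in
theorem blowup_aux {V κ : Type*} [Fintype V] [Nonempty V] [Fintype κ] [Nonempty κ] (r : ℕ) :
    ∀ (S : Finset (Fin r → V)) (c : ℝ), 0 ≤ c →
      c * (Fintype.card V : ℝ) ^ r ≤ S.card →
      c ^ (Fintype.card κ ^ r) * (Fintype.card V : ℝ) ^ (r * Fintype.card κ) ≤
        ((univ : Finset (Fin r → κ → V)).filter
          (fun φ => ∀ g : Fin r → κ, (fun i => φ i (g i)) ∈ S)).card := by
  have hM : 0 < Fintype.card κ := Fintype.card_pos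
  have hn : (0 : ℝ) < Fintype.card V := by exact_mod_cast Fintype.card_pos
  induction r with
  | zero =>
    intro S c hc hS
    simp only [pow_zero, mul_one, pow_one, zero_mul] at hS ⊢
    refine hS.trans ?_
    have : S.card ≤ ((univ : Finset (Fin 0 → κ → V)).filter
          (fun φ => ∀ g : Fin 0 → κ, (fun i => φ i (g i)) ∈ S)).card := by
      apply Finset.card_le_card_of_injOn (fun _ => fun i => i.elim0)
      · intro x hx
        simp only [coe_filter, mem_univ, true_and, Set.mem_ofPred_eq]
        intro g
        have h0 : (fun i : Fin 0 => (fun i : Fin 0 => (i.elim0 : κ → V)) i (g i)) = x := Subsingleton.elim _ _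
        rw [h0]; exact hx
      · intro x _ y _ _
        exact Subsingleton.elim _ _
    exact_mod_cast this
  | succ r ih =>
    intro S c hc hS
    set M := Fintype.card κ with hMdef
    set n : ℝ := (Fintype.card V : ℝ) with hndef
    let Sa : (κ → V) → Finset (Fin r → V) := fun a =>
      univ.filter (fun y => ∀ i : κ, (Fin.cons (a i) y : Fin (r + 1) → V) ∈ S)
    let N : (Fin r → V) → Finset V := fun y =>
      univ.filter (fun v => (Fin.cons v y : Fin (r + 1) → V) ∈ S)
    -- degree sum
    have h1 : (S.card : ℝ) = ∑ y : Fin r → V, ((N y).card : ℝ) := by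
      rw [← Nat.cast_sum]
      congr 1
      rw [← Finset.card_sigma]
      symm
      apply Finset.card_bij (fun (p : (_ : Fin r → V) × V) _ => (Fin.cons p.2 p.1 : Fin (r + 1) → V))
      · rintro ⟨y, v⟩ h
        simpa [N] using h
      · rintro ⟨y, v⟩ _ ⟨y', v'⟩ _ h
        have := Fin.cons_inj.1 h
        obtain ⟨h1, h2⟩ := this
        dsimp only at h1 h2
        subst h1 h2
        rfl
      · intro x hx
        refine ⟨⟨Fin.tail x, x 0⟩, ?_, ?_⟩
        · simp [N, hx]
        · simp
    have h2 : ∑ a : κ → V, ((Sa a).card : ℝ) = ∑ y : Fin r → V, ((N y).card : ℝ) ^ M := by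
      have : ∀ y : Fin r → V, ((N y).card : ℝ) ^ M =
          (((univ : Finset (κ → V)).filter (fun a => ∀ i : κ, (Fin.cons (a i) y : Fin (r + 1) → V) ∈ S)).card : ℝ) := by
        intro y
        have : (univ : Finset (κ → V)).filter (fun a => ∀ i : κ, (Fin.cons (a i) y : Fin (r + 1) → V) ∈ S)
            = Fintype.piFinset (fun _ : κ => N y) := by
          ext a
          simp [N]
        rw [this, Fintype.card_piFinset]
        simp [hMdef]
      simp_rw [this]
      rw [← Nat.cast_sum, ← Nat.cast_sum]
      congr 1
      simp only [Sa, Finset.card_filter]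
      rw [Finset.sum_comm]
    have h3 : c ^ M * n ^ M * n ^ r ≤ ∑ a : κ → V, ((Sa a).card : ℝ) := by
      rw [h2]
      have hcard : (((univ : Finset (Fin r → V)).card : ℕ) : ℝ) = n ^ r := by
        simp [hndef]
      have := jensen_pow (univ : Finset (Fin r → V)) (fun y => ((N y).card : ℝ))
        (fun _ _ => by positivity) M hM (c * n) (by positivity)
        (by
          have : (0 : ℝ) < ((univ : Finset (Fin r → V)).card : ℝ) := by rw [hcard]; positivity
          exact_mod_cast this)
        (by rw [hcard, ← h1]; calc c * n * n ^ r = c * n ^ (r + 1) := by ring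
              _ ≤ _ := hS)
      rw [hcard] at this
      rwa [mul_pow] at this
    have h4 : ∀ a : κ → V, ((Sa a).card / n ^ r : ℝ) ^ (M ^ r) * n ^ (r * M) ≤
        ((univ : Finset (Fin r → κ → V)).filter
          (fun φ => ∀ g : Fin r → κ, (fun i => φ i (g i)) ∈ Sa a)).card := by
      intro a
      apply ih
      · positivity
      · rw [div_mul_cancel₀]
        positivity
    have h5 : (c ^ M) ^ (M ^ r) * n ^ M ≤ ∑ a : κ → V, ((Sa a).card / n ^ r : ℝ) ^ (M ^ r) := by
      have hcard : (((univ : Finset (κ → V)).card : ℕ) : ℝ) = n ^ M := by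
        simp [hndef, hMdef]
      have := jensen_pow (univ : Finset (κ → V)) (fun a => ((Sa a).card / n ^ r : ℝ))
        (fun _ _ => by positivity) (M ^ r) (by positivity) (c ^ M) (by positivity)
        (by
          have : (0 : ℝ) < ((univ : Finset (κ → V)).card : ℝ) := by rw [hcard]; positivity
          exact_mod_cast this)
        (by
          rw [hcard, ← Finset.sum_div, le_div_iff₀ (by positivity)]
          exact h3)
      rwa [hcard] at this
    have h6 : ∑ a : κ → V, (((univ : Finset (Fin r → κ → V)).filter
          (fun φ => ∀ g : Fin r → κ, (fun i => φ i (g i)) ∈ Sa a)).card) ≤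
        ((univ : Finset (Fin (r + 1) → κ → V)).filter
          (fun φ => ∀ g : Fin (r + 1) → κ, (fun i => φ i (g i)) ∈ S)).card := by
      rw [← Finset.card_sigma]
      apply Finset.card_le_card_of_injOn
        (fun (p : (_ : κ → V) × (Fin r → κ → V)) => (Fin.cons p.1 p.2 : Fin (r + 1) → κ → V))
      · rintro ⟨a, ψ⟩ h
        simp only [coe_sigma, coe_filter, mem_univ, true_and, Set.mem_sigma_iff, Set.mem_ofPred_eq, coe_univ, Set.mem_univ] at h ⊢
        intro g
        have := h (fun i => g i.succ)
        simp only [Sa, mem_filter, mem_univ, true_and] at this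
        convert this (g 0) using 1
        funext i
        refine Fin.cases ?_ (fun i => ?_) i <;> simp
      · rintro ⟨y, v⟩ _ ⟨y', v'⟩ _ h
        have := Fin.cons_inj.1 h
        obtain ⟨h1, h2⟩ := this
        dsimp only at h1 h2
        subst h1 h2
        rfl
    calc c ^ (M ^ (r + 1)) * n ^ ((r + 1) * M)
        = ((c ^ M) ^ (M ^ r) * n ^ M) * n ^ (r * M) := by
          rw [← pow_mul, ← pow_succ', mul_assoc, ← pow_add]; congr 2; ring
      _ ≤ (∑ a : κ → V, ((Sa a).card / n ^ r : ℝ) ^ (M ^ r)) * n ^ (r * M) := by gcongr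
      _ = ∑ a : κ → V, ((Sa a).card / n ^ r : ℝ) ^ (M ^ r) * n ^ (r * M) := by rw [Finset.sum_mul]
      _ ≤ _ := Finset.sum_le_sum (fun a _ => h4 a)
      _ ≤ _ := by exact_mod_cast h6

open Classical in
theorem blowup {V κ : Type*} [Fintype V] [Nonempty V] [Fintype κ] [Nonempty κ] (r : ℕ)
    (S : Finset (Fin r → V)) (c : ℝ) (hc : 0 ≤ c)
    (hS : c * (Fintype.card V : ℝ) ^ r ≤ S.card) :
      c ^ (Fintype.card κ ^ r) * (Fintype.card V : ℝ) ^ (r * Fintype.card κ) ≤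
        ((univ : Finset (Fin r × κ → V)).filter
          (fun φ => ∀ g : Fin r → κ, (fun i => φ (i, g i)) ∈ S)).card := by
  refine (blowup_aux (κ := κ) r S c hc hS).trans ?_
  norm_cast
  apply Finset.card_le_card_of_injOn (fun φ => Function.uncurry φ)
  · intro φ hφ
    simpa [Function.uncurry] using hφ
  · intro φ _ ψ _ h
    exact Function.uncurry_injective h

end HC
end

section
namespace HC

/-- codegree condition in neighbourhood form -/
def Cod {V : Type*} [Fintype V] [DecidableEq V] (k : ℕ) (H : Finset (Finset V)) (x : ℝ) : Prop :=
  ∀ A : Finset V, A.card = k - 1 →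
    x ≤ ((univ.filter (fun v => v ∉ A ∧ insert v A ∈ H)).card : ℝ)

theorem cod_of_minDegree {n k : ℕ} (hk : 1 ≤ k) {H : Finset (Finset (Fin n))} (hH : IsKGraph n k H)
    {x : ℝ} (h : MinDegreeGe n k H x) : Cod k H x := by
  intro A hA
  refine (h A hA).trans ?_
  norm_cast
  unfold degree
  have key : ∀ e ∈ H.filter (fun e => A ⊆ e), ∃ v, v ∉ A ∧ insert v A = e := by
    intro e he
    rw [mem_filter] at he
    have h1 : (e \ A).card = 1 := by
      rw [card_sdiff_of_subset he.2, hH e he.1, hA]; omega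
    obtain ⟨v, hv⟩ := card_eq_one.1 h1
    have hv' : v ∈ e \ A := by rw [hv]; simp
    refine ⟨v, (mem_sdiff.1 hv').2, ?_⟩
    ext y
    constructor
    · intro hy
      rcases mem_insert.1 hy with rfl | hy
      · exact (mem_sdiff.1 hv').1
      · exact he.2 hy
    · intro hy
      by_cases hyA : y ∈ A
      · exact mem_insert_of_mem hyA
      · have : y ∈ e \ A := mem_sdiff.2 ⟨hy, hyA⟩
        rw [hv] at this
        simp at this
        simp [this]
  have : H.filter (fun e => A ⊆ e) ⊆
      (univ.filter (fun v => v ∉ A ∧ insert v A ∈ H)).image (fun v => insert v A) := by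
    intro e he
    obtain ⟨v, hv, rfl⟩ := key e he
    rw [mem_image]
    exact ⟨v, by simp [hv, (mem_filter.1 he).1], rfl⟩
  exact (card_le_card this).trans card_image_le

open Classical in
theorem degenerate {V : Type*} [Fintype V] [DecidableEq V] (k r s m : ℕ) (H : Finset (Finset V))
    (hH : Cod k H ((m + (r + s) : ℕ) : ℝ)) (hm : m + (r + s) ≤ Fintype.card V)
    (Q : ℕ → Finset ℕ)
    (hQ : ∀ j < r, ∀ l ∈ Q j, l < j ∨ (r ≤ l ∧ l < r + s)) (fixed : ℕ → V)
    (hfix : Set.InjOn fixed (Set.Ico r (r + s))) (i : ℕ) (hi : i ≤ r) :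
    ∃ G : Finset (ℕ → V), m ^ i ≤ G.card ∧ ∀ φ ∈ G, (∀ l, i ≤ l → φ l = fixed l) ∧
      Set.InjOn φ (↑(range i ∪ Ico r (r + s)) : Set ℕ) ∧
      ∀ j < i, (Q j).card = k - 1 → (insert j (Q j)).image φ ∈ H := by
  induction i with
  | zero =>
    refine ⟨{fixed}, by simp, ?_⟩
    intro φ hφ
    rw [mem_singleton] at hφ
    subst hφ
    refine ⟨by simp, by simpa using hfix, by simp⟩
  | succ i ih =>
    obtain ⟨G, hG, hG2⟩ := ih (by omega)
    let R : Finset ℕ := range i ∪ Ico r (r + s)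
    let ch : (ℕ → V) → Finset V := fun φ =>
      (if (Q i).card = k - 1 then univ.filter (fun v => insert v ((Q i).image φ) ∈ H) else univ) \
        R.image φ
    have hR : R.card ≤ r + s := by
      refine (card_union_le _ _).trans ?_
      simp; omega
    have hch : ∀ φ ∈ G, m ≤ (ch φ).card := by
      intro φ hφ
      obtain ⟨h1, h2, h3⟩ := hG2 φ hφ
      have hsub : (Q i) ⊆ R := by
        intro l hl
        rcases hQ i (by omega) l hl with h | h
        · simp [R, h]
        · simp [R, h]
      have h4 : m + (r + s) ≤ (if (Q i).card = k - 1 then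
          univ.filter (fun v => insert v ((Q i).image φ) ∈ H) else univ).card := by
        split_ifs with hc
        · have hc2 : ((Q i).image φ).card = k - 1 := by
            rw [card_image_of_injOn, hc]
            exact h2.mono (by exact_mod_cast hsub)
          have := hH _ hc2
          norm_cast at this
          refine this.trans (card_le_card ?_)
          intro v hv
          simp only [mem_filter, mem_univ, true_and] at hv ⊢
          exact hv.2
        · simpa using hm
      have h5 := le_card_sdiff (R.image φ) (if (Q i).card = k - 1 then
          univ.filter (fun v => insert v ((Q i).image φ) ∈ H) else univ)
      have h6 : (R.image φ).card ≤ R.card := card_image_le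
      simp only [ch]
      omega
    refine ⟨(G.sigma ch).image (fun p => Function.update p.1 i p.2), ?_, ?_⟩
    · rw [card_image_of_injOn]
      · rw [card_sigma, pow_succ]
        calc m ^ i * m ≤ G.card * m := Nat.mul_le_mul_right _ hG
          _ = ∑ _φ ∈ G, m := by simp
          _ ≤ _ := sum_le_sum hch
      · rintro ⟨φ, v⟩ hp ⟨ψ, w⟩ hq h
        simp only [coe_sigma, Set.mem_sigma_iff, mem_coe] at hp hq
        dsimp only at h
        have hv : v = w := by
          have := congrFun h i
          simpa using this
        have hφ : φ = ψ := by
          funext l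
          by_cases hl : l = i
          · subst hl
            rw [(hG2 φ hp.1).1 l le_rfl, (hG2 ψ hq.1).1 l le_rfl]
          · have := congrFun h l
            simpa [hl] using this
        subst hv hφ
        rfl
    · intro φ' hφ'
      rw [mem_image] at hφ'
      obtain ⟨⟨φ, v⟩, hp, rfl⟩ := hφ'
      rw [mem_sigma] at hp
      obtain ⟨hφ, hv⟩ := hp
      obtain ⟨h1, h2, h3⟩ := hG2 φ hφ
      simp only [ch, mem_sdiff] at hv
      obtain ⟨hv1, hv2⟩ := hv
      have hvR : ∀ l ∈ R, φ l ≠ v := fun l hl he => hv2 (mem_image.2 ⟨l, hl, he⟩)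
      have hmemR : ∀ l, l ∈ range (i + 1) ∪ Ico r (r + s) → l ≠ i → l ∈ R := by
        intro l hl hli
        simp only [R, mem_union, mem_range, mem_Ico] at hl ⊢
        omega
      refine ⟨?_, ?_, ?_⟩
      · intro l hl
        rw [Function.update_of_ne (by omega)]
        exact h1 l (by omega)
      · intro x hx y hy hxy
        rw [mem_coe] at hx hy
        by_cases hxi : x = i
        · by_cases hyi : y = i
          · omega
          · subst hxi
            simp only [Function.update_self, Function.update_of_ne hyi] at hxy
            exact absurd hxy.symm (hvR y (hmemR y hy hyi))
        · by_cases hyi : y = i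
          · subst hyi
            simp only [Function.update_self, Function.update_of_ne hxi] at hxy
            exact absurd hxy (hvR x (hmemR x hx hxi))
          · simp only [Function.update_of_ne hyi, Function.update_of_ne hxi] at hxy
            exact h2 (hmemR x hx hxi) (hmemR y hy hyi) hxy
      · intro j hj hc
        by_cases hji : j = i
        · subst hji
          rw [if_pos hc] at hv1
          simp only [mem_filter, mem_univ, true_and] at hv1
          have : (insert j (Q j)).image (Function.update φ j v) = insert v ((Q j).image φ) := by
            rw [image_insert, Function.update_self]
            congr 1
            apply image_congr
            intro l hl
            rw [Function.update_of_ne]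
            rcases hQ j (by omega) l hl with h | h <;> omega
          rw [this]; exact hv1
        · have := h3 j (by omega) hc
          have h5 : (insert j (Q j)).image (Function.update φ i v) = (insert j (Q j)).image φ := by
            apply image_congr
            intro l hl
            rw [mem_coe, mem_insert] at hl
            rw [Function.update_of_ne]
            rcases hl with rfl | hl
            · exact hji
            · rcases hQ j (by omega) l hl with h | h <;> omega
          rw [h5]; exact this

/-- evaluation of a labelled copy -/
def val {V κ : Type*} (r : ℕ) (fixed : ℕ → V) (φ : Fin r × κ → V) (p : ℕ × κ) : V :=
  if h : p.1 < r then φ (⟨p.1, h⟩, p.2) else fixed p.1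

/-- φ satisfies all the template constraints -/
def Sat {V κ : Type*} [DecidableEq V] (k r : ℕ) (H : Finset (Finset V)) (Q : ℕ → Finset ℕ)
    (fixed : ℕ → V) (φ : Fin r × κ → V) : Prop :=
  ∀ g : ℕ → κ, ∀ j < r, (Q j).card = k - 1 →
    (insert j (Q j)).image (fun l => val r fixed φ (l, g l)) ∈ H

open Classical in
theorem template0 {V κ : Type*} [Fintype V] [Nonempty V] [DecidableEq V] [Fintype κ] [Nonempty κ]
    (k r s m : ℕ) (H : Finset (Finset V))
    (hH : Cod k H ((m + (r + s) : ℕ) : ℝ)) (hm : m + (r + s) ≤ Fintype.card V)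
    (Q : ℕ → Finset ℕ)
    (hQ : ∀ j < r, ∀ l ∈ Q j, l < j ∨ (r ≤ l ∧ l < r + s)) (fixed : ℕ → V)
    (hfix : Set.InjOn fixed (Set.Ico r (r + s))) (c : ℝ) (hc : 0 ≤ c)
    (hcm : c * Fintype.card V ≤ m) :
    (c ^ r) ^ (Fintype.card κ ^ r) * (Fintype.card V : ℝ) ^ (r * Fintype.card κ) ≤
      ((univ : Finset (Fin r × κ → V)).filter (fun φ => Sat k r H Q fixed φ)).card := by
  obtain ⟨G, hG, hG2⟩ := degenerate k r s m H hH hm Q hQ fixed hfix r le_rfl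
  let S : Finset (Fin r → V) := G.image (fun φ => fun i : Fin r => φ i)
  have hS : S.card = G.card := by
    apply card_image_of_injOn
    intro φ hφ ψ hψ h
    funext l
    by_cases hl : l < r
    · exact congrFun h ⟨l, hl⟩
    · rw [(hG2 φ hφ).1 l (by omega), (hG2 ψ hψ).1 l (by omega)]
  have h1 := blowup (κ := κ) r S (c ^ r) (by positivity) (by
    rw [hS, ← mul_pow]
    calc (c * Fintype.card V) ^ r ≤ (m : ℝ) ^ r := pow_le_pow_left₀ (by positivity) hcm r
      _ ≤ _ := by exact_mod_cast hG)
  refine h1.trans ?_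
  norm_cast
  apply card_le_card
  intro φ hφ
  simp only [mem_filter, mem_univ, true_and] at hφ ⊢
  intro g j hj hQj
  have := hφ (fun i => g i)
  simp only [S, mem_image] at this
  obtain ⟨ψ, hψ, hψ2⟩ := this
  have h3 := (hG2 ψ hψ).2.2 j hj hQj
  convert h3 using 2
  funext l
  unfold val
  split_ifs with hl
  · exact (congrFun hψ2 ⟨l, hl⟩).symm
  · exact ((hG2 ψ hψ).1 l (by simpa using hl)).symm

open Classical in
/-- few tuples are non-injective or hit a given set -/
theorem bad_tuples {ι V : Type*} [Fintype ι] [Fintype V] (W : Finset V) :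
    ((univ : Finset (ι → V)).filter
      (fun φ => ¬ (Function.Injective φ ∧ ∀ i, φ i ∉ W))).card * Fintype.card V ≤
      (Fintype.card ι ^ 2 + Fintype.card ι * W.card) * Fintype.card V ^ Fintype.card ι := by
  have hA : ∀ x y : ι, x ≠ y → ((univ : Finset (ι → V)).filter (fun φ => φ x = φ y)).card
      * Fintype.card V ≤ Fintype.card V ^ Fintype.card ι := by
    intro x y hxy
    have : Fintype.card V ^ Fintype.card ι = (univ : Finset (ι → V)).card := by simp
    rw [this, ← card_univ (α := V), ← card_product]
    apply card_le_card_of_injOn (fun p => Function.update p.1 y p.2)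
    · intro _ _; simp
    · rintro ⟨φ, v⟩ hp ⟨ψ, w⟩ hq h
      simp only [coe_product, coe_filter, mem_univ, true_and, coe_univ, Set.mem_prod,
        Set.mem_ofPred_eq, Set.mem_univ, and_true] at hp hq
      dsimp only at h
      have h0 : v = w := by simpa using congrFun h y
      have h1 : ∀ z, z ≠ y → φ z = ψ z := by
        intro z hz
        simpa [hz] using congrFun h z
      have h2 : φ = ψ := by
        funext z
        by_cases hz : z = y
        · subst hz; rw [← hp, ← hq]; exact h1 x hxy
        · exact h1 z hz
      rw [h0, h2]
  have hB : ∀ x : ι, ((univ : Finset (ι → V)).filter (fun φ => φ x ∈ W)).card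
      * Fintype.card V ≤ W.card * Fintype.card V ^ Fintype.card ι := by
    intro x
    have : Fintype.card V ^ Fintype.card ι = (univ : Finset (ι → V)).card := by simp
    rw [this, ← card_univ (α := V), ← card_product, ← card_product]
    apply card_le_card_of_injOn (fun p => (p.1 x, Function.update p.1 x p.2))
    · rintro ⟨φ, v⟩ hp
      simpa using hp
    · rintro ⟨φ, v⟩ hp ⟨ψ, w⟩ hq h
      rw [Prod.mk.injEq] at h
      obtain ⟨ha, h⟩ := h
      dsimp only at h ha
      have h0 : v = w := by simpa using congrFun h x
      have h2 : φ = ψ := by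
        funext z
        by_cases hz : z = x
        · subst hz; exact ha
        · simpa [hz] using congrFun h z
      rw [h0, h2]
  have hsub : (univ : Finset (ι → V)).filter (fun φ => ¬ (Function.Injective φ ∧ ∀ i, φ i ∉ W)) ⊆
      ((univ : Finset (ι × ι)).filter (fun p => p.1 ≠ p.2)).biUnion
        (fun p => (univ : Finset (ι → V)).filter (fun φ => φ p.1 = φ p.2)) ∪
      (univ : Finset ι).biUnion (fun x => (univ : Finset (ι → V)).filter (fun φ => φ x ∈ W)) := by
    intro φ hφ
    simp only [mem_filter, mem_univ, true_and] at hφ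
    rw [mem_union, mem_biUnion, mem_biUnion]
    by_cases hinj : Function.Injective φ
    · right
      have : ¬ ∀ i, φ i ∉ W := fun h => hφ ⟨hinj, h⟩
      push Not at this
      obtain ⟨i, hi⟩ := this
      exact ⟨i, mem_univ _, by simpa using hi⟩
    · left
      simp only [Function.Injective] at hinj
      push Not at hinj
      obtain ⟨x, y, h1, h2⟩ := hinj
      exact ⟨(x, y), by simpa using h2, by simpa using h1⟩
  calc _ ≤ (∑ p ∈ (univ : Finset (ι × ι)).filter (fun p => p.1 ≠ p.2),
        ((univ : Finset (ι → V)).filter (fun φ => φ p.1 = φ p.2)).card +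
        ∑ x : ι, ((univ : Finset (ι → V)).filter (fun φ => φ x ∈ W)).card) * Fintype.card V := by
        apply Nat.mul_le_mul_right
        refine (card_le_card hsub).trans ((card_union_le _ _).trans ?_)
        exact add_le_add card_biUnion_le card_biUnion_le
    _ ≤ ∑ p ∈ (univ : Finset (ι × ι)).filter (fun p => p.1 ≠ p.2),
          Fintype.card V ^ Fintype.card ι +
        ∑ x : ι, W.card * Fintype.card V ^ Fintype.card ι := by
        rw [add_mul, sum_mul, sum_mul]
        apply add_le_add
        · apply sum_le_sum
          intro p hp
          exact hA _ _ (mem_filter.1 hp).2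
        · exact sum_le_sum (fun x _ => hB x)
    _ ≤ _ := by
        rw [sum_const, sum_const, add_mul]
        apply add_le_add
        · rw [smul_eq_mul]
          apply Nat.mul_le_mul_right
          refine (card_filter_le _ _).trans ?_
          simp [sq]
        · simp [mul_assoc]

open Classical in
/-- real version: a dense family contains many injective tuples avoiding a small set -/
theorem good_tuples {ι V : Type*} [Fintype ι] [Fintype V] [Nonempty V] (W : Finset V)
    (p : (ι → V) → Prop) (c : ℝ)
    (h : c * (Fintype.card V : ℝ) ^ Fintype.card ι ≤ ((univ : Finset (ι → V)).filter p).card)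
    (h2 : 2 * ((Fintype.card ι : ℝ) ^ 2 + Fintype.card ι * W.card) ≤ c * Fintype.card V) :
    c / 2 * (Fintype.card V : ℝ) ^ Fintype.card ι ≤
      ((univ : Finset (ι → V)).filter
        (fun φ => p φ ∧ Function.Injective φ ∧ ∀ i, φ i ∉ W)).card := by
  have h3 := bad_tuples (ι := ι) (V := V) W
  have hn : (0 : ℝ) < Fintype.card V := by exact_mod_cast Fintype.card_pos
  have h4 : ((univ : Finset (ι → V)).filter p).card ≤
      ((univ : Finset (ι → V)).filter
        (fun φ => p φ ∧ Function.Injective φ ∧ ∀ i, φ i ∉ W)).card +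
      ((univ : Finset (ι → V)).filter
        (fun φ => ¬ (Function.Injective φ ∧ ∀ i, φ i ∉ W))).card := by
    refine le_trans (card_le_card ?_) (card_union_le _ _)
    intro φ hφ
    simp only [mem_union, mem_filter, mem_univ, true_and] at hφ ⊢
    tauto
  have h3' : (((univ : Finset (ι → V)).filter
      (fun φ => ¬ (Function.Injective φ ∧ ∀ i, φ i ∉ W))).card : ℝ) * Fintype.card V ≤
      ((Fintype.card ι : ℝ) ^ 2 + Fintype.card ι * W.card) * (Fintype.card V : ℝ) ^ Fintype.card ι := by
    exact_mod_cast h3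
  have h4' : ((((univ : Finset (ι → V)).filter p).card : ℕ) : ℝ) ≤
      ((univ : Finset (ι → V)).filter
        (fun φ => p φ ∧ Function.Injective φ ∧ ∀ i, φ i ∉ W)).card +
      ((univ : Finset (ι → V)).filter
        (fun φ => ¬ (Function.Injective φ ∧ ∀ i, φ i ∉ W))).card := by
    exact_mod_cast h4
  have h5 : (((univ : Finset (ι → V)).filter
      (fun φ => ¬ (Function.Injective φ ∧ ∀ i, φ i ∉ W))).card : ℝ) ≤
      c / 2 * (Fintype.card V : ℝ) ^ Fintype.card ι := by
    refine le_of_mul_le_mul_right (h3'.trans ?_) hn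
    have : (0:ℝ) ≤ (Fintype.card V : ℝ) ^ Fintype.card ι := by positivity
    nlinarith
  linarith

open Classical in
/-- Template lemma. -/
theorem template (κ : Type) [Fintype κ] [Nonempty κ] (k r s : ℕ) (hr : 0 < r) (μ : ℝ) (hμ : 0 < μ) :
    ∃ c > (0:ℝ), ∃ β > (0:ℝ), ∃ n0 : ℕ, ∀ n ≥ n0, ∀ H : Finset (Finset (Fin n)),
      Cod k H (μ * n) → μ ≤ 1 → ∀ Q : ℕ → Finset ℕ,
      (∀ j < r, ∀ l ∈ Q j, l < j ∨ (r ≤ l ∧ l < r + s)) → ∀ fixed : ℕ → Fin n,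
      Set.InjOn fixed (Set.Ico r (r + s)) → ∀ W : Finset (Fin n), (W.card : ℝ) ≤ β * n →
      c * (n : ℝ) ^ (r * Fintype.card κ) ≤
        ((univ : Finset (Fin r × κ → Fin n)).filter (fun φ => Sat k r H Q fixed φ ∧
          Function.Injective φ ∧ ∀ i, φ i ∉ W)).card := by
  set M := Fintype.card κ with hM
  have hMpos : 0 < M := Fintype.card_pos
  set c0 : ℝ := ((μ / 2) ^ r) ^ (M ^ r) with hc0
  have hc0pos : 0 < c0 := by positivity
  set m : ℝ := ((r * M : ℕ) : ℝ) with hm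
  have hmpos : 0 < m := by rw [hm]; positivity
  refine ⟨c0 / 2, by positivity, c0 / (4 * m), by positivity,
    max 1 (max (⌈2 * (r + s + 1) / μ⌉₊) ⌈4 * m ^ 2 / c0⌉₊), ?_⟩
  intro n hn H hH hμ1 Q hQ fixed hfix W hW
  have hn1 : 1 ≤ n := le_trans (le_max_left _ _) hn
  have hn2 : 2 * (r + s + 1) / μ ≤ n := (Nat.le_ceil _).trans (by
    exact_mod_cast (le_trans ((le_max_left _ _).trans (le_max_right _ _)) hn))
  have hn3 : 4 * m ^ 2 / c0 ≤ n := (Nat.le_ceil _).trans (by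
    exact_mod_cast (le_trans ((le_max_right _ _).trans (le_max_right _ _)) hn))
  have hnpos : (0:ℝ) < n := by exact_mod_cast hn1
  have : Nonempty (Fin n) := ⟨⟨0, hn1⟩⟩
  rw [div_le_iff₀ (by positivity)] at hn2 hn3
  have hsum : ((⌈μ / 2 * n⌉₊ + (r + s) : ℕ) : ℝ) ≤ μ * n := by
    push_cast
    have := (Nat.ceil_lt_add_one (show 0 ≤ μ / 2 * n by positivity)).le
    nlinarith
  have h1 := template0 (κ := κ) k r s ⌈μ / 2 * n⌉₊ H (by
      intro A hA
      exact hsum.trans (hH A hA)) (by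
      have h7 : ((⌈μ / 2 * n⌉₊ + (r + s) : ℕ) : ℝ) ≤ (n : ℝ) := by nlinarith
      simpa using (by exact_mod_cast h7 : ⌈μ / 2 * (n:ℝ)⌉₊ + (r + s) ≤ n)) Q hQ fixed hfix (μ / 2)
      (by positivity) (by simpa using Nat.le_ceil _)
  have hι : Fintype.card (Fin r × κ) = r * M := by simp [hM]
  have h2 := good_tuples (ι := Fin r × κ) W (fun φ => Sat k r H Q fixed φ) c0 (by
    rw [hι]; convert h1) (by
    rw [hι, ← hm, Fintype.card_fin]
    have hW' : W.card * (4 * m) ≤ c0 * n := by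
      have : c0 / (4 * m) * n = c0 * n / (4 * m) := by ring
      rw [this, le_div_iff₀ (by positivity)] at hW
      exact hW
    nlinarith)
  rw [hι, Fintype.card_fin] at h2
  convert h2

/-- label windows that are edges of the template -/
def Ok (r : ℕ) (Q : ℕ → Finset ℕ) (b : List ℕ) : Prop :=
  b.Nodup ∧ ∃ j < r, b.toFinset = insert j (Q j)

theorem lift_win {V κ : Type*} [DecidableEq V] [Nonempty κ] {k d r s : ℕ}
    {H : Finset (Finset V)}
    {Q : ℕ → Finset ℕ} (hQ : ∀ j < r, ∀ l ∈ Q j, l < j ∨ (r ≤ l ∧ l < r + s))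
    {fixed : ℕ → V} {φ : Fin r × κ → V} (hs : Sat k r H Q fixed φ) (w : List (ℕ × κ))
    (hw : WinP k d (Ok r Q) (w.map Prod.fst)) : Win k d H (w.map (val r fixed φ)) := by
  classical
  have : WinP k d (fun b => b.length = k ∧ Ok r Q (b.map Prod.fst)) w := by
    intro a b c h1 h2 h3
    refine ⟨h3, hw (a.map Prod.fst) (b.map Prod.fst) (c.map Prod.fst) (by simp [h1]) (by simpa using h2)
      (by simpa using h3)⟩
  refine WinP.map _ this ?_
  rintro b ⟨hbl, hnd, j, hj, hb⟩
  let g : ℕ → κ := fun l => if h : ∃ c, (l, c) ∈ b then h.choose else Classical.arbitrary κ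
  have hg : ∀ p ∈ b, g p.1 = p.2 := by
    intro p hp
    have h : ∃ c, (p.1, c) ∈ b := ⟨p.2, hp⟩
    have h1 : (p.1, g p.1) ∈ b := by
      simp only [g, dif_pos h]
      exact h.choose_spec
    have := List.inj_on_of_nodup_map hnd h1 hp rfl
    exact congrArg Prod.snd this
  have hjQ : j ∉ Q j := by
    intro h
    rcases hQ j hj j h with h | h <;> omega
  have hcard : (Q j).card = k - 1 := by
    have h1 : (b.map Prod.fst).toFinset.card = k := by
      rw [List.toFinset_card_of_nodup hnd]; simpa using hbl
    rw [hb, card_insert_of_notMem hjQ] at h1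
    omega
  have := hs g j hj hcard
  rw [← hb] at this
  convert this using 1
  ext v
  simp only [List.mem_toFinset, List.mem_map, mem_image]
  constructor
  · rintro ⟨p, hp, rfl⟩
    exact ⟨p.1, ⟨p, hp, rfl⟩, by rw [hg p hp]⟩
  · rintro ⟨l, ⟨p, hp, rfl⟩, rfl⟩
    exact ⟨p, hp, by rw [hg p hp]⟩

end HC
end

section
namespace HC

open Classical in
theorem select0 {ι V J : Type*} [Fintype ι] [Nonempty ι] [Fintype V] [Nonempty V] [Fintype J]
    [Nonempty J] (A : J → Finset (ι → V)) (c : ℝ) (hc : 0 < c)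
    (hA : ∀ s, c * (Fintype.card V : ℝ) ^ Fintype.card ι ≤ (A s).card) (t : ℕ)
    (ht : 2 * (Fintype.card ι : ℝ) ^ 2 * t ≤ c * Fintype.card V) :
    ∃ F : Finset (ι → V), F.card = t ∧ (∀ φ ∈ F, Function.Injective φ ∧ ∃ s, φ ∈ A s) ∧
      (∀ φ ∈ F, ∀ ψ ∈ F, φ ≠ ψ → ∀ i j, φ i ≠ ψ j) ∧
      ∑ s : J, (1 / 2 : ℝ) ^ (F.filter (fun φ => φ ∈ A s)).card ≤
        Fintype.card J * (1 - c / 4) ^ t := by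
  have hn : (0 : ℝ) < Fintype.card V := by exact_mod_cast Fintype.card_pos
  have hJ : (0 : ℝ) < Fintype.card J := by exact_mod_cast Fintype.card_pos
  have hc1 : c ≤ 1 := by
    obtain ⟨s⟩ := ‹Nonempty J›
    have h1 := hA s
    have h2 : ((A s).card : ℝ) ≤ 1 * (Fintype.card V : ℝ) ^ Fintype.card ι := by
      have := card_le_univ (A s)
      rw [Fintype.card_fun] at this
      rw [one_mul]
      exact_mod_cast this
    exact le_of_mul_le_mul_right (h1.trans h2) (by positivity)
  induction t with
  | zero => exact ⟨∅, by simp⟩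
  | succ t ih =>
    have hm : (0:ℝ) ≤ (Fintype.card ι : ℝ) ^ 2 := by positivity
    push_cast at ht
    obtain ⟨F, hF1, hF2, hF3, hF4⟩ := ih (by nlinarith)
    let U : Finset V := F.biUnion (fun φ => univ.image φ)
    have hU : U.card ≤ t * Fintype.card ι := by
      rw [← hF1]
      apply card_biUnion_le_card_mul
      intro φ _
      exact card_image_le
    have hU' : (U.card : ℝ) ≤ t * Fintype.card ι := by exact_mod_cast hU
    let B : J → Finset (ι → V) := fun s =>
      univ.filter (fun φ => φ ∈ A s ∧ Function.Injective φ ∧ ∀ i, φ i ∉ U)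
    have hB : ∀ s, c / 2 * (Fintype.card V : ℝ) ^ Fintype.card ι ≤ (B s).card := by
      intro s
      have h0 := good_tuples U (fun φ => φ ∈ A s) c (by simpa using hA s) (by
        have : (0:ℝ) ≤ Fintype.card ι := by positivity
        nlinarith)
      convert h0
    let BB : Finset (ι → V) := univ.biUnion B
    have hBBne : BB.Nonempty := by
      obtain ⟨s⟩ := ‹Nonempty J›
      have : 0 < (B s).card := by
        have h1 := hB s
        have : (0:ℝ) < (B s).card := lt_of_lt_of_le (by positivity) h1
        exact_mod_cast this
      obtain ⟨x, hx⟩ := card_pos.1 this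
      exact ⟨x, mem_biUnion.2 ⟨s, mem_univ _, hx⟩⟩
    have hBBc : (BB.card : ℝ) ≤ (Fintype.card V : ℝ) ^ Fintype.card ι := by
      have := card_le_univ BB
      rw [Fintype.card_fun] at this
      exact_mod_cast this
    let w : J → ℝ := fun s => (1 / 2 : ℝ) ^ (F.filter (fun φ => φ ∈ A s)).card
    have hw : ∀ s, 0 < w s := fun s => by positivity
    have hex : ∃ x ∈ BB, c / 2 * ∑ s, w s ≤ ∑ s, (if x ∈ B s then w s else 0) := by
      apply exists_le_of_sum_le hBBne
      rw [sum_comm]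
      calc ∑ _x ∈ BB, c / 2 * ∑ s, w s = (BB.card : ℝ) * (c / 2 * ∑ s, w s) := by simp
        _ ≤ (Fintype.card V : ℝ) ^ Fintype.card ι * (c / 2 * ∑ s, w s) := by
          apply mul_le_mul_of_nonneg_right hBBc
          have : 0 ≤ ∑ s, w s := sum_nonneg (fun s _ => (hw s).le)
          positivity
        _ = ∑ s, (c / 2 * (Fintype.card V : ℝ) ^ Fintype.card ι) * w s := by
          rw [← mul_sum]; ring
        _ ≤ ∑ s, ((B s).card : ℝ) * w s :=
          sum_le_sum (fun s _ => mul_le_mul_of_nonneg_right (hB s) (hw s).le)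
        _ = _ := by
          apply sum_congr rfl
          intro s _
          rw [← sum_filter]
          have : BB.filter (fun x => x ∈ B s) = B s := by
            ext x
            simp only [mem_filter, BB, mem_biUnion, mem_univ, true_and]
            exact ⟨fun h => h.2, fun h => ⟨⟨s, h⟩, h⟩⟩
          rw [this]; simp
    obtain ⟨x, hx, hxs⟩ := hex
    have hxinj : Function.Injective x ∧ (∃ s, x ∈ A s) ∧ ∀ i, x i ∉ U := by
      simp only [BB, B, mem_biUnion, mem_univ, true_and, mem_filter] at hx
      obtain ⟨s, h1, h2, h3⟩ := hx
      exact ⟨h2, ⟨s, h1⟩, h3⟩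
    have hUmem : ∀ φ ∈ F, ∀ i, φ i ∈ U := by
      intro φ hφ i
      exact mem_biUnion.2 ⟨φ, hφ, mem_image.2 ⟨i, mem_univ _, rfl⟩⟩
    have hxF : x ∉ F := by
      intro h
      obtain ⟨i⟩ := ‹Nonempty ι›
      exact hxinj.2.2 i (hUmem x h i)
    refine ⟨insert x F, by rw [card_insert_of_notMem hxF, hF1], ?_, ?_, ?_⟩
    · intro φ hφ
      rcases mem_insert.1 hφ with rfl | hφ
      · exact ⟨hxinj.1, hxinj.2.1⟩
      · exact hF2 φ hφ
    · intro φ hφ ψ hψ hne i j heq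
      rcases mem_insert.1 hφ with rfl | hφ2
      · rcases mem_insert.1 hψ with rfl | hψ
        · exact hne rfl
        · exact hxinj.2.2 i (heq ▸ hUmem ψ hψ j)
      · rcases mem_insert.1 hψ with rfl | hψ
        · exact hxinj.2.2 j (heq ▸ hUmem φ hφ2 i)
        · exact hF3 φ hφ2 ψ hψ hne i j heq
    · have hstep : ∀ s, (1 / 2 : ℝ) ^ ((insert x F).filter (fun φ => φ ∈ A s)).card ≤
          w s - 1 / 2 * (if x ∈ B s then w s else 0) := by
        intro s
        by_cases hxA : x ∈ A s
        · rw [filter_insert, if_pos hxA, card_insert_of_notMem (by simp [hxF]), pow_succ]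
          have := hw s
          show w s * (1 / 2) ≤ _
          split_ifs <;> linarith
        · rw [filter_insert, if_neg hxA, if_neg]
          · simp [w]
          · simp [B, hxA]
      calc _ ≤ ∑ s, (w s - 1 / 2 * (if x ∈ B s then w s else 0)) := sum_le_sum (fun s _ => hstep s)
        _ = ∑ s, w s - 1 / 2 * ∑ s, (if x ∈ B s then w s else 0) := by
          rw [sum_sub_distrib, mul_sum]
        _ ≤ (∑ s, w s) * (1 - c / 4) := by linarith
        _ ≤ (Fintype.card J * (1 - c / 4) ^ t) * (1 - c / 4) := by
          apply mul_le_mul_of_nonneg_right hF4; linarith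
        _ = _ := by ring

open Classical in
theorem select (ι : Type) [Fintype ι] [Nonempty ι] (q : ℕ) (c τ : ℝ) (hc : 0 < c) (hτ : 0 < τ)
    (h : 2 * (Fintype.card ι : ℝ) ^ 2 * τ ≤ c) :
    ∃ n0 : ℕ, ∀ n ≥ n0, ∀ (J : Type) [Fintype J], Fintype.card J ≤ n ^ q →
      ∀ A : J → Finset (ι → Fin n),
      (∀ s, c * (n : ℝ) ^ Fintype.card ι ≤ (A s).card) →
      ∃ F : Finset (ι → Fin n), (F.card : ℝ) ≤ τ * n ∧
        (∀ φ ∈ F, Function.Injective φ ∧ ∃ s, φ ∈ A s) ∧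
        (∀ φ ∈ F, ∀ ψ ∈ F, φ ≠ ψ → ∀ i j, φ i ≠ ψ j) ∧
        ∀ s, c * τ / 16 * n ≤ ((F.filter (fun φ => φ ∈ A s)).card : ℝ) := by
  have hlim : ∀ᶠ n : ℕ in Filter.atTop, ((n : ℝ) ^ q) ≤ Real.exp (c * τ / 16 * n) := by
    have h1 := (isLittleO_pow_exp_pos_mul_atTop q (show 0 < c * τ / 16 by positivity)).bound
      (show (0:ℝ) < 1 by norm_num)
    have h2 := tendsto_natCast_atTop_atTop (R := ℝ) |>.eventually h1
    filter_upwards [h2] with n hn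
    have h3 : (0:ℝ) ≤ (n:ℝ) ^ q := by positivity
    rw [Real.norm_of_nonneg h3, Real.norm_of_nonneg (Real.exp_pos _).le, one_mul] at hn
    exact hn
  obtain ⟨n1, hn1⟩ := Filter.eventually_atTop.1 hlim
  refine ⟨max 1 (max n1 ⌈2 / τ⌉₊), ?_⟩
  intro n hn J _ hJ A hA
  have h1n : 1 ≤ n := le_trans (le_max_left _ _) hn
  have hnpos : (0:ℝ) < n := by exact_mod_cast h1n
  have h2n : n1 ≤ n := le_trans ((le_max_left _ _).trans (le_max_right _ _)) hn
  have h3n : 2 / τ ≤ n := (Nat.le_ceil _).trans (by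
    exact_mod_cast (le_trans ((le_max_right _ _).trans (le_max_right _ _)) hn))
  rw [div_le_iff₀ hτ] at h3n
  rcases isEmpty_or_nonempty J with hJe | hJn
  · exact ⟨∅, by simp; positivity, by simp, by simp, fun s => (hJe.false s).elim⟩
  have : Nonempty (Fin n) := ⟨⟨0, h1n⟩⟩
  set t := ⌊τ * n⌋₊ with htdef
  have ht1 : (t : ℝ) ≤ τ * n := Nat.floor_le (by positivity)
  have ht2 : τ * n < t + 1 := Nat.lt_floor_add_one _
  have ht3 : τ * n / 2 ≤ t := by linarith
  have hm : (0:ℝ) ≤ (Fintype.card ι : ℝ) ^ 2 := by positivity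
  have hJpos : (0 : ℝ) < Fintype.card J := by exact_mod_cast Fintype.card_pos
  obtain ⟨F, hF1, hF2, hF3, hF4⟩ := select0 A c hc (by simpa using hA) t (by
    rw [Fintype.card_fin]
    calc 2 * (Fintype.card ι : ℝ) ^ 2 * t ≤ 2 * (Fintype.card ι : ℝ) ^ 2 * (τ * n) := by gcongr
      _ = (2 * (Fintype.card ι : ℝ) ^ 2 * τ) * n := by ring
      _ ≤ c * n := by gcongr)
  have hc1 : c ≤ 1 := by
    obtain ⟨s⟩ := hJn
    have h1 := hA s
    have h2 : ((A s).card : ℝ) ≤ 1 * (n : ℝ) ^ Fintype.card ι := by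
      have := card_le_univ (A s)
      rw [Fintype.card_fun, Fintype.card_fin] at this
      rw [one_mul]
      exact_mod_cast this
    exact le_of_mul_le_mul_right (h1.trans h2) (by positivity)
  refine ⟨F, by rw [hF1]; exact ht1, hF2, hF3, ?_⟩
  intro s
  by_contra hlt
  push Not at hlt
  set hh := (F.filter (fun φ => φ ∈ A s)).card with hhdef
  have h5 : (1 / 2 : ℝ) ^ hh ≤ Fintype.card J * (1 - c / 4) ^ t := by
    have hF5 : ∑ s : J, (1 / 2 : ℝ) ^ (F.filter (fun φ => φ ∈ A s)).card ≤
        Fintype.card J * (1 - c / 4) ^ t := by convert hF4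
    refine le_trans ?_ hF5
    have h51 := single_le_sum (s := (univ : Finset J))
      (f := fun s => (1 / 2 : ℝ) ^ (F.filter (fun φ => φ ∈ A s)).card)
      (fun s _ => pow_nonneg (by norm_num) _) (mem_univ s)
    exact h51
  have h6 : (1 - c / 4) ^ t ≤ Real.exp (-(c * τ / 8 * n)) := by
    calc (1 - c / 4) ^ t ≤ (Real.exp (-(c / 4))) ^ t := by
          apply pow_le_pow_left₀ (by linarith)
          have := Real.add_one_le_exp (-(c / 4))
          linarith
      _ = Real.exp (-(c / 4) * t) := by rw [← Real.exp_nat_mul]; congr 1; ring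
      _ ≤ _ := by
          apply Real.exp_le_exp.2
          nlinarith
  have h7 : Real.exp (-(c * τ / 16 * n)) < (1 / 2 : ℝ) ^ hh := by
    calc Real.exp (-(c * τ / 16 * n)) < Real.exp (-(hh : ℝ)) := Real.exp_lt_exp.2 (by linarith)
      _ = (Real.exp (-1)) ^ hh := by rw [← Real.exp_nat_mul]; congr 1; ring
      _ ≤ _ := by
          apply pow_le_pow_left₀ (Real.exp_pos _).le
          have := Real.add_one_le_exp (1:ℝ)
          rw [Real.exp_neg, one_div]
          apply inv_anti₀ (by norm_num); linarith
  have h8 : (Fintype.card J : ℝ) ≤ Real.exp (c * τ / 16 * n) := by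
    refine le_trans ?_ (hn1 n h2n)
    exact_mod_cast hJ
  have h9 : (Fintype.card J : ℝ) * (1 - c / 4) ^ t ≤ Real.exp (-(c * τ / 16 * n)) := by
    calc _ ≤ Real.exp (c * τ / 16 * n) * Real.exp (-(c * τ / 8 * n)) := by
          apply mul_le_mul h8 h6 (pow_nonneg (by linarith) _) (Real.exp_pos _).le
      _ = _ := by rw [← Real.exp_add]; congr 1; ring
  linarith

/-- injective choice from large families -/
theorem hall_choice {β : Type*} [DecidableEq β] {N : ℕ} (S : Fin N → Finset β)
    (h : ∀ i, N ≤ (S i).card) : ∃ f : Fin N → β, Function.Injective f ∧ ∀ i, f i ∈ S i := by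
  apply (Finset.all_card_le_biUnion_card_iff_exists_injective S).1
  intro s
  rcases s.eq_empty_or_nonempty with rfl | ⟨i, hi⟩
  · simp
  · calc s.card ≤ N := by simpa using card_le_univ s
      _ ≤ (S i).card := h i
      _ ≤ _ := card_le_card (subset_biUnion_of_mem S hi)

end HC
end

section
namespace HC

theorem ok_of_surj {r k j : ℕ} {Q : ℕ → Finset ℕ} {b : List ℕ} (hb : b.length = k) (hj : j < r)
    (hcard : (insert j (Q j)).card = k) (h : ∀ x ∈ insert j (Q j), x ∈ b) : Ok r Q b := by
  have hsub : insert j (Q j) ⊆ b.toFinset := fun x hx => List.mem_toFinset.2 (h x hx)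
  have h1 : b.toFinset.card ≤ b.length := List.toFinset_card_le b
  have h2 : b.toFinset = insert j (Q j) := (eq_of_subset_of_card_le hsub (by omega)).symm
  refine ⟨?_, j, hj, h2⟩
  have h3 : b.toFinset.card = b.length := by rw [h2, hcard, hb]
  exact Multiset.coe_nodup.1 ((Multiset.toFinset_card_eq_card_iff_nodup (m := (b : Multiset ℕ))).1 h3)

/-- constraint sets of the connecting gadget -/
def Qc (k l d j : ℕ) : Finset ℕ :=
  if j < k then
    if j = k - 1 then range (k - 1)
    else if d ∣ j + 1 then Ico (3 * k + (j + 1 - d)) (3 * k + l) ∪ range j else ∅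
  else if j < 2 * k then
    if j = 2 * k - 1 then Ico k (2 * k - 1)
    else if d ∣ j - k + 1 then Ico (3 * k + l) (3 * k + l + (k - (j - k + 1))) ∪ Ico k j else ∅
  else Ico (2 * k - (j - 2 * k)) (2 * k) ∪ Ico (j - 2 * k + 1) k

def rhoc (k d c : ℕ) : ℕ := if d ∣ c + (2 * c + 1) * k then 2 * c + 2 else 2 * c + 1

theorem rhoc_spec {k d c : ℕ} (hnd : ¬ d ∣ k) : ¬ d ∣ c + rhoc k d c * k := by
  unfold rhoc
  split_ifs with h
  · intro h2
    apply hnd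
    have : c + (2 * c + 2) * k = c + (2 * c + 1) * k + k := by ring
    rw [this] at h2
    exact (Nat.dvd_add_right h).1 h2
  · exact h

theorem rhoc_bounds (k d c : ℕ) : 2 * c + 1 ≤ rhoc k d c ∧ rhoc k d c ≤ 2 * c + 2 := by
  unfold rhoc; split_ifs <;> omega

def midlab (k d i : ℕ) : ℕ :=
  if i / k < rhoc k d (i % k) then i % k
  else if i / k < rhoc k d (i % k + 1) then 2 * k + i % k
  else k + (k - 1 - i % k)

def mc (k d : ℕ) : ℕ := k * (d * (2 * k + 3) - 1)

def labc (k l d p : ℕ) : ℕ :=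
  if p < l then 3 * k + p else if p < l + mc k d then midlab k d (p - l)
  else 3 * k + l + (p - l - mc k d)

theorem Qc_ok {k l d : ℕ} (hk : k = l + d) (hd : 0 < d) : ∀ j < 3 * k, ∀ x ∈ Qc k l d j,
    x < j ∨ (3 * k ≤ x ∧ x < 3 * k + 2 * l) := by
  intro j hj x hx
  unfold Qc at hx
  split_ifs at hx with h1 h2 h3 h4 h5 h6
  · simp at hx; omega
  · simp at hx
    have := Nat.le_of_dvd (by omega) h3
    omega
  · simp at hx
  · simp at hx; omega
  · simp at hx
    have := Nat.le_of_dvd (by omega) h6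
    omega
  · simp at hx
  · simp at hx; omega

theorem insert_Qc_card {k l d j : ℕ} (hk : k = l + d) (hd : 0 < d) (hl : 0 < l)
    (h : (j < k ∧ (j = k - 1 ∨ d ∣ j + 1)) ∨ (k ≤ j ∧ j < 2 * k ∧ (j = 2 * k - 1 ∨ d ∣ j - k + 1)) ∨
      (2 * k ≤ j ∧ j < 3 * k)) : (insert j (Qc k l d j)).card = k := by
  rw [card_insert_of_notMem]
  · unfold Qc
    split_ifs with h1 h2 h3 h4 h5 h6
    · simp; omega
    · have := Nat.le_of_dvd (by omega) h3
      rw [card_union_of_disjoint]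
      · simp; omega
      · rw [disjoint_left]; intro x; simp; omega
    · omega
    · simp; omega
    · have := Nat.le_of_dvd (by omega) h6
      rw [card_union_of_disjoint]
      · simp; omega
      · rw [disjoint_left]; intro x; simp; omega
    · omega
    · rw [card_union_of_disjoint]
      · simp; omega
      · rw [disjoint_left]; intro x; simp; omega
  · intro hmem
    rcases Qc_ok hk hd j (by omega) j hmem with h | h <;> omega

/-- in any window of length k there is a position with given residue -/
theorem exists_pos (k i c : ℕ) (hc : c < k) : ∃ u, i ≤ u ∧ u < i + k ∧ u % k = c ∧ u = u / k * k + c := by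
  have hk : 0 < k := by omega
  have h1 := Nat.div_add_mod i k
  have h2 := Nat.mod_lt i hk
  set q := i / k
  set e := i % k
  by_cases h : e ≤ c
  · refine ⟨k * q + c, by omega, by omega, ?_, ?_⟩
    · rw [Nat.mul_add_mod, Nat.mod_eq_of_lt hc]
    · rw [Nat.mul_add_div hk, Nat.div_eq_of_lt hc, mul_comm]; rfl
  · refine ⟨k * (q + 1) + c, by rw [mul_add]; omega, by rw [mul_add]; omega, ?_, ?_⟩
    · rw [Nat.mul_add_mod, Nat.mod_eq_of_lt hc]
    · rw [Nat.mul_add_div hk, Nat.div_eq_of_lt hc, mul_comm]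

/-- passed positions -/
theorem pos_lt_iff {k i u q c : ℕ} (hc : c < k) (h1 : i ≤ u) (h2 : u < i + k) (hu : u = q * k + c) (ρ : ℕ) :
    q < ρ ↔ i + k ≤ c + ρ * k := by
  constructor
  · intro h
    have : (q + 1) * k ≤ ρ * k := Nat.mul_le_mul_right _ h
    rw [add_mul] at this
    omega
  · intro h
    by_contra hn
    have : ρ * k ≤ q * k := Nat.mul_le_mul_right _ (by omega)
    omega

theorem connect_mid {k l d : ℕ} (hk : k = l + d) (hd : 0 < d) (hl : 0 < l) (hnd : ¬ d ∣ k) (i : ℕ)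
    (hi : d ∣ i + k) : Ok (3 * k) (Qc k l d) ((List.range' i k).map (midlab k d)) := by
  have hk0 : 0 < k := by omega
  let T : ℕ → ℕ := fun c => c + rhoc k d c * k
  have hT : StrictMono T := by
    apply strictMono_nat_of_lt_succ
    intro c
    have h1 := rhoc_bounds k d c
    have h2 := rhoc_bounds k d (c + 1)
    have : rhoc k d c * k ≤ rhoc k d (c + 1) * k := Nat.mul_le_mul_right _ (by omega)
    show c + _ < c + 1 + _
    omega
  have hTne : ∀ c, T c ≠ i + k := by
    intro c h
    exact rhoc_spec hnd (c := c) (by rw [show c + rhoc k d c * k = i + k from h]; exact hi)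
  -- label values
  have hx : ∀ c < k, i + k < T c → c ∈ (List.range' i k).map (midlab k d) := by
    intro c hc h
    obtain ⟨u, h1, h2, h3, h4⟩ := exists_pos k i c hc
    rw [List.mem_map]
    refine ⟨u, List.mem_range'_1.2 ⟨h1, h2⟩, ?_⟩
    unfold midlab
    rw [h3, if_pos]
    exact (pos_lt_iff hc h1 h2 h4 _).2 h.le
  have hz : ∀ c < k, T c < i + k → i + k < T (c + 1) → 2 * k + c ∈ (List.range' i k).map (midlab k d) := by
    intro c hc h h'
    obtain ⟨u, h1, h2, h3, h4⟩ := exists_pos k i c hc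
    rw [List.mem_map]
    refine ⟨u, List.mem_range'_1.2 ⟨h1, h2⟩, ?_⟩
    unfold midlab
    rw [h3, if_neg, if_pos]
    · apply (pos_lt_iff hc h1 h2 h4 _).2
      have : T (c + 1) = c + 1 + rhoc k d (c + 1) * k := rfl
      omega
    · rw [pos_lt_iff hc h1 h2 h4]
      have : T c = c + rhoc k d c * k := rfl
      omega
  have hy : ∀ c < k, T (c + 1) < i + k → k + (k - 1 - c) ∈ (List.range' i k).map (midlab k d) := by
    intro c hc h
    obtain ⟨u, h1, h2, h3, h4⟩ := exists_pos k i c hc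
    rw [List.mem_map]
    refine ⟨u, List.mem_range'_1.2 ⟨h1, h2⟩, ?_⟩
    have h5 := hT (show c < c + 1 by omega)
    unfold midlab
    rw [h3, if_neg, if_neg]
    · rw [pos_lt_iff hc h1 h2 h4]
      have : T (c + 1) = c + 1 + rhoc k d (c + 1) * k := rfl
      omega
    · rw [pos_lt_iff hc h1 h2 h4]
      have : T c = c + rhoc k d c * k := rfl
      omega
  have hlen : ((List.range' i k).map (midlab k d)).length = k := by simp
  by_cases h0 : i + k < T 0
  · refine ok_of_surj (j := k - 1) hlen (by omega) (insert_Qc_card hk hd hl (by omega)) ?_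
    intro x hxm
    have : x < k := by
      unfold Qc at hxm
      simp [hk0] at hxm; omega
    exact hx x this (lt_of_lt_of_le h0 (hT.monotone (Nat.zero_le _)))
  by_cases hkk : T k < i + k
  · refine ok_of_surj (j := 2 * k - 1) hlen (by omega) (insert_Qc_card hk hd hl (by omega)) ?_
    intro x hxm
    have h1 : k ≤ x ∧ x < 2 * k := by
      unfold Qc at hxm
      rw [if_neg (by omega), if_pos (by omega), if_pos rfl] at hxm
      simp at hxm; omega
    have := hy (2 * k - 1 - x) (by omega) (lt_of_le_of_lt (hT.monotone (by omega)) hkk)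
    convert this using 1
    omega
  · have hex : ∃ c, i + k < T c := ⟨k, by have := hTne k; omega⟩
    have hfind := Nat.find_spec hex
    have hmin := fun m => Nat.find_min hex (m := m)
    set t' := Nat.find hex
    have ht0 : t' ≠ 0 := by intro h; rw [h] at hfind; exact h0 hfind
    have htk : t' ≤ k := by
      by_contra h
      have := hmin k (by omega)
      have := hTne k
      omega
    obtain ⟨t, ht⟩ : ∃ t, t' = t + 1 := ⟨t' - 1, by omega⟩
    have hpt : T t < i + k := by
      have h1 := hmin t (by omega)
      have := hTne t
      omega
    rw [ht] at hfind
    refine ok_of_surj (j := 2 * k + t) hlen (by omega) (insert_Qc_card hk hd hl (by omega)) ?_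
    intro x hxm
    rw [mem_insert] at hxm
    rcases hxm with rfl | hxm
    · exact hz t (by omega) hpt hfind
    · unfold Qc at hxm
      rw [if_neg (by omega), if_neg (by omega)] at hxm
      simp only [mem_union, mem_Ico] at hxm
      rcases hxm with h | h
      · have := hy (2 * k - 1 - x) (by omega) (lt_of_le_of_lt (hT.monotone (by omega)) hpt)
        convert this using 1
        omega
      · exact hx x (by omega) (lt_of_lt_of_le hfind (hT.monotone (by omega)))

theorem mc_dvd {k d : ℕ} (hd : 0 < d) : d ∣ mc k d + k := by
  have : mc k d + k = d * (k * (2 * k + 3)) := by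
    unfold mc
    have h1 : 1 ≤ d * (2 * k + 3) := Nat.mul_pos hd (by omega)
    obtain ⟨R, hR⟩ : ∃ R, d * (2 * k + 3) = R + 1 := ⟨d * (2 * k + 3) - 1, by omega⟩
    calc k * (d * (2 * k + 3) - 1) + k = k * (d * (2 * k + 3)) := by rw [hR]; simp; ring
      _ = _ := by ring
  rw [this]; exact dvd_mul_right _ _

theorem mc_ge {k d : ℕ} (hd : 2 ≤ d) (hk : 0 < k) : ∃ R, mc k d = k * (R + 1) ∧ 2 * k + 2 ≤ R := by
  refine ⟨d * (2 * k + 3) - 1 - 1, ?_, ?_⟩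
  · unfold mc
    have : 2 * (2 * k + 3) ≤ d * (2 * k + 3) := Nat.mul_le_mul_right _ hd
    congr 1; omega
  · have : 2 * (2 * k + 3) ≤ d * (2 * k + 3) := Nat.mul_le_mul_right _ hd
    omega

theorem connect_labels {k l d : ℕ} (hk : k = l + d) (hd : 2 ≤ d) (hl : 0 < l) (hnd : ¬ d ∣ k) :
    WinP k d (Ok (3 * k) (Qc k l d)) ((List.range (l + mc k d + l)).map (labc k l d)) := by
  have hk0 : 0 < k := by omega
  apply WinP.ofFun
  intro j hj
  obtain ⟨R, hR, hR2⟩ := mc_ge (k := k) hd hk0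
  have hmk : 2 * k ≤ mc k d := by
    rw [hR]
    calc 2 * k = k * 2 := by ring
      _ ≤ _ := Nat.mul_le_mul_left _ (by omega)
  have hdm := mc_dvd (k := k) (d := d) (by omega)
  set m := mc k d with hm
  set s := j * d with hs
  have hds : d ∣ s := dvd_mul_left _ _
  have hlen : ((List.range' s k).map (labc k l d)).length = k := by simp
  rcases lt_or_ge s l with h1 | h1
  · -- start window
    have hdh : d ∣ s + d := dvd_add hds dvd_rfl
    have e1 : s + d - 1 + 1 = s + d := by omega
    refine ok_of_surj (j := s + d - 1) hlen (by omega)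
      (insert_Qc_card hk (by omega) hl (Or.inl ⟨by omega, Or.inr (by rw [e1]; exact hdh)⟩)) ?_
    intro x hx
    have hx' : x < s + d ∨ (3 * k + s ≤ x ∧ x < 3 * k + l) := by
      unfold Qc at hx
      rw [if_pos (by omega), if_neg (by omega), if_pos (by rw [e1]; exact hdh)] at hx
      simp at hx
      omega
    rw [List.mem_map]
    rcases hx' with h | h
    · refine ⟨l + x, List.mem_range'_1.2 (by omega), ?_⟩
      unfold labc
      rw [if_neg (by omega), if_pos (by omega), Nat.add_sub_cancel_left]
      unfold midlab
      rw [Nat.mod_eq_of_lt (by omega), Nat.div_eq_of_lt (by omega), if_pos]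
      have := rhoc_bounds k d x
      omega
    · refine ⟨x - 3 * k, List.mem_range'_1.2 (by omega), ?_⟩
      unfold labc
      rw [if_pos (by omega)]
      omega
  · obtain ⟨i, hi⟩ : ∃ i, s = l + i := ⟨s - l, by omega⟩
    have hdi : d ∣ i + k := by
      have : i + k = s + d := by omega
      rw [this]; exact dvd_add hds dvd_rfl
    rcases le_or_gt (i + k) m with h2 | h2
    · have := connect_mid hk (by omega) hl hnd i hdi
      convert this using 1
      rw [hi, ← List.map_add_range', List.map_map]
      apply List.map_congr_left
      intro u hu
      rw [List.mem_range'_1] at hu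
      simp only [Function.comp]
      unfold labc
      rw [if_neg (by omega), if_pos (by omega), Nat.add_sub_cancel_left]
    · obtain ⟨h, hh⟩ : ∃ h, m = i + h := ⟨m - i, by omega⟩
      have hdh : d ∣ h := by
        have : m + k = (i + k) + h := by omega
        rw [this] at hdm
        exact (Nat.dvd_add_right hdi).1 hdm
      have hhd : d ≤ h := Nat.le_of_dvd (by omega) hdh
      have e1 : k + h - 1 - k + 1 = h := by omega
      refine ok_of_surj (j := k + h - 1) hlen (by omega)
        (insert_Qc_card hk (by omega) hl (Or.inr (Or.inl ⟨by omega, by omega, Or.inr (by rw [e1]; exact hdh)⟩))) ?_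
      intro x hx
      have hx' : (k ≤ x ∧ x < k + h) ∨ (3 * k + l ≤ x ∧ x < 3 * k + l + (k - h)) := by
        unfold Qc at hx
        rw [if_neg (by omega), if_pos (by omega), if_neg (by omega), if_pos (by rw [e1]; exact hdh), e1] at hx
        simp at hx
        omega
      rw [List.mem_map]
      rcases hx' with h' | h'
      · refine ⟨l + (m - 1 - (x - k)), List.mem_range'_1.2 (by omega), ?_⟩
        unfold labc
        rw [if_neg (by omega), if_pos (by omega), Nat.add_sub_cancel_left]
        have e2 : m - 1 - (x - k) = k * R + (2 * k - 1 - x) := by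
          rw [hR, mul_add]; omega
        rw [e2]
        have e3 : (k * R + (2 * k - 1 - x)) % k = 2 * k - 1 - x := by
          rw [Nat.mul_add_mod, Nat.mod_eq_of_lt (by omega)]
        have e4 : (k * R + (2 * k - 1 - x)) / k = R := by
          rw [Nat.mul_add_div hk0, Nat.div_eq_of_lt (by omega), add_zero]
        unfold midlab
        rw [e3, e4]
        have b1 := rhoc_bounds k d (2 * k - 1 - x)
        have b2 := rhoc_bounds k d (2 * k - 1 - x + 1)
        rw [if_neg (by omega), if_neg (by omega)]
        omega
      · refine ⟨l + m + (x - (3 * k + l)), List.mem_range'_1.2 (by omega), ?_⟩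
        unfold labc
        rw [if_neg (by omega), if_neg (by omega)]
        omega

end HC
end

section
namespace HC

theorem val_fixed {V κ : Type*} {r : ℕ} {fixed : ℕ → V} {φ : Fin r × κ → V} {a : ℕ} (b : κ)
    (h : r ≤ a) : val r fixed φ (a, b) = fixed a := by
  unfold val
  rw [dif_neg]
  exact not_lt.2 h

theorem val_var {V κ : Type*} {r : ℕ} {fixed : ℕ → V} {φ : Fin r × κ → V} {a : ℕ} (b : κ)
    (h : a < r) : val r fixed φ (a, b) = φ (⟨a, h⟩, b) := by
  unfold val
  rw [dif_pos h]

open Classical in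
/-- Connecting lemma: many connectors between any two disjoint ends. -/
theorem connect {k l d : ℕ} (hk : k = l + d) (hd : 2 ≤ d) (hl : 0 < l) (hnd : ¬ d ∣ k)
    (μ : ℝ) (hμ : 0 < μ) (hμ1 : μ ≤ 1) :
    ∃ m0 : ℕ, d ∣ l + m0 ∧ ∃ (N : ℕ), 0 < N ∧ ∃ c > (0:ℝ), ∃ β > (0:ℝ), ∃ n0 : ℕ, ∀ n ≥ n0,
      ∀ H : Finset (Finset (Fin n)), Cod k H (μ * n) →
      ∀ S T : List (Fin n), S.length = l → T.length = l → (S ++ T).Nodup →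
      ∀ W : Finset (Fin n), (W.card : ℝ) ≤ β * n →
      c * (n : ℝ) ^ (3 * k * N) ≤
        ((univ : Finset (Fin (3 * k) × Fin N → Fin n)).filter (fun φ =>
          (∃ C : List (Fin n), C.Nodup ∧ C.length = m0 ∧ (∀ x ∈ C, ∃ i, φ i = x) ∧
            Win k d H (S ++ C ++ T)) ∧ Function.Injective φ ∧ ∀ i, φ i ∉ W)).card := by
  have hk0 : 0 < k := by omega
  obtain ⟨R, hR, hR2⟩ := mc_ge (k := k) hd hk0
  have hmpos : 0 < mc k d := by rw [hR]; positivity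
  have : Nonempty (Fin (mc k d)) := ⟨⟨0, hmpos⟩⟩
  obtain ⟨c, hc, β, hβ, n0, h⟩ := template (Fin (mc k d)) k (3 * k) (2 * l) (by omega) μ hμ
  refine ⟨mc k d, ?_, mc k d, hmpos, c, hc, β, hβ, max n0 1, ?_⟩
  · have h1 := mc_dvd (k := k) (d := d) (by omega)
    have : mc k d + k = (l + mc k d) + d := by omega
    rw [this] at h1
    exact (Nat.dvd_add_left dvd_rfl).1 h1
  intro n hn H hH S T hS hT hST W hW
  have hn1 : 0 < n := lt_of_lt_of_le one_pos ((le_max_right _ _).trans hn)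
  let fixed : ℕ → Fin n := fun p => if h : p - 3 * k < (S ++ T).length then (S ++ T)[p - 3 * k] else ⟨0, hn1⟩
  have hlen : (S ++ T).length = 2 * l := by simp [hS, hT]; omega
  have hfix : Set.InjOn fixed (Set.Ico (3 * k) (3 * k + 2 * l)) := by
    intro x hx y hy hxy
    simp only [Set.mem_Ico] at hx hy
    simp only [fixed] at hxy
    rw [dif_pos (by omega), dif_pos (by omega)] at hxy
    have := (List.Nodup.getElem_inj_iff hST).1 hxy
    omega
  have h1 := h n ((le_max_left _ _).trans hn) H hH hμ1 (Qc k l d) (Qc_ok hk (by omega)) fixed hfix W hW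
  rw [Fintype.card_fin] at h1
  refine h1.trans ?_
  norm_cast
  apply card_le_card
  intro φ hφ
  simp only [mem_filter, mem_univ, true_and] at hφ ⊢
  obtain ⟨hsat, hinj, hav⟩ := hφ
  refine ⟨?_, hinj, hav⟩
  let cp : ℕ → Fin (mc k d) := fun p => ⟨(p - l) % mc k d, Nat.mod_lt _ hmpos⟩
  let w : List (ℕ × Fin (mc k d)) := (List.range (l + mc k d + l)).map (fun p => (labc k l d p, cp p))
  have hw := lift_win (Qc_ok hk (by omega)) hsat w (by
    have := connect_labels hk hd hl hnd
    simpa [w, Function.comp_def] using this)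
  let f : ℕ → Fin n := fun p => val (3 * k) fixed φ (labc k l d p, cp p)
  have hwf : w.map (val (3 * k) fixed φ) = (List.range (l + mc k d + l)).map f := by
    simp [w, f, Function.comp_def]
  have hlab : ∀ i < mc k d, labc k l d (l + i) < 3 * k := by
    intro i hi
    unfold labc
    rw [if_neg (by omega), if_pos (by omega)]
    unfold midlab
    have := Nat.mod_lt (l + i - l) hk0
    split_ifs <;> omega
  let C : List (Fin n) := (List.range (mc k d)).map (fun i => f (l + i))
  have hfC : ∀ i (hi : i < mc k d), f (l + i) = φ (⟨labc k l d (l + i), hlab i hi⟩, ⟨i, hi⟩) := by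
    intro i hi
    simp only [f]
    rw [val_var _ (hlab i hi)]
    simp only [cp, Nat.add_sub_cancel_left, Nat.mod_eq_of_lt hi]
  refine ⟨C, ?_, by simp [C], ?_, ?_⟩
  · apply List.Nodup.map_on _ List.nodup_range
    intro i hi j hj hij
    rw [List.mem_range] at hi hj
    rw [hfC i hi, hfC j hj] at hij
    have := hinj hij
    rw [Prod.mk.injEq] at this
    exact congrArg Fin.val this.2
  · intro x hx
    obtain ⟨i, hi, rfl⟩ := List.mem_map.1 hx
    rw [List.mem_range] at hi
    exact ⟨_, (hfC i hi).symm⟩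
  · rw [hwf] at hw
    convert hw using 1
    rw [List.range_add, List.range_add, List.map_append, List.map_append]
    congr 1
    · congr 1
      · apply List.ext_getElem
        · simp [hS]
        · intro i h1 h2
          have hi : i < l := by omega
          have e1 : labc k l d i = 3 * k + i := by unfold labc; rw [if_pos hi]
          simp only [List.getElem_map, List.getElem_range, f]
          rw [val_fixed _ (by omega)]
          simp only [fixed, e1]
          rw [dif_pos (by omega)]
          simp only [Nat.add_sub_cancel_left]
          rw [List.getElem_append_left]
      · simp [C, Function.comp_def]
    · apply List.ext_getElem
      · simp [hT]
      · intro i h1 h2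
        have hi : i < l := by omega
        have e1 : labc k l d (l + mc k d + i) = 3 * k + l + i := by
          unfold labc; rw [if_neg (by omega), if_neg (by omega)]; omega
        simp only [List.getElem_map, List.getElem_range, f]
        rw [val_fixed _ (by omega)]
        simp only [fixed, e1]
        rw [dif_pos (by omega)]
        rw [List.getElem_append_right (by omega)]
        congr 1
        omega

end HC
end

section
namespace HC

theorem mod_unique {m t t' : ℕ} (h : t % m = t' % m) (h1 : t < t' + m) (h2 : t' < t + m) : t = t' := by
  have e1 := Nat.div_add_mod t m
  have e2 := Nat.div_add_mod t' m
  rcases lt_trichotomy (t / m) (t' / m) with h3 | h3 | h3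
  · have : m * (t / m + 1) ≤ m * (t' / m) := Nat.mul_le_mul_left _ h3
    rw [mul_add] at this; omega
  · rw [h3] at e1; omega
  · have : m * (t' / m + 1) ≤ m * (t / m) := Nat.mul_le_mul_left _ h3
    rw [mul_add] at this; omega

theorem exists_count {p : ℕ → Prop} [DecidablePred p] {s e ρ : ℕ} (h1 : Nat.count p s ≤ ρ)
    (h2 : ρ < Nat.count p e) : ∃ t, s ≤ t ∧ t < e ∧ p t ∧ Nat.count p t = ρ := by
  have hex : ∃ t, ρ < Nat.count p (t + 1) := ⟨e, lt_of_lt_of_le h2 (Nat.count_monotone p (by omega))⟩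
  have hs := Nat.find_spec hex
  have hm := fun m => Nat.find_min hex (m := m)
  set t := Nat.find hex
  have h3 : Nat.count p t ≤ ρ := by
    rcases Nat.eq_zero_or_pos t with h | h
    · rw [h]; simp
    · have := hm (t - 1) (by omega)
      rw [show t - 1 + 1 = t by omega] at this
      omega
  rw [Nat.count_succ] at hs
  refine ⟨t, ?_, ?_, ?_, ?_⟩
  · by_contra hlt
    have := Nat.count_monotone p (show t + 1 ≤ s by omega)
    rw [Nat.count_succ] at this
    omega
  · by_contra hlt
    have := Nat.count_monotone p (show e ≤ t by omega)
    omega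
  · by_contra hp
    rw [if_neg hp] at hs; omega
  · split_ifs at hs <;> omega

theorem count_window {p : ℕ → Prop} [DecidablePred p] (s k : ℕ) :
    Nat.count p (s + k) = Nat.count p s + ((Ico s (s + k)).filter p).card := by
  rw [Nat.count_eq_card_filter_range, Nat.count_eq_card_filter_range, ← card_union_of_disjoint]
  · congr 1
    ext t
    simp only [mem_filter, mem_range, mem_union, mem_Ico]
    constructor
    · rintro ⟨h1, h2⟩
      by_cases h : t < s
      · exact Or.inl ⟨h, h2⟩
      · exact Or.inr ⟨⟨by omega, h1⟩, h2⟩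
    · rintro (⟨h1, h2⟩ | ⟨h1, h2⟩)
      · exact ⟨by omega, h2⟩
      · exact ⟨by omega, h2⟩
  · rw [disjoint_left]
    intro t
    simp only [mem_filter, mem_range, mem_Ico]
    rintro ⟨h1, _⟩ ⟨h2, _⟩
    omega

/-- ranks modulo `m` take every residue in a window with at least `m` good positions -/
theorem rank_surj {p : ℕ → Prop} [DecidablePred p] {s k m i : ℕ}
    (h : m ≤ ((Ico s (s + k)).filter p).card) (hi : i < m) :
    ∃ t, s ≤ t ∧ t < s + k ∧ p t ∧ Nat.count p t % m = i := by
  obtain ⟨ρ, h1, h2, h3, _⟩ := exists_pos m (Nat.count p s) i hi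
  have := count_window (p := p) s k
  obtain ⟨t, ht1, ht2, ht3, ht4⟩ := exists_count (p := p) (s := s) (e := s + k) (ρ := ρ) h1 (by omega)
  exact ⟨t, ht1, ht2, ht3, by rw [ht4, h3]⟩

def isU (b d t : ℕ) : Prop := t % ((b + 1) * d) = 0
def isV (b d t : ℕ) : Prop := t % (b * d) = d - 1
instance (b d t : ℕ) : Decidable (isU b d t) := inferInstanceAs (Decidable (_ = _))
instance (b d t : ℕ) : Decidable (isV b d t) := inferInstanceAs (Decidable (_ = _))

def nonsp (b d t : ℕ) : Prop := ¬ isU b d t ∧ ¬ isV b d t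
instance (b d : ℕ) : DecidablePred (nonsp b d) := fun t => inferInstanceAs (Decidable (_ ∧ _))

theorem uv_exists {k d b : ℕ} (hd : 2 ≤ d) (hb : 0 < b) (h1 : b * d < k) (h2 : k < (b + 1) * d) (j : ℕ) :
    ∃ βu βv, (b + 1) ∣ βu ∧ b ∣ βv ∧ j ≤ βu ∧ βu ≤ j + b ∧ j ≤ βv ∧ βv + 1 ≤ j + b ∧
      isU b d (βu * d) ∧ isV b d (βv * d + (d - 1)) ∧
      j * d ≤ βu * d ∧ βu * d < j * d + k ∧ j * d ≤ βv * d + (d - 1) ∧ βv * d + (d - 1) < j * d + k ∧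
      (k - 2) ≤ ((Ico (j * d) (j * d + k)).filter (nonsp b d)).card := by
  obtain ⟨βu, hu1, hu2, hu3, -⟩ := exists_pos (b + 1) j 0 (by omega)
  obtain ⟨βv, hv1, hv2, hv3, -⟩ := exists_pos b j 0 hb
  have hud : (b + 1) ∣ βu := Nat.dvd_of_mod_eq_zero hu3
  have hvd : b ∣ βv := Nat.dvd_of_mod_eq_zero hv3
  have hU : isU b d (βu * d) := Nat.mod_eq_zero_of_dvd (Nat.mul_dvd_mul_right hud d)
  have hdb : d ≤ b * d := Nat.le_mul_of_pos_left _ hb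
  have hV : isV b d (βv * d + (d - 1)) := by
    obtain ⟨x, rfl⟩ := hvd
    unfold isV
    rw [show b * x * d + (d - 1) = b * d * x + (d - 1) by ring, Nat.mul_add_mod,
      Nat.mod_eq_of_lt (by omega)]
  have i1 : j * d ≤ βu * d := Nat.mul_le_mul_right _ hu1
  have i2 : βu * d ≤ (j + b) * d := Nat.mul_le_mul_right _ (by omega)
  have i3 : j * d ≤ βv * d := Nat.mul_le_mul_right _ hv1
  have i4 : (βv + 1) * d ≤ (j + b) * d := Nat.mul_le_mul_right _ (by omega)
  have i5 : (j + b) * d = j * d + b * d := by ring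
  have i6 : (βv + 1) * d = βv * d + d := by ring
  have i7 : (b + 1) * d = b * d + d := by ring
  refine ⟨βu, βv, hud, hvd, hu1, by omega, hv1, by omega, hU, hV, i1, by omega, by omega, by omega, ?_⟩
  have hsub : Ico (j * d) (j * d + k) \ {βu * d, βv * d + (d - 1)} ⊆
      (Ico (j * d) (j * d + k)).filter (nonsp b d) := by
    intro t ht
    rw [mem_sdiff, mem_Ico] at ht
    rw [mem_filter, mem_Ico]
    obtain ⟨ht, hne⟩ := ht
    refine ⟨ht, ?_, ?_⟩
    · intro h
      apply hne
      have : t = βu * d := mod_unique (m := (b + 1) * d) (by rw [show t % _ = 0 from h]; exact hU.symm)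
        (by omega) (by omega)
      simp [this]
    · intro h
      apply hne
      have hmod : t % d = d - 1 := by
        rw [← Nat.mod_mod_of_dvd t (Dvd.intro_left b rfl : d ∣ b * d), show t % (b * d) = d - 1 from h,
          Nat.mod_eq_of_lt (by omega)]
      have hdm := Nat.div_add_mod t d
      rw [hmod] at hdm
      have hle : t / d < j + b := by
        by_contra hh
        have : d * (j + b) ≤ d * (t / d) := Nat.mul_le_mul_left _ (by omega)
        rw [mul_comm d (j + b)] at this
        omega
      have hge : j ≤ t / d := by
        by_contra hh
        have : d * (t / d + 1) ≤ d * j := Nat.mul_le_mul_left _ (by omega)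
        rw [mul_add, mul_comm d j] at this
        omega
      have : d * (t / d + 1) ≤ d * (j + b) := Nat.mul_le_mul_left _ (by omega)
      rw [mul_add, mul_comm d (j + b)] at this
      have : t = βv * d + (d - 1) := mod_unique (m := b * d)
        (by rw [show t % _ = d - 1 from h]; exact hV.symm)
        (by omega) (by omega)
      simp [this]
  refine le_trans ?_ (card_le_card hsub)
  refine le_trans ?_ (le_card_sdiff _ _)
  rw [Nat.card_Ico]
  have : ({βu * d, βv * d + (d - 1)} : Finset ℕ).card ≤ 2 := card_le_two
  omega

/-- both special positions lie on the same side of the boundary -/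
theorem boundary {b j βu βv N : ℕ} (hu : (b + 1) ∣ βu) (hv : b ∣ βv) (h1 : j ≤ βu) (h2 : βu ≤ j + b)
    (h3 : j ≤ βv) (h4 : βv + 1 ≤ j + b) (hN1 : (b + 1) ∣ N) (hN2 : b ∣ N) : βu ≤ N ↔ βv ≤ N := by
  constructor
  · intro h
    by_contra hn
    obtain ⟨x, rfl⟩ := hv
    obtain ⟨y, hy⟩ := hN2
    have : y < x := by
      by_contra hxy
      have : b * x ≤ b * y := Nat.mul_le_mul_left _ (by omega)
      omega
    have : b * (y + 1) ≤ b * x := Nat.mul_le_mul_left _ this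
    rw [mul_add] at this
    omega
  · intro h
    by_contra hn
    obtain ⟨x, rfl⟩ := hu
    obtain ⟨y, hy⟩ := hN1
    have : y < x := by
      by_contra hxy
      have : (b + 1) * x ≤ (b + 1) * y := Nat.mul_le_mul_left _ (by omega)
      omega
    have : (b + 1) * (y + 1) ≤ (b + 1) * x := Nat.mul_le_mul_left _ this
    rw [mul_add] at this
    omega

/-- base label of the p-th block -/
def Ab (k p : ℕ) : ℕ := k + p * (k - 1)
/-- number of variable labels -/
def ra (k d : ℕ) : ℕ := k + k * d * (k - 1)

/-- constraint sets of the absorbing gadget -/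
def Qa (k d j : ℕ) : Finset ℕ :=
  if j < k then (if j = k - 1 then range (k - 1) else ∅)
  else
    let p := (j - k) / (k - 1)
    let i := (j - k) % (k - 1)
    if i = k - 2 then insert (p % k) (Ico (Ab k p) (Ab k p + (k - 2)))
    else if i = k - 3 then insert (p % k) (insert (ra k d + p) (Ico (Ab k p) (Ab k p + (k - 3))))
    else ∅

theorem Ab_lt {k d p : ℕ} (hk : 3 ≤ k) (hp : p < k * d) : Ab k p + (k - 2) < ra k d := by
  unfold Ab ra
  have : (p + 1) * (k - 1) ≤ k * d * (k - 1) := Nat.mul_le_mul_right _ hp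
  rw [add_mul] at this
  omega

theorem Qa_at {k d p i : ℕ} (hk : 3 ≤ k) (hi : i < k - 1) : Qa k d (Ab k p + i) =
    if i = k - 2 then insert (p % k) (Ico (Ab k p) (Ab k p + (k - 2)))
    else if i = k - 3 then insert (p % k) (insert (ra k d + p) (Ico (Ab k p) (Ab k p + (k - 3))))
    else ∅ := by
  have e : Ab k p + i - k = (k - 1) * p + i := by unfold Ab; rw [mul_comm]; omega
  have e1 : (Ab k p + i - k) / (k - 1) = p := by
    rw [e, Nat.mul_add_div (by omega), Nat.div_eq_of_lt hi, add_zero]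
  have e2 : (Ab k p + i - k) % (k - 1) = i := by
    rw [e, Nat.mul_add_mod, Nat.mod_eq_of_lt hi]
  unfold Qa
  rw [if_neg (by unfold Ab; omega)]
  simp only [e1, e2]

theorem Qa_ok {k d : ℕ} (hk : 3 ≤ k) : ∀ j < ra k d, ∀ x ∈ Qa k d j,
    x < j ∨ (ra k d ≤ x ∧ x < ra k d + k * d) := by
  intro j hj x hx
  rcases lt_or_ge j k with h | h
  · unfold Qa at hx
    rw [if_pos h] at hx
    split_ifs at hx with h1
    · simp at hx; omega
    · simp at hx
  · obtain ⟨p, i, hp, hi, rfl⟩ : ∃ p i, p < k * d ∧ i < k - 1 ∧ j = Ab k p + i := by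
      refine ⟨(j - k) / (k - 1), (j - k) % (k - 1), ?_, Nat.mod_lt _ (by omega), ?_⟩
      · rw [Nat.div_lt_iff_lt_mul (by omega)]; unfold ra at hj; omega
      · have := Nat.div_add_mod (j - k) (k - 1)
        unfold Ab
        rw [mul_comm] at this
        omega
    rw [Qa_at hk hi] at hx
    have hpk : p % k < k := Nat.mod_lt _ (by omega)
    have hAb : k ≤ Ab k p := by unfold Ab; omega
    split_ifs at hx with h1 h2
    · simp only [mem_insert, mem_Ico] at hx; omega
    · simp only [mem_insert, mem_Ico] at hx; omega
    · simp at hx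

theorem Qa_card_y {k d p : ℕ} (hk : 3 ≤ k) :
    (insert (Ab k p + (k - 2)) (Qa k d (Ab k p + (k - 2)))).card = k := by
  have hpk : p % k < k := Nat.mod_lt _ (by omega)
  have hAb : k ≤ Ab k p := by unfold Ab; omega
  rw [Qa_at hk (by omega), if_pos rfl, card_insert_of_notMem, card_insert_of_notMem, Nat.card_Ico]
  · omega
  · rw [mem_Ico]; omega
  · rw [mem_insert, mem_Ico]; omega

theorem Qa_card_x {k d p : ℕ} (hk : 3 ≤ k) (hp : p < k * d) :
    (insert (Ab k p + (k - 3)) (Qa k d (Ab k p + (k - 3)))).card = k := by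
  have hpk : p % k < k := Nat.mod_lt _ (by omega)
  have hAb : k ≤ Ab k p := by unfold Ab; omega
  have := Ab_lt hk hp
  rw [Qa_at hk (by omega), if_neg (by omega), if_pos rfl, card_insert_of_notMem, card_insert_of_notMem,
    card_insert_of_notMem, Nat.card_Ico]
  · omega
  · rw [mem_Ico]; omega
  · rw [mem_insert, mem_Ico]; omega
  · rw [mem_insert, mem_insert, mem_Ico]; omega

theorem swap_window {k d b p : ℕ} (hk : 3 ≤ k) (hp : p < k * d) (f : ℕ → ℕ) (s tu tv X : ℕ)
    (hu1 : s ≤ tu) (hu2 : tu < s + k) (hv1 : s ≤ tv) (hv2 : tv < s + k)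
    (hA : ∀ t, nonsp b d t → f t = Ab k p + (Nat.count (nonsp b d) t) % (k - 2))
    (hc : (k - 2) ≤ ((Ico s (s + k)).filter (nonsp b d)).card)
    (h : (f tu = p % k ∧ f tv = X) ∨ (f tu = X ∧ f tv = p % k))
    (hX : X = Ab k p + (k - 2) ∨ X = ra k d + p) :
    Ok (ra k d) (Qa k d) ((List.range' s k).map f) := by
  have hlen : ((List.range' s k).map f).length = k := by simp
  have hmem : ∀ t, s ≤ t → t < s + k → f t ∈ (List.range' s k).map f := fun t h1 h2 =>
    List.mem_map.2 ⟨t, List.mem_range'_1.2 ⟨h1, h2⟩, rfl⟩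
  have hpm : p % k ∈ (List.range' s k).map f := by
    rcases h with h | h
    · rw [← h.1]; exact hmem _ hu1 hu2
    · rw [← h.2]; exact hmem _ hv1 hv2
  have hXm : X ∈ (List.range' s k).map f := by
    rcases h with h | h
    · rw [← h.2]; exact hmem _ hv1 hv2
    · rw [← h.1]; exact hmem _ hu1 hu2
  have hAm : ∀ i < k - 2, Ab k p + i ∈ (List.range' s k).map f := by
    intro i hi
    obtain ⟨t, h1, h2, h3, h4⟩ := rank_surj hc hi
    rw [← h4, ← hA t h3]
    exact hmem t h1 h2
  have hAb := Ab_lt hk hp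
  rcases hX with hX | hX
  · refine ok_of_surj (j := Ab k p + (k - 2)) hlen hAb (Qa_card_y hk) ?_
    intro x hx
    rw [Qa_at hk (by omega), if_pos rfl, mem_insert, mem_insert, mem_Ico] at hx
    rcases hx with rfl | rfl | hx
    · rw [← hX]; exact hXm
    · exact hpm
    · have := hAm (x - Ab k p) (by omega)
      rwa [show Ab k p + (x - Ab k p) = x by omega] at this
  · refine ok_of_surj (j := Ab k p + (k - 3)) hlen (by omega) (Qa_card_x hk hp) ?_
    intro x hx
    rw [Qa_at hk (by omega), if_neg (by omega), if_pos rfl, mem_insert, mem_insert, mem_insert, mem_Ico] at hx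
    rcases hx with rfl | rfl | rfl | hx
    · exact hAm _ (by omega)
    · exact hpm
    · rw [← hX]; exact hXm
    · have := hAm (x - Ab k p) (by omega)
      rwa [show Ab k p + (x - Ab k p) = x by omega] at this

def zz (b d : ℕ) : ℕ := (b * (b + 1) + 1) * d
def qq (b d : ℕ) : ℕ := (2 * (b * (b + 1)) + 1) * d

def Wl (k d b p t : ℕ) : ℕ :=
  if isU b d t then p % k else if isV b d t then Ab k p + (k - 2)
  else Ab k p + (Nat.count (nonsp b d) t) % (k - 2)

/-- labels before absorption -/
def WB (k d b p t : ℕ) : ℕ :=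
  if zz b d ≤ t ∧ t < qq b d then
    (if isU b d t then Ab k p + (k - 2) else if isV b d t then p % k
    else Ab k p + (Nat.count (nonsp b d) t) % (k - 2))
  else Wl k d b p t

/-- labels after absorption -/
def WA (k d b p t : ℕ) : ℕ := if t = qq b d - 1 then ra k d + p else Wl k d b p t

theorem not_UV {b d t : ℕ} (hd : 2 ≤ d) (hu : isU b d t) : ¬ isV b d t := by
  intro hv
  have h1 : t % d = 0 := by
    rw [← Nat.mod_mod_of_dvd t (Dvd.intro_left (b + 1) rfl : d ∣ (b + 1) * d), show t % ((b + 1) * d) = 0 from hu]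
    simp
  have h2 : t % d = d - 1 := by
    rw [← Nat.mod_mod_of_dvd t (Dvd.intro_left b rfl : d ∣ b * d), show t % (b * d) = d - 1 from hv,
      Nat.mod_eq_of_lt (by omega)]
  omega

theorem WB_win {k d b p : ℕ} (hk : 3 ≤ k) (hp : p < k * d) (hd : 2 ≤ d) (hb : 0 < b) (h1 : b * d < k)
    (h2 : k < (b + 1) * d) (L : ℕ) :
    WinP k d (Ok (ra k d) (Qa k d)) ((List.range L).map (WB k d b p)) := by
  apply WinP.ofFun
  intro j _
  obtain ⟨βu, βv, hud, hvd, hu1, hu2, hv1, hv2, hU, hV, i1, i2, i3, i4, hc⟩ := uv_exists hd hb h1 h2 j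
  have hnV := not_UV hd hU
  have hnU : ¬ isU b d (βv * d + (d - 1)) := fun h => not_UV hd h hV
  refine swap_window (b := b) hk hp _ (j * d) (βu * d) (βv * d + (d - 1)) (Ab k p + (k - 2)) i1 i2 i3 i4 ?_ hc ?_
    (Or.inl rfl)
  · intro t ht
    unfold WB Wl
    rw [if_neg ht.1, if_neg ht.2, if_neg ht.1, if_neg ht.2]
    simp
  · set P := b * (b + 1) with hP
    have hb1 := boundary (N := P) hud hvd hu1 hu2 hv1 hv2 (Dvd.intro_left b rfl) (Dvd.intro _ rfl)
    have hb2 := boundary (N := 2 * P) hud hvd hu1 hu2 hv1 hv2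
      (Dvd.dvd.mul_left (Dvd.intro_left b rfl) _) (Dvd.dvd.mul_left (Dvd.intro _ rfl) _)
    have key : ∀ N β c, c < d → ((N + 1) * d ≤ β * d + c ↔ ¬ β ≤ N) := by
      intro N β c hc
      constructor
      · intro h h'
        have : β * d ≤ N * d := Nat.mul_le_mul_right _ h'
        rw [add_mul] at h; omega
      · intro h
        have : (N + 1) * d ≤ β * d := Nat.mul_le_mul_right _ (by omega)
        omega
    have e1 := key P βu 0 (by omega)
    have e2 := key (2 * P) βu 0 (by omega)
    have e3 := key P βv (d - 1) (by omega)
    have e4 := key (2 * P) βv (d - 1) (by omega)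
    have ez : zz b d = (P + 1) * d := rfl
    have eq : qq b d = (2 * P + 1) * d := rfl
    by_cases hin : P < βu ∧ βu ≤ 2 * P
    · right
      unfold WB
      rw [if_pos (by omega), if_pos hU, if_pos (by omega), if_neg hnU, if_pos hV]
      exact ⟨rfl, rfl⟩
    · left
      unfold WB Wl
      rw [if_neg (by omega), if_pos hU, if_neg (by omega), if_neg hnU, if_pos hV]
      exact ⟨rfl, rfl⟩

theorem qq_V {b d : ℕ} (hd : 2 ≤ d) (hb : 0 < b) : isV b d (qq b d - 1) := by
  have hdb : d ≤ b * d := Nat.le_mul_of_pos_left _ hb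
  unfold isV qq
  have : (2 * (b * (b + 1)) + 1) * d - 1 = b * d * (2 * (b + 1)) + (d - 1) := by
    have : (2 * (b * (b + 1)) + 1) * d = b * d * (2 * (b + 1)) + d := by ring
    omega
  rw [this, Nat.mul_add_mod, Nat.mod_eq_of_lt (by omega)]

theorem WA_win {k d b p : ℕ} (hk : 3 ≤ k) (hp : p < k * d) (hd : 2 ≤ d) (hb : 0 < b) (h1 : b * d < k)
    (h2 : k < (b + 1) * d) (L : ℕ) :
    WinP k d (Ok (ra k d) (Qa k d)) ((List.range L).map (WA k d b p)) := by
  apply WinP.ofFun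
  intro j _
  obtain ⟨βu, βv, hud, hvd, hu1, hu2, hv1, hv2, hU, hV, i1, i2, i3, i4, hc⟩ := uv_exists hd hb h1 h2 j
  have hnU : ¬ isU b d (βv * d + (d - 1)) := fun h => not_UV hd h hV
  have hq := qq_V hd hb
  have hne : βu * d ≠ qq b d - 1 := by intro h; rw [← h] at hq; exact not_UV hd hU hq
  refine swap_window (b := b) hk hp _ (j * d) (βu * d) (βv * d + (d - 1))
    (if βv * d + (d - 1) = qq b d - 1 then ra k d + p else Ab k p + (k - 2)) i1 i2 i3 i4 ?_ hc ?_ ?_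
  · intro t ht
    unfold WA Wl
    rw [if_neg, if_neg ht.1, if_neg ht.2]
    intro h; rw [← h] at hq; exact ht.2 hq
  · left
    unfold WA Wl
    rw [if_neg hne, if_pos hU, if_neg hnU, if_pos hV]
    exact ⟨rfl, rfl⟩
  · split_ifs <;> simp

end HC
end

section
namespace HC

theorem perm_lift {α β : Type*} (f : α → β) {La Lb : List β} (h : La.Perm Lb) :
    ∀ B : List α, B.map f = Lb → ∃ A : List α, A.Perm B ∧ A.map f = La := by
  induction h with
  | nil => intro B hB; exact ⟨B, List.Perm.refl _, hB⟩
  | cons x h ih =>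
    intro B hB
    rw [List.map_eq_cons_iff] at hB
    obtain ⟨y, B', rfl, rfl, h2⟩ := hB
    obtain ⟨A, h3, h4⟩ := ih B' h2
    exact ⟨y :: A, h3.cons _, by simp [h4]⟩
  | swap x y l =>
    intro B hB
    rw [List.map_eq_cons_iff] at hB
    obtain ⟨a, B', rfl, rfl, h2⟩ := hB
    rw [List.map_eq_cons_iff] at h2
    obtain ⟨b, B'', rfl, rfl, h2⟩ := h2
    exact ⟨b :: a :: B'', List.Perm.swap _ _ _, by simp [h2]⟩
  | trans h1 h2 ih1 ih2 =>
    intro B hB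
    obtain ⟨A, h3, h4⟩ := ih2 B hB
    obtain ⟨A', h5, h6⟩ := ih1 A h4
    exact ⟨A', h5.trans h3, h6⟩

theorem count_range' (p : ℕ → Prop) [DecidablePred p] (s L : ℕ) :
    (List.range' s L).countP (fun t => decide (p t)) = ((Ico s (s + L)).filter p).card := by
  have : (Ico s (s + L)).filter p = ((List.range' s L).filter (fun t => decide (p t))).toFinset := by
    ext x; simp [List.mem_range'_1]
  rw [this, List.toFinset_card_of_nodup ((List.nodup_range' (step := 1)).filter _), List.countP_eq_length_filter]

theorem count_U {b d : ℕ} (hd : 2 ≤ d) (hb : 0 < b) (s : ℕ) :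
    (List.range' s (b * (b + 1) * d)).countP (fun t => decide (isU b d t)) = b := by
  rw [count_range', Nat.filter_Ico_card_eq_of_periodic]
  · have h : Nat.count (isU b d) (b * (b+1) * d) = Nat.count (fun x => x ≡ 0 [MOD (b+1)*d]) (b * (b+1) * d) := by
      congr
    rw [h, Nat.count_modEq_card _ (by positivity), show b * (b+1)*d = (b+1)*d*b by ring,
      Nat.mul_div_cancel_left _ (by positivity), Nat.mul_mod_right]
    simp
  · intro x
    unfold isU
    rw [show b * (b+1)*d = (b+1)*d*b by ring, Nat.add_mul_mod_self_left]

theorem count_V {b d : ℕ} (hd : 2 ≤ d) (hb : 0 < b) (s : ℕ) :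
    (List.range' s (b * (b + 1) * d)).countP (fun t => decide (isV b d t)) = b + 1 := by
  have hdb : d ≤ b * d := Nat.le_mul_of_pos_left _ hb
  rw [count_range', Nat.filter_Ico_card_eq_of_periodic]
  · have h : Nat.count (isV b d) (b * (b+1) * d) = Nat.count (fun x => x ≡ d - 1 [MOD b*d]) (b * (b+1) * d) := by
      congr
      ext x
      unfold isV Nat.ModEq
      rw [Nat.mod_eq_of_lt (show d - 1 < b * d by omega)]
    rw [h, Nat.count_modEq_card _ (by positivity), show b * (b+1)*d = b*d*(b+1) by ring,
      Nat.mul_div_cancel_left _ (by positivity), Nat.mul_mod_right]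
    simp
  · intro x
    unfold isV
    rw [show b * (b+1)*d = b*d*(b+1) by ring, Nat.add_mul_mod_self_left]

theorem Wl_eq_u {k d b p t : ℕ} (hk : 3 ≤ k) : Wl k d b p t = p % k ↔ isU b d t := by
  have hpk : p % k < k := Nat.mod_lt _ (by omega)
  have hAb : k ≤ Ab k p := by unfold Ab; omega
  unfold Wl
  split_ifs with h1 h2 <;> simp [h1] <;> omega

theorem Wl_eq_v {k d b p t : ℕ} (hk : 3 ≤ k) (hd : 2 ≤ d) : Wl k d b p t = Ab k p + (k-2) ↔ isV b d t := by
  have hpk : p % k < k := Nat.mod_lt _ (by omega)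
  have hAb : k ≤ Ab k p := by unfold Ab; omega
  unfold Wl
  split_ifs with h1 h2
  · have := not_UV hd h1
    simp only [this, iff_false]; omega
  · simp [h2]
  · have := Nat.mod_lt (Nat.count (nonsp b d) t) (show 0 < k - 2 by omega)
    simp only [h2, iff_false]; omega

theorem WB_eq_u {k d b p t : ℕ} (hk : 3 ≤ k) (hd : 2 ≤ d) (h1 : zz b d ≤ t) (h2 : t < qq b d) :
    WB k d b p t = p % k ↔ isV b d t := by
  have hpk : p % k < k := Nat.mod_lt _ (by omega)
  have hAb : k ≤ Ab k p := by unfold Ab; omega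
  unfold WB
  rw [if_pos ⟨h1, h2⟩]
  split_ifs with h1 h2
  · have := not_UV hd h1
    simp only [this, iff_false]; omega
  · simp [h2]
  · simp only [h2, iff_false]; omega

theorem WB_eq_v {k d b p t : ℕ} (hk : 3 ≤ k) (hd : 2 ≤ d) (h1 : zz b d ≤ t) (h2 : t < qq b d) :
    WB k d b p t = Ab k p + (k-2) ↔ isU b d t := by
  have hpk : p % k < k := Nat.mod_lt _ (by omega)
  have hAb : k ≤ Ab k p := by unfold Ab; omega
  unfold WB
  rw [if_pos ⟨h1, h2⟩]
  split_ifs with h1 h2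
  · simp [h1]
  · simp only [h1, iff_false]; omega
  · have := Nat.mod_lt (Nat.count (nonsp b d) t) (show 0 < k - 2 by omega)
    simp only [h1, iff_false]; omega

theorem WB_eq_other {k d b p t x : ℕ} (hk : 3 ≤ k) (hd : 2 ≤ d) (h1 : zz b d ≤ t) (h2 : t < qq b d)
    (hu : x ≠ p % k) (hv : x ≠ Ab k p + (k-2)) :
    WB k d b p t = x ↔ Wl k d b p t = x := by
  by_cases hU : isU b d t
  · rw [(Wl_eq_u hk).2 hU, (WB_eq_v hk hd h1 h2).2 hU]
    constructor <;> intro h <;> omega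
  · by_cases hV : isV b d t
    · rw [(Wl_eq_v hk hd).2 hV, (WB_eq_u hk hd h1 h2).2 hV]
      constructor <;> intro h <;> omega
    · unfold WB Wl
      rw [if_pos ⟨h1, h2⟩, if_neg hU, if_neg hV, if_neg hU, if_neg hV]

theorem mid_perm0 {k d b p : ℕ} (hk : 3 ≤ k) (hd : 2 ≤ d) (hb : 0 < b) :
    ((List.range' (zz b d) (b * (b+1) * d)).map (Wl k d b p) ++ [p % k]).Perm
      ((List.range' (zz b d) (b * (b+1) * d)).map (WB k d b p) ++ [Ab k p + (k-2)]) := by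
  have hpk : p % k < k := Nat.mod_lt _ (by omega)
  have hAb : k ≤ Ab k p := by unfold Ab; omega
  have hr : ∀ t ∈ List.range' (zz b d) (b * (b+1) * d), zz b d ≤ t ∧ t < qq b d := by
    intro t ht
    rw [List.mem_range'_1] at ht
    have : qq b d = zz b d + b * (b+1)*d := by unfold qq zz; ring
    omega
  rw [List.perm_iff_count]
  intro x
  rw [List.count_append, List.count_append]
  simp only [List.count, List.countP_map]
  by_cases hu : x = p % k
  · subst hu
    rw [List.countP_congr (q := fun t => decide (isU b d t)), count_U hd hb,
      List.countP_congr (l := List.range' _ _) (p := _ ∘ WB k d b p) (q := fun t => decide (isV b d t)), count_V hd hb]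
    · simp; omega
    · intro t ht; simp [WB_eq_u hk hd (hr t ht).1 (hr t ht).2]
    · intro t ht; simp [Wl_eq_u hk]
  · by_cases hv : x = Ab k p + (k-2)
    · subst hv
      rw [List.countP_congr (q := fun t => decide (isV b d t)), count_V hd hb,
        List.countP_congr (l := List.range' _ _) (p := _ ∘ WB k d b p) (q := fun t => decide (isU b d t)), count_U hd hb]
      · simp; omega
      · intro t ht; simp [WB_eq_v hk hd (hr t ht).1 (hr t ht).2]
      · intro t ht; simp [Wl_eq_v hk hd]
    · congr 1
      · apply List.countP_congr
        intro t ht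
        simp [WB_eq_other hk hd (hr t ht).1 (hr t ht).2 hu hv]
      · simp [Ne.symm hu, Ne.symm hv]

theorem mid_perm {k d b p l : ℕ} (hk : 3 ≤ k) (hd : 2 ≤ d) (hb : 0 < b) (hl : l ≤ zz b d) :
    ((List.range' l (qq b d - 1 - l)).map (Wl k d b p) ++ [p % k]).Perm
      ((List.range' l (qq b d - l)).map (WB k d b p)) := by
  have hq : qq b d = zz b d + b * (b+1)*d := by unfold qq zz; ring
  have hpos : 0 < b * (b+1) * d := by positivity
  set m := b * (b+1)*d with hm
  have e1 : List.range' l (qq b d - l) = List.range' l (zz b d - l) ++ List.range' (zz b d) m := by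
    rw [show qq b d - l = (zz b d - l) + m by omega, ← List.range'_append_1]
    congr; omega
  have e2 : List.range' l (qq b d - 1 - l) = List.range' l (zz b d - l) ++ List.range' (zz b d) (m-1) := by
    rw [show qq b d - 1 - l = (zz b d - l) + (m-1) by omega, ← List.range'_append_1]
    congr; omega
  have e3 : List.range' (zz b d) m = List.range' (zz b d) (m-1) ++ [qq b d - 1] := by
    have h : m = (m - 1) + 1 := by omega
    conv_lhs => rw [h, ← List.range'_append_1]
    congr 1
    simp; omega
  have h0 := mid_perm0 (p := p) hk hd hb
  rw [← hm] at h0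
  rw [e1, e2, List.map_append, List.map_append, List.append_assoc]
  have e4 : (List.range' l (zz b d - l)).map (WB k d b p) = (List.range' l (zz b d - l)).map (Wl k d b p) := by
    apply List.map_congr_left
    intro t ht
    rw [List.mem_range'_1] at ht
    unfold WB
    rw [if_neg (by omega)]
  rw [e4]
  apply List.Perm.append_left
  rw [← List.perm_append_right_iff [Ab k p + (k-2)]]
  refine List.Perm.trans ?_ h0
  rw [e3, List.map_append]
  have := (Wl_eq_v (p := p) hk hd).2 (qq_V hd hb)
  simp only [List.map_cons, List.map_nil, this, List.append_assoc]
  apply List.Perm.append_left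
  exact List.Perm.swap _ _ _

end HC
end

section
namespace HC

theorem K_win {k d : ℕ} (hk : 3 ≤ k) (L : ℕ) :
    WinP k d (Ok (ra k d) (Qa k d)) ((List.range L).map (fun t => t % k)) := by
  apply WinP.ofFun
  intro j _
  have hQ : Qa k d (k-1) = range (k-1) := by
    unfold Qa
    rw [if_pos (by omega), if_pos (by omega)]
  apply ok_of_surj (k := k) (j := k - 1) (by simp)
  · unfold ra; omega
  · rw [hQ, card_insert_of_notMem (by simp), card_range]; omega
  · intro x hx
    have hx : x < k := by
      rw [hQ, mem_insert, mem_range] at hx; omega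
    obtain ⟨u, h1, h2, h3, _⟩ := exists_pos k (j*d) x hx
    exact List.mem_map.2 ⟨u, List.mem_range'_1.2 ⟨h1, h2⟩, h3⟩

theorem swap_pairs {κ : Type*} {k l d b p : ℕ} (hk3 : 3 ≤ k) (hk : k = l + d) (hd : 2 ≤ d)
    (hb : 0 < b) (h1 : b * d < k) (h2 : k < (b + 1) * d) (hp : p < k * d) (cp : ℕ → κ) (c0 : κ) :
    ∃ (B1 : List (ℕ × κ)) (y : ℕ × κ), y.1 = p % k ∧
      (B1 ++ [y]).Perm ((List.range' l (qq b d - l)).map (fun t => (WB k d b p t, cp t))) ∧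
      WinP k d (Ok (ra k d) (Qa k d)) (((List.range l).map (fun t => (WB k d b p t, cp t)) ++
        (B1 ++ [(ra k d + p, c0)]) ++ (List.range' (qq b d) l).map (fun t => (WB k d b p t, cp t))).map
          Prod.fst) := by
  have hdb : d ≤ b * d := Nat.le_mul_of_pos_left _ hb
  have hlz : l < zz b d := by
    unfold zz
    have : (b * (b + 1) + 1) * d = b * (b*d) + b*d + d := by ring
    have h3 : (b+1)*d = b*d + d := by ring
    omega
  have hq : qq b d = zz b d + b * (b+1)*d := by unfold qq zz; ring
  have hpos : 0 < b * (b+1) * d := by positivity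
  obtain ⟨A, hA1, hA2⟩ := perm_lift (Prod.fst : ℕ × κ → ℕ) (mid_perm (p := p) hk3 hd hb hlz.le)
    ((List.range' l (qq b d - l)).map (fun t => (WB k d b p t, cp t))) (by simp [Function.comp_def])
  rw [List.map_eq_append_iff] at hA2
  obtain ⟨B1, Y, rfl, hB, hY⟩ := hA2
  rw [List.map_eq_singleton_iff] at hY
  obtain ⟨y, rfl, hy⟩ := hY
  refine ⟨B1, y, hy, hA1, ?_⟩
  have := WA_win hk3 hp hd hb h1 h2 (qq b d + l)
  convert this using 1
  have e : List.range (qq b d + l) = List.range l ++ (List.range' l (qq b d - 1 - l) ++ [qq b d - 1]) ++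
      List.range' (qq b d) l := by
    apply List.ext_getElem
    · simp; omega
    · intro i h1 h2
      simp only [List.getElem_append, List.getElem_range, List.length_append, List.length_range,
        List.length_range', List.length_singleton, List.getElem_range']
      split_ifs <;> simp <;> omega
  rw [e]
  simp only [List.map_append, List.map_map, hB, List.map_cons, List.map_nil]
  congr 1
  · congr 1
    · apply List.map_congr_left
      intro t ht
      rw [List.mem_range] at ht
      simp only [Function.comp]
      unfold WB WA
      rw [if_neg (by omega), if_neg (by omega)]
    · congr 1
      · apply List.map_congr_left
        intro t ht
        rw [List.mem_range'_1] at ht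
        unfold WA
        rw [if_neg (by omega)]
      · simp [WA]
  · apply List.map_congr_left
    intro t ht
    rw [List.mem_range'_1] at ht
    simp only [Function.comp]
    unfold WB WA
    rw [if_neg (by omega), if_neg (by omega)]

/-- a segment: start, middle, end -/
abbrev Seg (α : Type*) := List α × List α × List α
def vs {α : Type*} (s : Seg α) : List α := s.1 ++ s.2.1 ++ s.2.2
def mapSeg {α β : Type*} (f : α → β) (s : Seg α) : Seg β := (s.1.map f, s.2.1.map f, s.2.2.map f)
def Good {V : Type*} [DecidableEq V] (k l d : ℕ) (H : Finset (Finset V)) (s : Seg V) : Prop :=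
  s.1.length = l ∧ s.2.2.length = l ∧ d ∣ l + s.2.1.length ∧ Win k d H (vs s)
/-- same ends, still good -/
def Rel {V : Type*} [DecidableEq V] (k l d : ℕ) (H : Finset (Finset V)) (s s' : Seg V) : Prop :=
  Good k l d H s' ∧ s'.1 = s.1 ∧ s'.2.2 = s.2.2

theorem vs_map {α β : Type*} (f : α → β) (s : Seg α) : vs (mapSeg f s) = (vs s).map f := by
  simp [vs, mapSeg]

def mkSeg {α : Type*} (e : ℕ → α) (l m : ℕ) : Seg α :=
  ((List.range l).map e, (List.range' l (m - l)).map e, (List.range' m l).map e)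

theorem vs_mkSeg {α : Type*} (e : ℕ → α) {l m : ℕ} (h : l ≤ m) :
    vs (mkSeg e l m) = (List.range (m + l)).map e := by
  unfold vs mkSeg
  simp only [← List.map_append]
  congr 1
  apply List.ext_getElem
  · simp; omega
  · intro i h1 h2
    simp only [List.getElem_append, List.getElem_range, List.length_append, List.length_range,
        List.length_range', List.getElem_range']
    split_ifs <;> simp <;> omega

def lenA (k d b p : ℕ) : ℕ := if p < k * d then qq b d else k * d
def labA (k d b p t : ℕ) : ℕ := if p < k * d then WB k d b p t else t % k

theorem lenA_props {k l d b p : ℕ} (hk : k = l + d) (hd : 2 ≤ d)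
    (hb : 0 < b) (h2 : k < (b + 1) * d) : l ≤ lenA k d b p ∧ d ∣ lenA k d b p ∧
    lenA k d b p ≤ qq b d + k * d := by
  have hdb : d ≤ b * d := Nat.le_mul_of_pos_left _ hb
  have hlz : l < qq b d := by
    unfold qq
    have : (2*(b * (b + 1)) + 1) * d = 2*(b * (b*d)) + 2*(b*d) + d := by ring
    have h3 : (b+1)*d = b*d + d := by ring
    omega
  have : k ≤ k * d := Nat.le_mul_of_pos_right _ (by omega)
  unfold lenA
  split_ifs with h
  · exact ⟨hlz.le, Dvd.intro_left _ rfl, by omega⟩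
  · exact ⟨by omega, Dvd.intro_left _ rfl, by omega⟩

theorem labA_win {k d b p : ℕ} (hk3 : 3 ≤ k) (hd : 2 ≤ d)
    (hb : 0 < b) (h1 : b * d < k) (h2 : k < (b + 1) * d) (L : ℕ) :
    WinP k d (Ok (ra k d) (Qa k d)) ((List.range L).map (labA k d b p)) := by
  by_cases h : p < k * d
  · have : labA k d b p = WB k d b p := by funext t; unfold labA; rw [if_pos h]
    rw [this]; exact WB_win hk3 h hd hb h1 h2 L
  · have : labA k d b p = fun t => t % k := by funext t; unfold labA; rw [if_neg h]
    rw [this]; exact K_win hk3 L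

theorem labA_lt {k d b p t : ℕ} (hk3 : 3 ≤ k) : labA k d b p t < ra k d := by
  unfold labA
  split_ifs with h
  · have h1 := Ab_lt hk3 h
    have hpk : p % k < k := Nat.mod_lt _ (by omega)
    have h2 := Nat.mod_lt (Nat.count (nonsp b d) t) (show 0 < k - 2 by omega)
    have : k ≤ ra k d := by unfold ra; omega
    unfold WB Wl
    split_ifs <;> omega
  · have := Nat.mod_lt t (show 0 < k by omega)
    unfold ra; omega

end HC
end

section
namespace HC

theorem flatMap_singleton_perm {α β : Type*} (L : List α) (A : α → List β) (f : α → β) :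
    (L.flatMap (fun p => A p ++ [f p])).Perm (L.flatMap A ++ L.map f) := by
  have := List.flatMap_append_perm L A (fun p => [f p])
  refine this.symm.trans ?_
  apply List.Perm.append_left
  rw [← List.map_eq_flatMap]

theorem flatMap_perm {α β : Type*} (L : List α) (A B : α → List β) (h : ∀ p ∈ L, (A p).Perm (B p)) :
    (L.flatMap A).Perm (L.flatMap B) := by
  induction L with
  | nil => simp
  | cons x L ih =>
    simp only [List.flatMap_cons]
    exact (h x (by simp)).append (ih (fun p hp => h p (by simp [hp])))

theorem absorb_perm {β : Type*} (m : ℕ) (B1 B : ℕ → List β) (x y : ℕ → β) (M : List β)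
    (h : ∀ p < m, (B1 p ++ [y p]).Perm (B p)) :
    ((List.range m).flatMap (fun p => B1 p ++ [x p]) ++ (M ++ (List.range m).map y)).Perm
      (((List.range m).flatMap B ++ M) ++ (List.range m).map x) := by
  have h1 := flatMap_singleton_perm (List.range m) B1 x
  have h2 := flatMap_singleton_perm (List.range m) B1 y
  have h3 := flatMap_perm (List.range m) (fun p => B1 p ++ [y p]) B (fun p hp => h p (List.mem_range.1 hp))
  rw [← Multiset.coe_eq_coe] at *
  simp only [← Multiset.coe_add] at *
  rw [h1, ← h3, h2]
  abel

open Classical in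
theorem absorber {k l d b : ℕ} (hk3 : 3 ≤ k) (hk : k = l + d) (hd : 2 ≤ d)
    (hb : 0 < b) (h1 : b * d < k) (h2 : k < (b + 1) * d) (μ : ℝ) (hμ : 0 < μ) (hμ1 : μ ≤ 1) :
    ∃ (ι : Type) (_ : Fintype ι) (_ : Nonempty ι) (segs : List (Seg ι)), (segs.flatMap vs).Nodup ∧
      ∃ c > (0:ℝ), ∃ β > (0:ℝ), ∃ n0 : ℕ, ∀ n ≥ n0, ∀ H : Finset (Finset (Fin n)), Cod k H (μ * n) →
      ∀ D : List (Fin n), D.Nodup → D.length = k * d →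
      ∀ W : Finset (Fin n), (W.card : ℝ) ≤ β * n →
      c * (n : ℝ) ^ (Fintype.card ι) ≤
        ((univ : Finset (ι → Fin n)).filter (fun φ =>
          ((∀ s ∈ segs, Good k l d H (mapSeg φ s)) ∧
            ∃ G', List.Forall₂ (Rel k l d H) (segs.map (mapSeg φ)) G' ∧
              (G'.flatMap (fun s => s.2.1)).Perm ((segs.map (mapSeg φ)).flatMap (fun s => s.2.1) ++ D)) ∧
           Function.Injective φ ∧ ∀ i, φ i ∉ W)).card := by
  have hk0 : 0 < k := by omega
  set m := k * d with hm
  have hm0 : 0 < m := by positivity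
  set L := qq b d + m + l with hL
  have hL0 : 0 < L := by omega
  have hra0 : 0 < ra k d := by unfold ra; omega
  let κ := Fin (m + 1) × Fin L
  have : Nonempty κ := ⟨⟨⟨0, by omega⟩, ⟨0, hL0⟩⟩⟩
  have : NeZero L := ⟨by omega⟩
  have : Nonempty (Fin (ra k d)) := ⟨⟨0, hra0⟩⟩
  let cp : ℕ → ℕ → κ := fun p t => (Fin.ofNat (m+1) p, Fin.ofNat L t)
  let c0 : κ := Classical.arbitrary κ
  let e : ℕ → ℕ → Fin (ra k d) × κ := fun p t => (⟨labA k d b p t, labA_lt hk3⟩, cp p t)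
  let segs : List (Seg (Fin (ra k d) × κ)) := (List.range (m+1)).map (fun p => mkSeg (e p) l (lenA k d b p))
  have hlp := fun p => lenA_props (p := p) hk hd hb h2
  obtain ⟨c, hc, β, hβ, n0, h⟩ := template κ k (ra k d) m hra0 μ hμ
  refine ⟨Fin (ra k d) × κ, inferInstance, inferInstance, segs, ?_, c, hc, β, hβ, max n0 1, ?_⟩
  · have : segs.flatMap vs = (List.range (m+1)).flatMap (fun p => (List.range (lenA k d b p + l)).map (e p)) := by
      simp only [segs, List.flatMap_map]
      congr 1
      funext p
      exact vs_mkSeg _ (hlp p).1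
    rw [this, List.nodup_flatMap]
    constructor
    · intro p hp
      apply List.Nodup.map_on _ List.nodup_range
      intro t ht t' ht' htt
      rw [List.mem_range] at ht ht'
      have h3 := congrArg (fun z => (z.2.2 : ℕ)) htt
      simp only [e, cp, Fin.ofNat] at h3
      have := (hlp p).2.2
      rwa [Nat.mod_eq_of_lt (by omega), Nat.mod_eq_of_lt (by omega)] at h3
    · apply List.Nodup.pairwise_of_forall_ne List.nodup_range
      intro p hp p' hp' hpp
      rw [List.mem_range] at hp hp'
      intro x hx hx'
      obtain ⟨t, -, rfl⟩ := List.mem_map.1 hx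
      obtain ⟨t', -, ht'⟩ := List.mem_map.1 hx'
      have h3 := congrArg (fun z => (z.2.1 : ℕ)) ht'
      simp only [e, cp, Fin.ofNat] at h3
      rw [Nat.mod_eq_of_lt (by omega), Nat.mod_eq_of_lt (by omega)] at h3
      exact hpp h3.symm
  intro n hn H hH D hD hDl W hW
  have hn1 : 0 < n := lt_of_lt_of_le one_pos ((le_max_right _ _).trans hn)
  let fixed : ℕ → Fin n := fun p => if h : p - ra k d < D.length then D[p - ra k d] else ⟨0, hn1⟩
  have hfix : Set.InjOn fixed (Set.Ico (ra k d) (ra k d + m)) := by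
    intro x hx y hy hxy
    simp only [Set.mem_Ico] at hx hy
    simp only [fixed] at hxy
    rw [dif_pos (by omega), dif_pos (by omega)] at hxy
    have := (List.Nodup.getElem_inj_iff hD).1 hxy
    omega
  have hQ : ∀ j < ra k d, ∀ x ∈ Qa k d j, x < j ∨ (ra k d ≤ x ∧ x < ra k d + m) := Qa_ok hk3
  have h3 := h n ((le_max_left _ _).trans hn) H hH hμ1 (Qa k d) hQ fixed hfix W hW
  rw [Fintype.card_prod, Fintype.card_fin]
  refine h3.trans ?_
  norm_cast
  apply card_le_card
  intro φ hφ
  simp only [mem_filter, mem_univ, true_and] at hφ ⊢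
  obtain ⟨hsat, hinj, hav⟩ := hφ
  refine ⟨?_, hinj, hav⟩
  let P : ℕ → ℕ → ℕ × κ := fun p t => (labA k d b p t, cp p t)
  let v := val (ra k d) fixed φ
  have hPe : ∀ p t, φ (e p t) = v (P p t) := by
    intro p t
    simp only [v, P, e]
    rw [val_var _ (labA_lt hk3)]
  have hseg : ∀ p, mapSeg φ (mkSeg (e p) l (lenA k d b p)) = mapSeg v (mkSeg (P p) l (lenA k d b p)) := by
    intro p
    unfold mapSeg mkSeg
    simp only [List.map_map]
    have : φ ∘ e p = v ∘ P p := funext (hPe p)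
    rw [this]
  have hsegs : segs.map (mapSeg φ) = (List.range (m+1)).map (fun p => mapSeg v (mkSeg (P p) l (lenA k d b p))) := by
    simp only [segs, List.map_map]
    apply List.map_congr_left
    intro p _
    exact hseg p
  constructor
  · intro s hs
    obtain ⟨p, hp, rfl⟩ := List.mem_map.1 hs
    rw [hseg]
    refine ⟨by simp [mapSeg, mkSeg], by simp [mapSeg, mkSeg], ?_, ?_⟩
    · simp only [mapSeg, mkSeg, List.length_map, List.length_range']
      rw [Nat.add_sub_cancel' (hlp p).1]
      exact (hlp p).2.1
    · rw [vs_map, vs_mkSeg _ (hlp p).1]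
      apply lift_win hQ hsat
      simpa [Function.comp_def, P] using labA_win hk3 hd hb h1 h2 (p := p) (lenA k d b p + l)
  rw [hsegs]
  have hsw : ∀ p, ∃ (B1 : List (ℕ × κ)) (y : ℕ × κ), p < m → y.1 = p % k ∧
      (B1 ++ [y]).Perm ((List.range' l (qq b d - l)).map (P p)) ∧
      WinP k d (Ok (ra k d) (Qa k d)) (((List.range l).map (P p) ++
        (B1 ++ [(ra k d + p, c0)]) ++ (List.range' (qq b d) l).map (P p)).map
          Prod.fst) := by
    intro p
    by_cases hp : p < m
    · obtain ⟨B1, y, h4, h5, h6⟩ := swap_pairs hk3 hk hd hb h1 h2 hp (cp p) c0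
      refine ⟨B1, y, fun _ => ⟨h4, ?_⟩⟩
      have : P p = fun t => (WB k d b p t, cp p t) := by
        funext t
        simp only [P, labA]
        rw [if_pos hp]
      rw [this]
      exact ⟨h5, h6⟩
    · exact ⟨[], (0, c0), fun h => absurd h hp⟩
  choose B1 y hBy using hsw
  have hmid : ∀ p < m, lenA k d b p = qq b d := fun p hp => if_pos hp
  have hmid' : lenA k d b m = m := if_neg (lt_irrefl _)
  have hlm : l ≤ m := by have := (hlp m).1; omega
  have hlq : l ≤ qq b d := by have := (hlp 0).1; rwa [hmid 0 hm0] at this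
  let g : ℕ → Seg (ℕ × κ) := fun p =>
    if p < m then ((List.range l).map (P p), B1 p ++ [(ra k d + p, c0)], (List.range' (qq b d) l).map (P p))
    else ((List.range l).map (P p), (List.range' l (m - l)).map (P p) ++ (List.range m).map y,
      (List.range' m l).map (P p))
  refine ⟨(List.range (m+1)).map (fun p => mapSeg v (g p)), ?_, ?_⟩
  · rw [List.forall₂_map_left_iff, List.forall₂_map_right_iff, List.forall₂_same]
    intro p hp
    rw [List.mem_range] at hp
    by_cases hpm : p < m
    · obtain ⟨h4, h5, h6⟩ := hBy p hpm
      have hg : g p = ((List.range l).map (P p), B1 p ++ [(ra k d + p, c0)], (List.range' (qq b d) l).map (P p)) :=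
        if_pos hpm
      refine ⟨⟨by simp [mapSeg, hg], by simp [mapSeg, hg], ?_, ?_⟩, ?_, ?_⟩
      · have := h5.length_eq
        simp only [List.length_append, List.length_map, List.length_range', List.length_singleton] at this
        simp only [mapSeg, hg, List.length_append, List.length_map, List.length_singleton, this]
        rw [Nat.add_sub_cancel' hlq, ← hmid p hpm]
        exact (hlp p).2.1
      · rw [vs_map]
        apply lift_win hQ hsat
        rw [hg]
        exact h6
      · simp [mapSeg, mkSeg, hg]
      · simp [mapSeg, mkSeg, hg, hmid p hpm]
    · obtain rfl : p = m := by omega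
      have hg : g m = ((List.range l).map (P m), (List.range' l (m - l)).map (P m) ++ (List.range m).map y,
      (List.range' m l).map (P m)) := if_neg hpm
      refine ⟨⟨by simp [mapSeg, hg], by simp [mapSeg, hg], ?_, ?_⟩, ?_, ?_⟩
      · simp only [mapSeg, hg, List.length_append, List.length_map, List.length_range', List.length_range]
        rw [show l + (m - l + m) = (k + k) * d by rw [add_mul]; omega]
        exact Dvd.intro_left _ rfl
      · rw [vs_map]
        apply lift_win hQ hsat
        rw [hg]
        have hK := K_win (d := d) hk3 (m + (m + l))
        convert hK using 1
        have hy : ∀ t ∈ List.range m, (y t).1 = t % k := fun t ht => (hBy t (List.mem_range.1 ht)).1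
        have hlab : ∀ t, (P m t).1 = t % k := by
          intro t; simp only [P, labA]; rw [if_neg (by omega)]
        have hmk : ∀ t, (m + t) % k = t % k := by
          intro t; rw [hm, Nat.mul_add_mod]
        have e0 : List.range m = List.range l ++ List.range' l (m - l) := by
          rw [List.range_eq_range', List.range_eq_range']
          conv_lhs => rw [show m = l + (m - l) by omega, ← List.range'_append_1]
          simp
        simp only [vs, List.map_append, List.map_map]
        have e1 : List.range (m + (m + l)) = (List.range l ++ List.range' l (m - l)) ++
            ((List.range m).map (m + ·) ++ ((List.range l).map (m + ·)).map (m + ·)) := by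
          rw [← e0, List.range_add, List.range_add, List.map_append]
        rw [e1]
        simp only [List.map_append, List.map_map, List.range'_eq_map_range (s := m)]
        simp only [List.append_assoc]
        congr 1
        · apply List.map_congr_left; intro t _; simp [hlab]
        congr 1
        · apply List.map_congr_left; intro t _; simp [hlab]
        congr 1
        · apply List.map_congr_left; intro t ht; simp [hy t ht, hmk]
        · apply List.map_congr_left; intro t ht; simp only [Function.comp, hlab, hmk]
      · simp [mapSeg, mkSeg, hg]
      · simp [mapSeg, mkSeg, hg, hmid']
  · simp only [List.flatMap_map]
    rw [List.range_succ, List.flatMap_append, List.flatMap_append]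
    simp only [List.flatMap_singleton]
    have hD' : D = (List.range m).map (fun p => v (ra k d + p, c0)) := by
      apply List.ext_getElem
      · simp [hDl]
      · intro i hi1 hi2
        simp only [List.getElem_map, List.getElem_range, v]
        rw [val_fixed _ (by omega)]
        simp only [fixed]
        rw [dif_pos (by omega)]
        simp
    have hap := absorb_perm m (fun p => (B1 p).map v) (fun p => ((List.range' l (qq b d - l)).map (P p)).map v)
      (fun p => v (ra k d + p, c0)) (fun p => v (y p)) (((List.range' l (m-l)).map (P m)).map v) (by
        intro p hp
        have := ((hBy p hp).2.1).map v
        simpa using this)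
    rw [← hD'] at hap
    convert hap using 2
    · apply List.flatMap_congr
      intro p hp
      rw [List.mem_range] at hp
      simp [mapSeg, g, hp]
    · simp [mapSeg, g]
    · congr 1
      · apply List.flatMap_congr
        intro p hp
        rw [List.mem_range] at hp
        simp [mapSeg, mkSeg, hmid p hp]
      · simp [mapSeg, mkSeg, hmid']

end HC
end

section
namespace HC

theorem toFinset_eq_of_subset {V : Type*} [DecidableEq V] {b : List V} {E : Finset V}
    (h : E ⊆ b.toFinset) (hc : b.length ≤ E.card) : b.toFinset = E :=
  (eq_of_subset_of_card_le h ((List.toFinset_card_le b).trans hc)).symm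

theorem blow_exists (r M : ℕ) (hr : 0 < r) (hM : 0 < M) (c : ℝ) (hc : 0 < c) :
    ∃ n0 : ℕ, ∀ n ≥ n0, ∀ S : Finset (Fin r → Fin n), c * (n:ℝ) ^ r ≤ S.card →
      ∃ φ : Fin r × Fin M → Fin n, Function.Injective φ ∧ ∀ g : Fin r → Fin M, (fun i => φ (i, g i)) ∈ S := by
  classical
  set c' : ℝ := c ^ (M ^ r) with hc'
  have hc'0 : 0 < c' := by positivity
  obtain ⟨n1, hn1⟩ := exists_nat_ge (2 * ((r * M : ℕ) : ℝ)^2 / c')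
  refine ⟨max n1 1, fun n hn S hS => ?_⟩
  have hn0 : 0 < n := lt_of_lt_of_le one_pos ((le_max_right _ _).trans hn)
  have : Nonempty (Fin n) := ⟨⟨0, hn0⟩⟩
  have : Nonempty (Fin M) := ⟨⟨0, hM⟩⟩
  have h1 := blowup (V := Fin n) (κ := Fin M) r S c hc.le (by simpa using hS)
  have h2 := good_tuples (ι := Fin r × Fin M) (V := Fin n) ∅
    (fun φ => ∀ g : Fin r → Fin M, (fun i => φ (i, g i)) ∈ S) c' (by
      simp only [Fintype.card_fin, Fintype.card_prod] at h1 ⊢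
      convert h1) (by
      simp only [Fintype.card_fin, Fintype.card_prod, card_empty]
      have : (n1 : ℝ) ≤ n := by exact_mod_cast (le_max_left _ _).trans hn
      have := hn1.trans this
      rw [div_le_iff₀ hc'0] at this
      push_cast at this ⊢
      linarith)
  have h3 : 0 < ((univ : Finset (Fin r × Fin M → Fin n)).filter
        (fun φ => (∀ g : Fin r → Fin M, (fun i => φ (i, g i)) ∈ S) ∧ Function.Injective φ ∧ ∀ i, φ i ∉ (∅ : Finset (Fin n)))).card := by
    have : (0:ℝ) < c' / 2 * (Fintype.card (Fin n) : ℝ) ^ Fintype.card (Fin r × Fin M) := by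
      have : (0:ℝ) < Fintype.card (Fin n) := by simpa using hn0
      positivity
    have h4 := this.trans_le h2
    have h5 := Nat.cast_pos.1 h4
    convert h5
  obtain ⟨φ, hφ⟩ := card_pos.1 h3
  rw [mem_filter] at hφ
  exact ⟨φ, hφ.2.2.1, hφ.2.1⟩

theorem pathA (k d N : ℕ) (hk : 0 < k) (hN : 0 < N) (c : ℝ) (hc : 0 < c) :
    ∃ n0 : ℕ, ∀ n ≥ n0, ∀ H : Finset (Finset (Fin n)), ∀ L : Finset (Fin n),
      ∀ S : Finset (Fin k → Fin n), c * (n:ℝ) ^ k ≤ S.card →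
      (∀ z ∈ S, univ.image z ∈ H ∧ ∀ i, z i ∈ L) →
      ∃ w : List (Fin n), w.Nodup ∧ w.length = N ∧ (∀ x ∈ w, x ∈ L) ∧ Win k d H w := by
  obtain ⟨n0, h⟩ := blow_exists k N hk hN c hc
  refine ⟨n0, fun n hn H L S hS hSH => ?_⟩
  obtain ⟨φ, hinj, hφ⟩ := h n hn S hS
  let f : ℕ → Fin n := fun t => φ (⟨t % k, Nat.mod_lt _ hk⟩, ⟨t % N, Nat.mod_lt _ hN⟩)
  refine ⟨(List.range N).map f, ?_, by simp, ?_, ?_⟩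
  · apply List.Nodup.map_on _ List.nodup_range
    intro t ht t' ht' htt
    rw [List.mem_range] at ht ht'
    have h3 := congrArg (fun z => (z.2 : ℕ)) (hinj htt)
    simp only at h3
    rwa [Nat.mod_eq_of_lt ht, Nat.mod_eq_of_lt ht'] at h3
  · intro x hx
    obtain ⟨t, ht, rfl⟩ := List.mem_map.1 hx
    exact (hSH _ (hφ (fun _ => ⟨t % N, Nat.mod_lt _ hN⟩))).2 ⟨t % k, Nat.mod_lt _ hk⟩
  · apply WinP.ofFun
    intro j _
    have hu : ∀ c : Fin k, ∃ u, j * d ≤ u ∧ u < j*d + k ∧ u % k = c := fun c => by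
      obtain ⟨u, h1, h2, h3, _⟩ := exists_pos k (j*d) c c.2
      exact ⟨u, h1, h2, h3⟩
    choose u hu1 hu2 hu3 using hu
    have hz := hφ (fun c => ⟨u c % N, Nat.mod_lt _ hN⟩)
    rw [toFinset_eq_of_subset (E := univ.image (fun c => φ (c, (⟨u c % N, Nat.mod_lt _ hN⟩ : Fin N))))]
    · exact (hSH _ hz).1
    · intro x hx
      rw [mem_image] at hx
      obtain ⟨c, -, rfl⟩ := hx
      rw [List.mem_toFinset, List.mem_map]
      refine ⟨u c, List.mem_range'_1.2 ⟨hu1 c, hu2 c⟩, ?_⟩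
      simp only [f]
      congr
      exact hu3 c
    · rw [card_image_of_injective]
      · simp
      · intro x y hxy
        exact congrArg Prod.fst (hinj hxy)

theorem pathB (k d b N : ℕ) (hk : 2 ≤ k) (hd : 0 < d) (h1 : b * d < k) (h2 : k < (b + 1) * d)
    (hN : 0 < N) (c : ℝ) (hc : 0 < c) :
    ∃ n0 : ℕ, ∀ n ≥ n0, ∀ H : Finset (Finset (Fin n)), ∀ L : Finset (Fin n),
      ∀ X : List (Fin n), X.Nodup → X.length ≤ N → (∀ x ∈ X, x ∉ L) → 
      ∀ S : Finset (Fin (k-1) → Fin n), c * (n:ℝ) ^ (k-1) ≤ S.card →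
      (∀ z ∈ S, (∀ x ∈ X, insert x (univ.image z) ∈ H) ∧ ∀ i, z i ∈ L) →
      ∃ w : List (Fin n), w.Nodup ∧ w.length = X.length * ((b+1)*d) ∧ (∀ x ∈ w, x ∈ X ∨ x ∈ L) ∧ Win k d H w := by
  set A := (b+1)*d with hA
  have hA0 : 0 < A := by omega
  set M := N * A with hM
  have hM0 : 0 < M := by positivity
  have hk1 : 0 < k - 1 := by omega
  obtain ⟨n0, h⟩ := blow_exists (k-1) M hk1 hM0 c hc
  refine ⟨n0, fun n hn H L X hXn hXN hXL S hS hSH => ?_⟩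
  obtain ⟨φ, hinj, hφ⟩ := h n hn S hS
  let np : ℕ → Prop := fun t => ¬ t % A = 0
  let f0 : ℕ → Fin n := fun t => φ (⟨Nat.count np t % (k-1), Nat.mod_lt _ hk1⟩, ⟨t % M, Nat.mod_lt _ hM0⟩)
  let f : ℕ → Fin n := fun t => if h : t % A = 0 ∧ t / A < X.length then X[t / A]'h.2 else f0 t
  have hφL : ∀ i, φ i ∈ L := by
    rintro ⟨i, t⟩
    exact (hSH _ (hφ (fun _ => t))).2 i
  have hlt : ∀ t < X.length * A, t / A < X.length := fun t ht => (Nat.div_lt_iff_lt_mul hA0).2 ht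
  have hfX : ∀ t (ht : t < X.length * A), t % A = 0 → f t = X[t/A]'(hlt t ht) := by
    intro t ht h0
    simp only [f]
    rw [dif_pos ⟨h0, hlt t ht⟩]
  have hf0 : ∀ t, ¬ t % A = 0 → f t = f0 t := by
    intro t h0
    simp only [f]
    rw [dif_neg (fun h => h0 h.1)]
  refine ⟨(List.range (X.length * A)).map f, ?_, by simp, ?_, ?_⟩
  · apply List.Nodup.map_on _ List.nodup_range
    intro t ht t' ht' htt
    rw [List.mem_range] at ht ht'
    by_cases h0 : t % A = 0 <;> by_cases h0' : t' % A = 0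
    · rw [hfX t ht h0, hfX t' ht' h0'] at htt
      have := (List.Nodup.getElem_inj_iff hXn).1 htt
      rw [← Nat.div_add_mod t A, ← Nat.div_add_mod t' A, h0, h0', this]
    · rw [hfX t ht h0, hf0 t' h0'] at htt
      exact absurd (htt ▸ hφL _) (hXL _ (List.getElem_mem (hlt t ht)))
    · rw [hf0 t h0, hfX t' ht' h0'] at htt
      exact absurd (htt ▸ hφL _) (hXL _ (List.getElem_mem (hlt t' ht')))
    · rw [hf0 t h0, hf0 t' h0'] at htt
      have h3 := congrArg (fun z => (z.2 : ℕ)) (hinj htt)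
      simp only at h3
      have : X.length * A ≤ M := Nat.mul_le_mul_right _ hXN
      rwa [Nat.mod_eq_of_lt (by omega), Nat.mod_eq_of_lt (by omega)] at h3
  · intro x hx
    obtain ⟨t, ht, rfl⟩ := List.mem_map.1 hx
    rw [List.mem_range] at ht
    by_cases h0 : t % A = 0
    · rw [hfX t ht h0]; left; exact List.getElem_mem _
    · rw [hf0 t h0]; right; exact hφL _
  · apply WinP.ofFun
    intro j hj
    obtain ⟨β, hβ1, hβ2, hβ3, _⟩ := exists_pos (b+1) j 0 (by omega)
    set t0 := β * d with ht0
    have ht0A : t0 % A = 0 := by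
      rw [ht0, hA]
      exact Nat.mod_eq_zero_of_dvd (Nat.mul_dvd_mul_right (Nat.dvd_of_mod_eq_zero hβ3) d)
    have i1 : j * d ≤ t0 := Nat.mul_le_mul_right _ hβ1
    have i2 : t0 ≤ (j + b) * d := Nat.mul_le_mul_right _ (by omega)
    rw [add_mul] at i2
    have hcard : k - 1 ≤ ((Ico (j*d) (j*d+k)).filter np).card := by
      have : (Ico (j*d) (j*d+k)).erase t0 ⊆ (Ico (j*d) (j*d+k)).filter np := by
        intro t ht
        rw [mem_erase, mem_Ico] at ht
        rw [mem_filter, mem_Ico]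
        refine ⟨ht.2, fun h0 => ht.1 ?_⟩
        exact mod_unique (m := A) (h0.trans ht0A.symm) (by omega) (by omega)
      refine le_trans ?_ (card_le_card this)
      rw [card_erase_of_mem (by rw [mem_Ico]; omega), Nat.card_Ico]
      omega
    have hu : ∀ c : Fin (k-1), ∃ u, j * d ≤ u ∧ u < j*d + k ∧ np u ∧ Nat.count np u % (k-1) = c :=
      fun c => rank_surj hcard c.2
    choose u hu1 hu2 hu3 hu4 using hu
    have hz := hφ (fun c => ⟨u c % M, Nat.mod_lt _ hM0⟩)
    have ht0X : t0 < X.length * A := by omega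
    rw [toFinset_eq_of_subset (E := insert (X[t0/A]'(hlt _ ht0X)) (univ.image (fun c => φ (c, (⟨u c % M, Nat.mod_lt _ hM0⟩ : Fin M)))))]
    · exact (hSH _ hz).1 _ (List.getElem_mem _)
    · intro x hx
      rw [mem_insert, mem_image] at hx
      rw [List.mem_toFinset, List.mem_map]
      rcases hx with rfl | ⟨c, -, rfl⟩
      · exact ⟨t0, List.mem_range'_1.2 ⟨i1, by omega⟩, hfX _ ht0X ht0A⟩
      · refine ⟨u c, List.mem_range'_1.2 ⟨hu1 c, hu2 c⟩, ?_⟩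
        rw [hf0 _ (hu3 c)]
        simp only [f0]
        congr
        exact hu4 c
    · rw [card_insert_of_notMem, card_image_of_injective]
      · simp; omega
      · intro x y hxy
        exact congrArg Prod.fst (hinj hxy)
      · rw [mem_image]
        rintro ⟨c, -, hc⟩
        exact hXL _ (List.getElem_mem (hlt _ ht0X)) (hc ▸ hφL _)

/-- cut a long path into pieces of length in `[N, 2N)` -/
theorem cut {V : Type*} [DecidableEq V] {k d N : ℕ} {H : Finset (Finset V)} (hN : 0 < N) (hdN : d ∣ N) :
    ∀ (m : ℕ) (w : List V), w.length = m → N ≤ w.length → Win k d H w →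
      ∃ Ps : List (List V), Ps.flatten = w ∧ ∀ p ∈ Ps, Win k d H p ∧ N ≤ p.length ∧ p.length < 2 * N := by
  intro m
  induction m using Nat.strong_induction_on with
  | _ m ih =>
    intro w hm hw hwin
    by_cases h : w.length < 2 * N
    · exact ⟨[w], by simp, by simp [hwin, hw, h]⟩
    · have hlen : (w.take N).length = N := by simp; omega
      have hw' : w.take N ++ w.drop N = w := List.take_append_drop _ _
      have h1 : Win k d H (w.drop N) := by
        rw [← hw'] at hwin
        exact WinP.suffix hwin (by rw [hlen]; exact hdN)
      have h2 : Win k d H (w.take N) := by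
        rw [← hw'] at hwin
        exact WinP.initial hwin
      obtain ⟨Ps, hP1, hP2⟩ := ih (w.drop N).length (by simp; omega) (w.drop N) rfl (by simp; omega) h1
      refine ⟨w.take N :: Ps, by simp [hP1], ?_⟩
      intro p hp
      rcases List.mem_cons.1 hp with rfl | hp
      · exact ⟨h2, by omega, by omega⟩
      · exact hP2 p hp

end HC
end

section
namespace HC

theorem list_sum_comm {α β : Type*} (s : Finset α) (L : List β) (f : α → β → ℕ) :
    ∑ y ∈ s, (L.map (f y)).sum = (L.map (fun p => ∑ y ∈ s, f y p)).sum := by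
  induction L with
  | nil => simp
  | cons x L ih => simp [sum_add_distrib, ih]

theorem flatten_filter_card {V : Type*} [DecidableEq V] (q : V → Prop) [DecidablePred q] (Ps : List (List V)) :
    (Ps.flatten.toFinset.filter q).card ≤ (Ps.map (fun p => (p.toFinset.filter q).card)).sum := by
  induction Ps with
  | nil => simp
  | cons x L ih =>
    simp only [List.flatten_cons, List.toFinset_append, List.map_cons, List.sum_cons, filter_union]
    exact (card_union_le _ _).trans (by omega)

theorem exists_big {β : Type*} (L : List β) (T len : β → ℕ) (C : ℝ) (h : C * ((L.map len).sum : ℕ) < ((L.map T).sum : ℕ)) :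
    ∃ p ∈ L, C * len p < T p := by
  by_contra hcon
  push Not at hcon
  have : ∀ L' : List β, (∀ p ∈ L', (T p : ℝ) ≤ C * len p) → (((L'.map T).sum : ℕ) : ℝ) ≤ C * ((L'.map len).sum : ℕ) := by
    intro L'
    induction L' with
    | nil => simp
    | cons x L' ih =>
      intro h'
      have h1 := h' x (by simp)
      have h2 := ih (fun p hp => h' p (by simp [hp]))
      simp only [List.map_cons, List.sum_cons, Nat.cast_add, mul_add]
      linarith
  have := this L hcon
  linarith

/-- validity of a partial path cover -/
def CovValid {n : ℕ} (k d N : ℕ) (H : Finset (Finset (Fin n))) (U : Finset (Fin n)) (Ps : List (List (Fin n))) : Prop :=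
  Ps.flatten.Nodup ∧ (∀ p ∈ Ps, Win k d H p ∧ N ≤ p.length ∧ p.length < 2 * N) ∧ ∀ x ∈ Ps.flatten, x ∈ U

theorem improve (K d b N : ℕ) (hK : 1 ≤ K) (hd : 0 < d) (h1 : b * d < K+1) (h2 : K+1 < (b + 1) * d)
    (hN : 0 < N) (hdN : d ∣ N) (η ε : ℝ) (hη : 0 < η) (hε : 0 < ε) :
    ∃ n0 : ℕ, ∀ n ≥ n0, ∀ H : Finset (Finset (Fin n)), Cod (K+1) H ((1 / (((b+1)*d : ℕ) : ℝ) + η) * n) →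
      ∀ U : Finset (Fin n), (Uᶜ.card : ℝ) ≤ η / 2 * n → ∀ Ps, CovValid (K+1) d N H U Ps →
      ε * n < ((U \ Ps.flatten.toFinset).card : ℝ) →
      ∃ Ps', CovValid (K+1) d N H U Ps' ∧ Ps.flatten.length < Ps'.flatten.length := by
  classical
  set A := (b+1)*d with hA
  have hA0 : 0 < A := by omega
  have hA0' : (0:ℝ) < A := by exact_mod_cast hA0
  set c1 : ℝ := ε ^ K / 2 with hc1
  have hc10 : 0 < c1 := by positivity
  set c2 : ℝ := η / 16 * c1 / 2 ^ (2 * N) with hc2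
  have hc20 : 0 < c2 := by positivity
  obtain ⟨na, hpa⟩ := pathA (K+1) d N (by omega) hN (η / 4 * c1) (by positivity)
  obtain ⟨nb, hpb⟩ := pathB (K+1) d b (2*N) (by omega) hd h1 h2 (by omega) c2 hc20
  obtain ⟨nc, hnc⟩ := exists_nat_ge (2 * (K : ℝ)^2 / ε ^ K)
  refine ⟨max (max na nb) (max nc 1), fun n hn H hH U hU Ps hPs hL => ?_⟩
  have hna : na ≤ n := ((le_max_left _ _).trans (le_max_left _ _)).trans hn
  have hnb : nb ≤ n := ((le_max_right _ _).trans (le_max_left _ _)).trans hn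
  have hncn : nc ≤ n := ((le_max_left _ _).trans (le_max_right _ _)).trans hn
  have hn0 : 0 < n := lt_of_lt_of_le one_pos (((le_max_right _ _).trans (le_max_right _ _)).trans hn)
  have hn0' : (0:ℝ) < n := by exact_mod_cast hn0
  have : Nonempty (Fin n) := ⟨⟨0, hn0⟩⟩
  set L := U \ Ps.flatten.toFinset with hLdef
  obtain ⟨hPn, hPw, hPU⟩ := hPs
  -- the tuples
  set Y : Finset (Fin K → Fin n) := univ.filter (fun y => (∀ i, y i ∈ L) ∧ Function.Injective y) with hY
  have hYc : c1 * (n:ℝ) ^ K ≤ Y.card := by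
    have h3 := good_tuples (ι := Fin K) (V := Fin n) ∅ (fun y => ∀ i, y i ∈ L) (ε ^ K) (by
      have : ((univ : Finset (Fin K → Fin n)).filter (fun y => ∀ i, y i ∈ L)) = Fintype.piFinset (fun _ => L) := by
        ext y; simp
      have h4 : ((univ : Finset (Fin K → Fin n)).filter (fun y => ∀ i, y i ∈ L)).card = L.card ^ K := by
        rw [this, Fintype.card_piFinset_const]
      have h5 : (ε * n) ^ K ≤ (L.card : ℝ) ^ K := pow_le_pow_left₀ (by positivity) hL.le _
      rw [mul_pow] at h5
      simp only [Fintype.card_fin]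
      refine h5.trans (le_of_eq ?_)
      rw [← Nat.cast_pow, ← h4]
      congr!) (by
      simp only [Fintype.card_fin, card_empty]
      have : (nc : ℝ) ≤ n := by exact_mod_cast hncn
      have := hnc.trans this
      rw [div_le_iff₀ (by positivity)] at this
      push_cast at this ⊢
      linarith)
    simp only [Fintype.card_fin] at h3
    refine h3.trans ?_
    norm_cast
    apply card_le_card
    intro y hy
    simp only [mem_filter, mem_univ, true_and] at hy
    rw [hY, mem_filter]
    exact ⟨mem_univ _, hy.1, hy.2.1⟩
  have hYpos : (0:ℝ) < Y.card := lt_of_lt_of_le (by positivity) hYc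
  let Nb : (Fin K → Fin n) → Finset (Fin n) := fun y =>
    univ.filter (fun v => v ∉ univ.image y ∧ insert v (univ.image y) ∈ H)
  let cnt : (Fin K → Fin n) → List (Fin n) → ℕ := fun y p => (p.toFinset.filter (· ∈ Nb y)).card
  have hNb : ∀ y ∈ Y, (1 / (A:ℝ) + η / 2) * n ≤ (((L.filter (· ∈ Nb y)).card + (Ps.map (cnt y)).sum : ℕ) : ℝ) := by
    intro y hy
    rw [hY, mem_filter] at hy
    have h3 := hH (univ.image y) (by rw [card_image_of_injective _ hy.2.2]; simp)
    have h4 : Nb y ⊆ Uᶜ ∪ (L.filter (· ∈ Nb y) ∪ Ps.flatten.toFinset.filter (· ∈ Nb y)) := by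
      intro x hx
      by_cases hxU : x ∈ U
      · by_cases hxP : x ∈ Ps.flatten.toFinset
        · exact mem_union_right _ (mem_union_right _ (mem_filter.2 ⟨hxP, hx⟩))
        · exact mem_union_right _ (mem_union_left _ (mem_filter.2 ⟨mem_sdiff.2 ⟨hxU, hxP⟩, hx⟩))
      · exact mem_union_left _ (mem_compl.2 hxU)
    have h5 : (Nb y).card ≤ Uᶜ.card + ((L.filter (· ∈ Nb y)).card + (Ps.map (cnt y)).sum) := by
      refine (card_le_card h4).trans ((card_union_le _ _).trans ?_)
      gcongr
      refine (card_union_le _ _).trans ?_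
      gcongr
      exact flatten_filter_card _ _
    have h6 : ((Nb y).card : ℝ) ≤ Uᶜ.card + (((L.filter (· ∈ Nb y)).card + (Ps.map (cnt y)).sum : ℕ) : ℝ) := by
      exact_mod_cast h5
    have h7 : (1 / (A:ℝ) + η) * n ≤ (Nb y).card := by
      convert h3 using 1
    linarith
  have hsum : (1 / (A:ℝ) + η / 2) * n * Y.card ≤
      ((∑ y ∈ Y, (L.filter (· ∈ Nb y)).card : ℕ) : ℝ) + ((Ps.map (fun p => ∑ y ∈ Y, cnt y p)).sum : ℕ) := by
    rw [← list_sum_comm, ← Nat.cast_add, ← sum_add_distrib]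
    push_cast [Nat.cast_sum]
    rw [mul_comm, ← nsmul_eq_mul]
    apply card_nsmul_le_sum
    intro y hy
    have := hNb y hy
    push_cast at this
    exact this
  have hLdisj : ∀ x ∈ L, x ∉ Ps.flatten := by
    intro x hx hx'
    exact (mem_sdiff.1 hx).2 (List.mem_toFinset.2 hx')
  by_cases hcase : η / 4 * n * Y.card ≤ ((∑ y ∈ Y, (L.filter (· ∈ Nb y)).card : ℕ) : ℝ)
  · -- a new path inside L
    set S : Finset (Fin (K+1) → Fin n) := univ.filter (fun z => univ.image z ∈ H ∧ ∀ i, z i ∈ L) with hS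
    have hSc : ∑ y ∈ Y, (L.filter (· ∈ Nb y)).card ≤ S.card := by
      rw [← card_sigma]
      apply card_le_card_of_injOn (fun q => Fin.cons q.2 q.1)
      · rintro ⟨y, v⟩ hq
        have hq := mem_sigma.1 (mem_coe.1 hq)
        simp only [mem_filter, hY, Nb, mem_univ, true_and] at hq
        rw [mem_coe, hS, mem_filter]
        refine ⟨mem_univ _, ?_, ?_⟩
        · have : univ.image (Fin.cons v y : Fin (K+1) → Fin n) = insert v (univ.image y) := by
            ext x
            simp only [mem_image, mem_univ, true_and, mem_insert, Fin.exists_fin_succ, Fin.cons_zero, Fin.cons_succ]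
            constructor
            · rintro (h | h)
              · exact Or.inl h.symm
              · exact Or.inr h
            · rintro (h | h)
              · exact Or.inl h.symm
              · exact Or.inr h
          simp only [this]
          exact hq.2.2.2
        · intro i
          refine Fin.cases ?_ (fun i => ?_) i
          · simpa using hq.2.1
          · simpa using hq.1.1 i
      · rintro ⟨y, v⟩ _ ⟨y', v'⟩ _ heq
        have := Fin.cons_injective2 heq
        simp only at this
        obtain ⟨rfl, rfl⟩ := this
        rfl
    obtain ⟨w, hw1, hw2, hw3, hw4⟩ := hpa n hna H L S (by
      calc η / 4 * c1 * (n:ℝ)^(K+1) = η / 4 * n * (c1 * (n:ℝ)^K) := by ring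
        _ ≤ η / 4 * n * Y.card := by gcongr
        _ ≤ _ := hcase
        _ ≤ S.card := by exact_mod_cast hSc) (fun z hz => (mem_filter.1 hz).2)
    refine ⟨w :: Ps, ⟨?_, ?_, ?_⟩, ?_⟩
    · rw [List.flatten_cons, List.nodup_append']
      exact ⟨hw1, hPn, fun x hx hx' => hLdisj x (hw3 x hx) hx'⟩
    · intro p hp
      rcases List.mem_cons.1 hp with rfl | hp
      · exact ⟨hw4, by omega, by omega⟩
      · exact hPw p hp
    · intro x hx
      rw [List.flatten_cons, List.mem_append] at hx
      rcases hx with hx | hx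
      · exact (mem_sdiff.1 (hw3 x hx)).1
      · exact hPU x hx
    · rw [List.flatten_cons, List.length_append]; omega
  · -- extend one of the paths
    push Not at hcase
    have hlen : ((Ps.map List.length).sum : ℕ) ≤ n := by
      rw [← List.length_flatten]
      have := hPn.length_le_card
      simpa using this
    obtain ⟨p, hp, hpT⟩ := exists_big Ps (fun p => ∑ y ∈ Y, cnt y p) List.length
      ((1 / (A:ℝ) + η / 8) * Y.card) (by
        have h3 : (((Ps.map List.length).sum : ℕ) : ℝ) ≤ n := by exact_mod_cast hlen
        have h4 : (1 / (A:ℝ) + η / 8) * Y.card * ((Ps.map List.length).sum : ℕ) ≤ (1 / (A:ℝ) + η / 8) * Y.card * n := by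
          gcongr
        have h5 : 0 < η * n * Y.card := by positivity
        nlinarith)
    obtain ⟨hpw, hpN, hpN2⟩ := hPw p hp
    have hpn : p.Nodup := (List.nodup_flatten.1 hPn).1 p hp
    have hp0 : (0:ℝ) < p.length := by
      have : 0 < p.length := by omega
      exact_mod_cast this
    set Big := Y.filter (fun y => (1 / (A:ℝ) + η / 16) * p.length ≤ cnt y p) with hBig
    have hcl : ∀ y, cnt y p ≤ p.length := by
      intro y
      exact (card_filter_le _ _).trans (List.toFinset_card_le _)
    have hBigc : η / 16 * Y.card ≤ Big.card := by
      have h3 : ((∑ y ∈ Y, cnt y p : ℕ) : ℝ) ≤ ∑ y ∈ Y, ((1 / (A:ℝ) + η / 16) * p.length +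
          if (1 / (A:ℝ) + η / 16) * p.length ≤ cnt y p then (p.length:ℝ) else 0) := by
        push_cast
        apply sum_le_sum
        intro y _
        have : (cnt y p : ℝ) ≤ p.length := by exact_mod_cast hcl y
        split_ifs with h
        · have : 0 ≤ (1 / (A:ℝ) + η / 16) * p.length := by positivity
          linarith
        · linarith
      rw [sum_add_distrib, sum_const, ← sum_filter, sum_const, nsmul_eq_mul, nsmul_eq_mul] at h3
      have h4 := lt_of_lt_of_le hpT h3
      have h5 : η / 16 * Y.card * p.length < Big.card * p.length := by
        rw [hBig]
        nlinarith
      exact (lt_of_mul_lt_mul_right h5 hp0.le).le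
    obtain ⟨X, hX, hXc⟩ := exists_le_card_fiber_of_nsmul_le_card_of_maps_to (s := Big) (t := p.toFinset.powerset)
      (f := fun y => p.toFinset.filter (· ∈ Nb y)) (b := c2 * (n:ℝ)^K) (fun y _ => mem_powerset.2 (filter_subset _ _))
      ⟨∅, by simp⟩ (by
        rw [card_powerset, List.toFinset_card_of_nodup hpn, nsmul_eq_mul]
        have h3 : ((2 ^ p.length : ℕ) : ℝ) ≤ 2 ^ (2 * N) := by
          push_cast
          exact pow_le_pow_right₀ (by norm_num) hpN2.le
        calc ((2 ^ p.length : ℕ) : ℝ) * (c2 * (n:ℝ)^K) ≤ 2 ^ (2*N) * (c2 * (n:ℝ)^K) := by gcongr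
          _ = η / 16 * (c1 * (n:ℝ)^K) := by rw [hc2]; field_simp
          _ ≤ η / 16 * Y.card := by gcongr
          _ ≤ _ := hBigc)
    rw [mem_powerset] at hX
    set S' := Big.filter (fun y => p.toFinset.filter (· ∈ Nb y) = X) with hS'
    have hS'0 : 0 < S'.card := by
      have : (0:ℝ) < S'.card := lt_of_lt_of_le (by positivity) hXc
      exact_mod_cast this
    have hXbig : p.length < X.card * A := by
      obtain ⟨y, hy⟩ := card_pos.1 hS'0
      obtain ⟨hyB, hyX⟩ := mem_filter.1 hy
      have h3 := (mem_filter.1 hyB).2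
      have h4 : cnt y p = X.card := by rw [← hyX]
      rw [h4] at h3
      have h5 : (p.length : ℝ) < X.card * A := by
        have : (1 / (A:ℝ) + η / 16) * p.length * A ≤ X.card * A := by gcongr
        have h6 : (1 / (A:ℝ) + η / 16) * p.length * A = p.length + η / 16 * p.length * A := by field_simp
        have h7 : 0 < η / 16 * p.length * A := by positivity
        linarith
      exact_mod_cast h5
    have hXp : ∀ x ∈ X, x ∈ p := fun x hx => List.mem_toFinset.1 (hX hx)
    have hpf : ∀ x ∈ p, x ∈ Ps.flatten := fun x hx => List.mem_flatten.2 ⟨p, hp, hx⟩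
    obtain ⟨w, hw1, hw2, hw3, hw4⟩ := hpb n hnb H L X.toList X.nodup_toList (by
        rw [length_toList]
        have := card_le_card hX
        rw [List.toFinset_card_of_nodup hpn] at this
        omega) (fun x hx hxL => hLdisj x hxL (hpf x (hXp x (mem_toList.1 hx)))) S' hXc (by
        intro z hz
        obtain ⟨hzB, hzX⟩ := mem_filter.1 hz
        obtain ⟨hzY, _⟩ := mem_filter.1 hzB
        refine ⟨fun x hx => ?_, (mem_filter.1 hzY).2.1⟩
        rw [mem_toList, ← hzX, mem_filter] at hx
        exact (mem_filter.1 hx.2).2.2)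
    rw [length_toList, ← hA] at hw2
    obtain ⟨Qs, hQ1, hQ2⟩ := cut hN hdN w.length w rfl (by omega) hw4
    have hperm : Ps.Perm (p :: Ps.erase p) := List.perm_cons_erase hp
    have hfl := hperm.flatten
    rw [List.flatten_cons] at hfl
    have hnd := hfl.nodup_iff.1 hPn
    rw [List.nodup_append'] at hnd
    refine ⟨Qs ++ Ps.erase p, ⟨?_, ?_, ?_⟩, ?_⟩
    · rw [List.flatten_append, hQ1, List.nodup_append']
      refine ⟨hw1, hnd.2.1, ?_⟩
      intro x hx hx'
      rcases hw3 x hx with h | h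
      · exact hnd.2.2 (hXp x (mem_toList.1 h)) hx'
      · exact hLdisj x h (hfl.mem_iff.2 (List.mem_append_right _ hx'))
    · intro q hq
      rcases List.mem_append.1 hq with hq | hq
      · exact hQ2 q hq
      · exact hPw q (List.mem_of_mem_erase hq)
    · intro x hx
      rw [List.flatten_append, hQ1, List.mem_append] at hx
      rcases hx with hx | hx
      · rcases hw3 x hx with h | h
        · exact hPU x (hpf x (hXp x (mem_toList.1 h)))
        · exact (mem_sdiff.1 h).1
      · exact hPU x (hfl.mem_iff.2 (List.mem_append_right _ hx))
    · rw [hfl.length_eq, List.flatten_append, List.length_append, List.length_append, hQ1]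
      omega

theorem cover (K d b N : ℕ) (hK : 1 ≤ K) (hd : 0 < d) (h1 : b * d < K+1) (h2 : K+1 < (b + 1) * d)
    (hN : 0 < N) (hdN : d ∣ N) (η ε : ℝ) (hη : 0 < η) (hε : 0 < ε) :
    ∃ n0 : ℕ, ∀ n ≥ n0, ∀ H : Finset (Finset (Fin n)), Cod (K+1) H ((1 / (((b+1)*d : ℕ) : ℝ) + η) * n) →
      ∀ U : Finset (Fin n), (Uᶜ.card : ℝ) ≤ η / 2 * n → ∃ Ps, CovValid (K+1) d N H U Ps ∧
      ((U \ Ps.flatten.toFinset).card : ℝ) ≤ ε * n := by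
  obtain ⟨n0, h⟩ := improve K d b N hK hd h1 h2 hN hdN η ε hη hε
  refine ⟨n0, fun n hn H hH U hU => ?_⟩
  by_contra hcon
  push Not at hcon
  have : ∀ m : ℕ, ∃ Ps, CovValid (K+1) d N H U Ps ∧ m ≤ Ps.flatten.length := by
    intro m
    induction m with
    | zero => exact ⟨[], ⟨by simp, by simp, by simp⟩, by simp⟩
    | succ m ih =>
      obtain ⟨Ps, hv, hm⟩ := ih
      obtain ⟨Ps', hv', hm'⟩ := h n hn H hH U hU Ps hv (hcon Ps hv)
      exact ⟨Ps', hv', by omega⟩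
  obtain ⟨Ps, hv, hm⟩ := this (n+1)
  have := hv.1.length_le_card
  rw [Fintype.card_fin] at this
  omega

end HC
end

section
namespace HC

open Classical in
theorem reservoir {k l d : ℕ} (hk : k = l + d) (hd : 2 ≤ d) (hl : 0 < l) (hnd : ¬ d ∣ k)
    (μ : ℝ) (hμ : 0 < μ) (hμ1 : μ ≤ 1) :
    ∃ m0 : ℕ, d ∣ l + m0 ∧ ∃ β > (0:ℝ), ∀ ρ > (0:ℝ), ∃ lam > (0:ℝ), ∃ n0 : ℕ, ∀ n ≥ n0,
      ∀ H : Finset (Finset (Fin n)), Cod k H (μ * n) →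
      ∀ W : Finset (Fin n), (W.card : ℝ) ≤ β * n →
      ∃ R : Finset (Fin n), (∀ x ∈ R, x ∉ W) ∧ (R.card : ℝ) ≤ ρ * n ∧
        ∀ prs : List (List (Fin n) × List (Fin n)), (prs.length : ℝ) ≤ lam * n →
          (∀ pr ∈ prs, pr.1.length = l ∧ pr.2.length = l ∧ (pr.1 ++ pr.2).Nodup) →
          ∃ Cs : List (List (Fin n)), Cs.flatten.Nodup ∧ (∀ x ∈ Cs.flatten, x ∈ R) ∧
            List.Forall₂ (fun pr C => C.length = m0 ∧ Win k d H (pr.1 ++ C ++ pr.2)) prs Cs := by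
  obtain ⟨m0, hm0, N, hN, c, hc, β, hβ, n1, hcon⟩ := connect hk hd hl hnd μ hμ hμ1
  refine ⟨m0, hm0, β, hβ, fun ρ hρ => ?_⟩
  set ι := Fin (3 * k) × Fin N with hι
  have hcι : Fintype.card ι = 3 * k * N := by simp [hι]
  have hcι0 : (0:ℝ) < Fintype.card ι := by
    rw [hcι]
    have : 0 < 3 * k * N := by have : 0 < k := by omega
                               positivity
    exact_mod_cast this
  set τ : ℝ := min (c / (2 * (Fintype.card ι : ℝ)^2)) (ρ / Fintype.card ι) with hτ
  have hτ0 : 0 < τ := by rw [hτ]; apply lt_min <;> positivity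
  have hτ1 : 2 * (Fintype.card ι : ℝ)^2 * τ ≤ c := by
    have : τ ≤ c / (2 * (Fintype.card ι : ℝ)^2) := min_le_left _ _
    rw [le_div_iff₀ (by positivity)] at this
    linarith
  have hτ2 : τ * Fintype.card ι ≤ ρ := by
    have : τ ≤ ρ / Fintype.card ι := min_le_right _ _
    rwa [le_div_iff₀ (by positivity)] at this
  have : Nonempty ι := Fintype.card_pos_iff.1 (by exact_mod_cast hcι0)
  obtain ⟨n2, hsel⟩ := select ι (l + l) c τ hc hτ0 hτ1
  refine ⟨c * τ / 16, by positivity, max n1 n2, fun n hn H hH W hW => ?_⟩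
  let J := {q : Fin (l + l) → Fin n // Function.Injective q}
  let Sf : J → List (Fin n) := fun q => (List.ofFn q.1).take l
  let Tf : J → List (Fin n) := fun q => (List.ofFn q.1).drop l
  let A : J → Finset (ι → Fin n) := fun q => univ.filter (fun φ =>
          (∃ C : List (Fin n), C.Nodup ∧ C.length = m0 ∧ (∀ x ∈ C, ∃ i, φ i = x) ∧
            Win k d H (Sf q ++ C ++ Tf q)) ∧ Function.Injective φ ∧ ∀ i, φ i ∉ W)
  have hJ : Fintype.card J ≤ n ^ (l + l) := by
    refine (Fintype.card_subtype_le _).trans ?_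
    simp
  obtain ⟨F, hF1, hF2, hF3, hF4⟩ := hsel n ((le_max_right _ _).trans hn) J hJ A (by
    intro q
    rw [hcι]
    exact hcon n ((le_max_left _ _).trans hn) H hH (Sf q) (Tf q) (by simp [Sf]) (by simp [Tf])
      (by simp only [Sf, Tf, List.take_append_drop]; exact List.nodup_ofFn.2 q.2) W hW)
  refine ⟨F.biUnion (fun φ => univ.image φ), ?_, ?_, ?_⟩
  · intro x hx
    rw [mem_biUnion] at hx
    obtain ⟨φ, hφ, hx⟩ := hx
    obtain ⟨i, -, rfl⟩ := mem_image.1 hx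
    obtain ⟨-, s, hs⟩ := hF2 φ hφ
    exact (mem_filter.1 hs).2.2.2 i
  · have h1 : (F.biUnion (fun φ => univ.image φ)).card ≤ F.card * Fintype.card ι := by
      apply card_biUnion_le_card_mul
      intro φ _
      exact card_image_le
    calc ((F.biUnion (fun φ => univ.image φ)).card : ℝ) ≤ F.card * Fintype.card ι := by exact_mod_cast h1
      _ ≤ τ * n * Fintype.card ι := by gcongr
      _ = τ * Fintype.card ι * n := by ring
      _ ≤ ρ * n := by gcongr
  intro prs hlen hprs
  have hq : ∀ i : Fin prs.length, ∃ q : J, Sf q = prs[i].1 ∧ Tf q = prs[i].2 := by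
    intro i
    obtain ⟨h1, h2, h3⟩ := hprs prs[i] (List.getElem_mem _)
    set w := prs[i].1 ++ prs[i].2 with hw
    have hwl : l + l = w.length := by rw [hw, List.length_append, h1, h2]
    have hofn : List.ofFn (fun i : Fin (l+l) => w.get (i.cast hwl)) = w := by
      apply List.ext_getElem
      · simp [hwl]
      · intro i _ _; simp
    refine ⟨⟨fun i => w.get (i.cast hwl), ?_⟩, ?_, ?_⟩
    · exact (List.nodup_iff_injective_get.1 h3).comp (Fin.cast_injective hwl)
    · simp only [Sf, hofn]; rw [hw, List.take_left' h1]
    · simp only [Tf, hofn]; rw [hw, List.drop_left' h1]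
  choose q hq1 hq2 using hq
  obtain ⟨f, hfinj, hf⟩ := hall_choice (fun i => F.filter (· ∈ A (q i))) (fun i => by
    have := hlen.trans (hF4 (q i))
    exact_mod_cast this)
  have hC : ∀ i, ∃ C : List (Fin n), C.Nodup ∧ C.length = m0 ∧ (∀ x ∈ C, ∃ t, f i t = x) ∧
            Win k d H (Sf (q i) ++ C ++ Tf (q i)) := fun i =>
    (mem_filter.1 (mem_filter.1 (hf i)).2).2.1
  choose C hC1 hC2 hC3 hC4 using hC
  have hfF : ∀ i, f i ∈ F := fun i => (mem_filter.1 (hf i)).1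
  refine ⟨List.ofFn C, ?_, ?_, ?_⟩
  · rw [List.nodup_flatten]
    constructor
    · intro L hL
      rw [List.mem_ofFn] at hL
      obtain ⟨i, rfl⟩ := hL
      exact hC1 i
    · rw [List.pairwise_ofFn]
      intro i j hij x hx hx'
      obtain ⟨t, ht⟩ := hC3 i x hx
      obtain ⟨t', ht'⟩ := hC3 j x hx'
      exact hF3 _ (hfF i) _ (hfF j) (fun h => hij.ne (hfinj h)) t t' (ht.trans ht'.symm)
  · intro x hx
    obtain ⟨L, hL, hx⟩ := List.mem_flatten.1 hx
    rw [List.mem_ofFn] at hL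
    obtain ⟨i, rfl⟩ := hL
    obtain ⟨t, rfl⟩ := hC3 i x hx
    exact mem_biUnion.2 ⟨f i, hfF i, mem_image_of_mem _ (mem_univ _)⟩
  · rw [List.forall₂_iff_get]
    refine ⟨by simp, fun i h1 h2 => ?_⟩
    simp only [List.get_eq_getElem, List.getElem_ofFn]
    have := hC4 ⟨i, h1⟩
    rw [hq1, hq2] at this
    exact ⟨hC2 _, this⟩

end HC
end

section
namespace HC

def joinSeg {α : Type*} (s : Seg α) (C : List α) (t : Seg α) : Seg α :=
  (s.1, s.2.1 ++ s.2.2 ++ C ++ t.1 ++ t.2.1, t.2.2)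

theorem vs_joinSeg {α : Type*} (s : Seg α) (C : List α) (t : Seg α) :
    vs (joinSeg s C t) = vs s ++ C ++ vs t := by simp [vs, joinSeg]

def chain {α : Type*} : Seg α → List (List α) → List (Seg α) → Seg α
  | s, _, [] => s
  | s, [], _ => s
  | s, C :: Cs, t :: ts => chain (joinSeg s C t) Cs ts

def pairs {α : Type*} : Seg α → List (Seg α) → List (List α × List α)
  | _, [] => []
  | s, t :: ts => (s.2.2, t.1) :: pairs t ts

theorem pairs_congr {α : Type*} {s s' : Seg α} (h : s.2.2 = s'.2.2) (ts : List (Seg α)) :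
    pairs s ts = pairs s' ts := by
  cases ts <;> simp [pairs, h]

theorem pairs_length {α : Type*} (s : Seg α) (ts : List (Seg α)) : (pairs s ts).length = ts.length := by
  induction ts generalizing s with
  | nil => rfl
  | cons t ts ih => simp [pairs, ih]

variable {V : Type*} [DecidableEq V]

def Conn (k d m0 : ℕ) (H : Finset (Finset V)) (pr : List V × List V) (C : List V) : Prop :=
  C.length = m0 ∧ Win k d H (pr.1 ++ C ++ pr.2)

theorem join_good {k l d m0 : ℕ} (hk : k = l + d) (hm : d ∣ l + m0) {H : Finset (Finset V)} {s t : Seg V}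
    {C : List V} (hs : Good k l d H s) (ht : Good k l d H t) (hC : Conn k d m0 H (s.2.2, t.1) C) :
    Good k l d H (joinSeg s C t) := by
  obtain ⟨s1, s2, s3⟩ := s
  obtain ⟨t1, t2, t3⟩ := t
  obtain ⟨a1, a2, a3, a4⟩ := hs
  obtain ⟨b1, b2, b3, b4⟩ := ht
  obtain ⟨c1, c2⟩ := hC
  simp only at *
  refine ⟨a1, b2, ?_, ?_⟩
  · simp only [joinSeg, List.length_append]
    obtain ⟨x, hx⟩ := a3
    obtain ⟨y, hy⟩ := b3
    obtain ⟨z, hz⟩ := hm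
    refine ⟨x + y + z, ?_⟩
    rw [mul_add, mul_add]; omega
  · rw [vs_joinSeg]
    have h1 : Win k d H ((s1 ++ s2) ++ s3 ++ (C ++ t1)) := by
      refine WinP.glue (P := fun b => b.toFinset ∈ H) hk a2 ?_ ?_ ?_
      · simpa [a1] using a3
      · exact a4
      · simpa [Win] using c2
    have h2 : Win k d H ((s1 ++ s2 ++ s3 ++ C) ++ t1 ++ (t2 ++ t3)) := by
      refine WinP.glue (P := fun b => b.toFinset ∈ H) hk b1 ?_ ?_ ?_
      · obtain ⟨x, hx⟩ := a3
        obtain ⟨z, hz⟩ := hm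
        refine ⟨x + z, ?_⟩
        simp only [List.length_append]
        rw [mul_add]; omega
      · simpa [Win] using h1
      · simpa [Win, vs] using b4
    simpa [vs, Win] using h2

theorem chain_rel {k l d m0 : ℕ} (hk : k = l + d) (hm : d ∣ l + m0) {H : Finset (Finset V)}
    {ts ts' : List (Seg V)} (h : List.Forall₂ (Rel k l d H) ts ts') :
    ∀ (s s' : Seg V) (Cs : List (List V)), Rel k l d H s s' →
      List.Forall₂ (Conn k d m0 H) (pairs s ts) Cs → Rel k l d H (chain s Cs ts) (chain s' Cs ts') := by
  induction h with
  | nil => intro s s' Cs h _; cases Cs <;> simpa [chain] using h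
  | @cons t t' ts ts' ht _ ih =>
    intro s s' Cs hs hC
    simp only [pairs] at hC
    obtain ⟨C, Cs, hC1, hC2, rfl⟩ := List.forall₂_cons_left_iff.1 hC
    simp only [chain]
    apply ih
    · refine ⟨join_good hk hm hs.1 ht.1 (m0 := m0) ?_, ?_, ?_⟩
      · rw [hs.2.2, ht.2.1]; exact hC1
      · exact hs.2.1
      · exact ht.2.2
    · rwa [pairs_congr (s := joinSeg s C t) (s' := t) rfl]

theorem chain_perm {α : Type*} (ts : List (Seg α)) (s : Seg α) (Cs : List (List α))
    (h : Cs.length = ts.length) : (vs (chain s Cs ts)).Perm (vs s ++ ts.flatMap vs ++ Cs.flatten) := by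
  induction ts generalizing s Cs with
  | nil =>
    have : Cs = [] := List.length_eq_zero_iff.1 (by simpa using h)
    subst this; simp [chain]
  | cons t ts ih =>
    cases Cs with
    | nil => simp at h
    | cons C Cs =>
      simp only [chain]
      refine (ih _ _ (by simpa using h)).trans ?_
      rw [vs_joinSeg]
      simp only [List.flatMap_cons, List.flatten_cons]
      rw [← Multiset.coe_eq_coe]
      simp only [← Multiset.coe_add]
      abel

theorem chain_last {α : Type*} (ts : List (Seg α)) (s t : Seg α) (Cs : List (List α))
    (h : Cs.length = ts.length + 1) : ∃ X, vs (chain s Cs (ts ++ [t])) = vs s ++ X ++ vs t := by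
  induction ts generalizing s Cs with
  | nil =>
    obtain ⟨C, rfl⟩ := List.length_eq_one_iff.1 (by simpa using h)
    exact ⟨C, by simp [chain, vs_joinSeg]⟩
  | cons u ts ih =>
    cases Cs with
    | nil => simp at h
    | cons C Cs =>
      obtain ⟨X, hX⟩ := ih (joinSeg s C u) Cs (by simpa using h)
      refine ⟨C ++ vs u ++ X, ?_⟩
      simp only [List.cons_append, chain, hX, vs_joinSeg]
      simp

theorem rel_refl {k l d : ℕ} {H : Finset (Finset V)} {s : Seg V} (h : Good k l d H s) : Rel k l d H s s :=
  ⟨h, rfl, rfl⟩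

theorem pairs_mem {α : Type*} (ts : List (Seg α)) (s : Seg α) (pr) (h : pr ∈ pairs s ts) :
    ∃ x ∈ s :: ts, ∃ y ∈ s :: ts, pr = (x.2.2, y.1) := by
  induction ts generalizing s with
  | nil => simp [pairs] at h
  | cons t ts ih =>
    simp only [pairs, List.mem_cons] at h
    rcases h with rfl | h
    · exact ⟨s, by simp, t, by simp, rfl⟩
    · obtain ⟨x, hx, y, hy, e⟩ := ih t h
      exact ⟨x, List.mem_cons_of_mem _ hx, y, List.mem_cons_of_mem _ hy, e⟩

theorem pairs_nodup {α : Type*} (ts : List (Seg α)) (s : Seg α) (hn : (vs s ++ ts.flatMap vs).Nodup)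
    (pr) (h : pr ∈ pairs s ts) : (pr.1 ++ pr.2).Nodup := by
  induction ts generalizing s with
  | nil => simp [pairs] at h
  | cons t ts ih =>
    simp only [pairs, List.mem_cons] at h
    rcases h with rfl | h
    · refine List.Nodup.sublist ?_ hn
      simp only [vs, List.flatMap_cons, List.append_assoc]
      apply List.Sublist.trans _ (List.sublist_append_right _ _)
      apply List.Sublist.trans _ (List.sublist_append_right _ _)
      rw [← List.append_assoc]
      apply List.sublist_append_left
    · exact ih t (by simpa using hn.sublist (List.sublist_append_right _ _)) h

theorem pairs_snoc {α : Type*} (ts : List (Seg α)) (s t : Seg α) (pr) (h : pr ∈ pairs s (ts ++ [t])) :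
    pr ∈ pairs s ts ∨ ∃ x ∈ s :: ts, pr = (x.2.2, t.1) := by
  induction ts generalizing s with
  | nil => right; simpa [pairs] using h
  | cons u ts ih =>
    simp only [List.cons_append, pairs, List.mem_cons] at h ⊢
    rcases h with rfl | h
    · left; left; rfl
    · rcases ih u h with h | ⟨x, hx, rfl⟩
      · left; right; exact h
      · right; exact ⟨x, Or.inr (by simpa using hx), rfl⟩

theorem pairs_cyc_nodup {α : Type*} (ts : List (Seg α)) (s : Seg α) (hn : (vs s ++ ts.flatMap vs).Nodup)
    (pr) (h : pr ∈ pairs s (ts ++ [s])) : (pr.1 ++ pr.2).Nodup := by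
  rcases pairs_snoc ts s s pr h with h | ⟨x, hx, rfl⟩
  · exact pairs_nodup ts s hn pr h
  · have hs : (s.1 ++ (s.2.1 ++ s.2.2)).Nodup := by
      have := hn.sublist (List.sublist_append_left _ _)
      simpa [vs] using this
    rcases List.mem_cons.1 hx with rfl | hx
    · refine List.Nodup.sublist ?_ (List.nodup_append_comm.1 hs)
      exact (List.sublist_append_right _ _).append (List.Sublist.refl _)
    · have h1 : (vs s ++ vs x).Nodup := hn.sublist ((List.Sublist.refl _).append
        (by rw [List.flatMap_def]; exact List.sublist_flatten_of_mem (List.mem_map_of_mem hx)))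
      refine List.Nodup.sublist ?_ (List.nodup_append_comm.1 h1)
      apply List.Sublist.append
      · simp only [vs]; exact List.sublist_append_right _ _
      · simp only [vs, List.append_assoc]; exact List.sublist_append_left _ _

theorem mid_perm_vs {k l d : ℕ} {H : Finset (Finset V)} {G G' : List (Seg V)} {D : List V}
    (h : List.Forall₂ (Rel k l d H) G G')
    (hp : (G'.flatMap (fun s => s.2.1)).Perm (G.flatMap (fun s => s.2.1) ++ D)) :
    (G'.flatMap vs).Perm (G.flatMap vs ++ D) := by
  have e : G'.flatMap (fun s => s.1 ++ s.2.2) = G.flatMap (fun s => s.1 ++ s.2.2) := by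
    clear hp
    induction h with
    | nil => rfl
    | cons a _ ih => simp only [List.flatMap_cons, ih, a.2.1, a.2.2]
  have f : ∀ G : List (Seg V), (G.flatMap vs).Perm
      (G.flatMap (fun s => s.2.1) ++ G.flatMap (fun s => s.1 ++ s.2.2)) := by
    intro G
    refine List.Perm.trans ?_ (List.flatMap_append_perm _ _ _).symm
    apply flatMap_perm
    intro s _
    rw [← Multiset.coe_eq_coe]
    simp only [vs, ← Multiset.coe_add]
    abel
  have f1 := f G
  have f2 := f G'
  rw [e] at f2
  rw [← Multiset.coe_eq_coe] at *
  simp only [← Multiset.coe_add] at *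
  rw [f2, hp, f1]; abel

theorem chunks {α : Type*} (m q : ℕ) (D : List α) (h : D.length = q * m) :
    ∃ ch : Fin q → List α, (∀ i, (ch i).length = m) ∧ (List.ofFn ch).flatten = D := by
  induction q generalizing D with
  | zero =>
    refine ⟨fun _ => [], fun i => i.elim0, ?_⟩
    have : D = [] := List.length_eq_zero_iff.1 (by simpa using h)
    simp [this]
  | succ q ih =>
    rw [Nat.succ_mul] at h
    obtain ⟨ch, h1, h2⟩ := ih (D.drop m) (by simp; omega)
    refine ⟨Fin.cons (D.take m) ch, ?_, ?_⟩
    · intro i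
      refine Fin.cases ?_ ?_ i
      · simp; omega
      · intro i; simpa using h1 i
    · simp [List.ofFn_succ, h2]

end HC
end

section
namespace HC

theorem forall₂_flatMap {α β γ : Type*} {R : β → γ → Prop} (L : List α) (f : α → List β) (g : α → List γ)
    (h : ∀ a ∈ L, List.Forall₂ R (f a) (g a)) : List.Forall₂ R (L.flatMap f) (L.flatMap g) := by
  induction L with
  | nil => simp
  | cons a L ih =>
    simp only [List.flatMap_cons]
    exact List.rel_append (h a (by simp)) (ih (fun x hx => h x (by simp [hx])))

/-- distributing chunks -/
theorem distribute {α β : Type*} [DecidableEq α] (F : Finset α) {q : ℕ} (f : Fin q → α)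
    (hf : Function.Injective f) (hF : ∀ i, f i ∈ F) (ch : Fin q → List β) :
    (F.toList.flatMap (Function.extend f ch (fun _ => []))).Perm (List.ofFn ch).flatten := by
  have h1 : F.toList.Perm (List.ofFn f ++ (F \ univ.image f).toList) := by
    rw [List.perm_ext_iff_of_nodup F.nodup_toList]
    · intro a
      simp only [mem_toList, List.mem_append, List.mem_ofFn, mem_sdiff, mem_image, mem_univ, true_and]
      constructor
      · intro h
        by_cases h' : ∃ i, f i = a
        · exact Or.inl h'
        · exact Or.inr ⟨h, h'⟩
      · rintro (⟨i, rfl⟩ | h)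
        · exact hF i
        · exact h.1
    · rw [List.nodup_append']
      refine ⟨List.nodup_ofFn.2 hf, Finset.nodup_toList _, ?_⟩
      intro a ha hb
      rw [List.mem_ofFn] at ha
      obtain ⟨i, rfl⟩ := ha
      simp at hb
  refine (h1.flatMap_right _).trans ?_
  rw [List.flatMap_append]
  have h2 : (F \ univ.image f).toList.flatMap (Function.extend f ch (fun _ => [])) = [] := by
    rw [List.flatMap_eq_nil_iff]
    intro a ha
    apply Function.extend_apply'
    rintro ⟨i, rfl⟩
    simp at ha
  have h3 : (List.ofFn f).flatMap (Function.extend f ch (fun _ => [])) = (List.ofFn ch).flatten := by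
    rw [List.flatMap_def, List.map_ofFn]
    congr 2
    funext i
    exact hf.extend_apply _ _ i
  rw [h2, h3, List.append_nil]

open Classical in
theorem abspath {k l d b : ℕ} (hk3 : 3 ≤ k) (hk : k = l + d) (hd : 2 ≤ d) (hl : 0 < l) (hnd : ¬ d ∣ k)
    (hb : 0 < b) (h1 : b * d < k) (h2 : k < (b + 1) * d) (μ : ℝ) (hμ : 0 < μ) (hμ1 : μ ≤ 1)
    (γ : ℝ) (hγ : 0 < γ) :
    ∃ α > (0:ℝ), ∃ n0 : ℕ, ∀ n ≥ n0, ∀ H : Finset (Finset (Fin n)), Cod k H (μ * n) →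
      ∃ s : Seg (Fin n), Good k l d H s ∧ (vs s).Nodup ∧ ((vs s).length : ℝ) ≤ γ * n ∧
        ∀ D : List (Fin n), D.Nodup → k * d ∣ D.length → (D.length : ℝ) ≤ α * n →
          ∃ s', Rel k l d H s s' ∧ (vs s').Perm (vs s ++ D) := by
  obtain ⟨m0, hm0, β, hβ, hres⟩ := reservoir hk hd hl hnd μ hμ hμ1
  obtain ⟨ι, _, _, segs, hsegs, c, hc, β', hβ', n1, habs⟩ := absorber hk3 hk hd hb h1 h2 μ hμ hμ1
  obtain ⟨lam, hlam, n2, hR⟩ := hres (min β' (γ / 2)) (lt_min hβ' (by positivity))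
  have hcι0 : (0:ℝ) < Fintype.card ι := by exact_mod_cast Fintype.card_pos
  have hkd : 0 < k * d := by positivity
  set τ : ℝ := min (min (c / (2 * (Fintype.card ι : ℝ)^2)) (γ / 2 / Fintype.card ι))
    (lam / (segs.length + 1)) with hτ
  have hτ0 : 0 < τ := by rw [hτ]; apply lt_min (lt_min _ _) <;> positivity
  have hτ1 : 2 * (Fintype.card ι : ℝ)^2 * τ ≤ c := by
    have : τ ≤ c / (2 * (Fintype.card ι : ℝ)^2) := (min_le_left _ _).trans (min_le_left _ _)
    rw [le_div_iff₀ (by positivity)] at this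
    linarith
  have hτ2 : τ * Fintype.card ι ≤ γ / 2 := by
    have : τ ≤ γ / 2 / Fintype.card ι := (min_le_left _ _).trans (min_le_right _ _)
    rwa [le_div_iff₀ (by positivity)] at this
  have hτ3 : τ * segs.length ≤ lam := by
    have : τ ≤ lam / (segs.length + 1) := min_le_right _ _
    rw [le_div_iff₀ (by positivity)] at this
    linarith
  obtain ⟨n3, hsel⟩ := select ι (k * d) c τ hc hτ0 hτ1
  refine ⟨c * τ / 16, by positivity, max (max n1 n2) (max n3 (k * d)), fun n hn H hH => ?_⟩
  simp only [ge_iff_le, max_le_iff] at hn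
  obtain ⟨⟨hn1, hn2⟩, hn3, hn4⟩ := hn
  have hnpos : (0:ℝ) < n := by exact_mod_cast (lt_of_lt_of_le hkd hn4)
  obtain ⟨R, -, hR1, hR2⟩ := hR n hn2 H hH ∅ (by simp; positivity)
  have hRβ : (R.card : ℝ) ≤ β' * n := hR1.trans (by gcongr; exact min_le_left _ _)
  have hRγ : (R.card : ℝ) ≤ γ / 2 * n := hR1.trans (by gcongr; exact min_le_right _ _)
  let J := {q : Fin (k * d) → Fin n // Function.Injective q}
  let A : J → Finset (ι → Fin n) := fun q => univ.filter (fun φ =>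
          ((∀ s ∈ segs, Good k l d H (mapSeg φ s)) ∧
            ∃ G', List.Forall₂ (Rel k l d H) (segs.map (mapSeg φ)) G' ∧
              (G'.flatMap (fun s => s.2.1)).Perm ((segs.map (mapSeg φ)).flatMap (fun s => s.2.1) ++
                List.ofFn q.1)) ∧
           Function.Injective φ ∧ ∀ i, φ i ∉ R)
  have hJ : Fintype.card J ≤ n ^ (k * d) := by
    refine (Fintype.card_subtype_le _).trans ?_
    simp
  obtain ⟨F, hF1, hF2, hF3, hF4⟩ := hsel n hn3 J hJ A (by
    intro q
    exact habs n hn1 H hH (List.ofFn q.1) (List.nodup_ofFn.2 q.2) (by simp) R hRβ)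
  -- basic properties of members
  have hFg : ∀ φ ∈ F, ∀ s ∈ segs, Good k l d H (mapSeg φ s) := by
    intro φ hφ
    obtain ⟨-, q, hq⟩ := hF2 φ hφ
    exact (mem_filter.1 hq).2.1.1
  have hFR : ∀ φ ∈ F, ∀ i, φ i ∉ R := by
    intro φ hφ
    obtain ⟨-, q, hq⟩ := hF2 φ hφ
    exact (mem_filter.1 hq).2.2.2
  set G : List (Seg (Fin n)) := F.toList.flatMap (fun φ => segs.map (mapSeg φ)) with hG
  have hGgood : ∀ s ∈ G, Good k l d H s := by
    intro s hs
    rw [hG, List.mem_flatMap] at hs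
    obtain ⟨φ, hφ, hs⟩ := hs
    obtain ⟨s', hs', rfl⟩ := List.mem_map.1 hs
    exact hFg φ (mem_toList.1 hφ) s' hs'
  have hGvs : G.flatMap vs = F.toList.flatMap (fun φ => (segs.flatMap vs).map φ) := by
    rw [hG, List.flatMap_assoc]
    congr 1
    funext φ
    rw [List.flatMap_map, List.map_flatMap]
    congr 1
    funext s
    exact vs_map φ s
  have hGnd : (G.flatMap vs).Nodup := by
    rw [hGvs, List.nodup_flatMap]
    constructor
    · intro φ hφ
      exact hsegs.map (hF2 φ (mem_toList.1 hφ)).1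
    · refine List.Nodup.pairwise_of_forall_ne F.nodup_toList ?_
      intro φ hφ ψ hψ hne x hx hy
      obtain ⟨i, -, rfl⟩ := List.mem_map.1 hx
      obtain ⟨j, -, hj⟩ := List.mem_map.1 hy
      exact hF3 φ (mem_toList.1 hφ) ψ (mem_toList.1 hψ) hne i j hj.symm
  have hGR : ∀ x ∈ G.flatMap vs, x ∉ R := by
    intro x hx
    rw [hGvs, List.mem_flatMap] at hx
    obtain ⟨φ, hφ, hx⟩ := hx
    obtain ⟨i, -, rfl⟩ := List.mem_map.1 hx
    exact hFR φ (mem_toList.1 hφ) i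
  have hGlen : (G.length : ℝ) ≤ lam * n := by
    have : G.length = F.card * segs.length := by
      rw [hG, List.length_flatMap]; simp
    rw [this]; push_cast
    calc (F.card : ℝ) * segs.length ≤ τ * n * segs.length := by gcongr
      _ = τ * segs.length * n := by ring
      _ ≤ _ := by gcongr
  have hGvl : ((G.flatMap vs).length : ℝ) ≤ γ / 2 * n := by
    have : (G.flatMap vs).length = F.card * (segs.flatMap vs).length := by
      rw [hGvs, List.length_flatMap]; simp only [List.length_map]; simp
    rw [this]; push_cast
    have h3 : (segs.flatMap vs).length ≤ Fintype.card ι := hsegs.length_le_card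
    have h4 : ((segs.flatMap vs).length : ℝ) ≤ Fintype.card ι := by exact_mod_cast h3
    calc (F.card : ℝ) * (segs.flatMap vs).length ≤ τ * n * Fintype.card ι := by gcongr
      _ = τ * Fintype.card ι * n := by ring
      _ ≤ _ := by gcongr
  have hGne : G ≠ [] := by
    let q0 : J := ⟨Fin.castLE hn4, Fin.castLE_injective hn4⟩
    have hpos : (0:ℝ) < ((F.filter (fun φ => φ ∈ A q0)).card : ℝ) :=
      lt_of_lt_of_le (by positivity) (hF4 q0)
    obtain ⟨φ, hφ⟩ := card_pos.1 (by exact_mod_cast hpos)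
    obtain ⟨hφF, hφA⟩ := mem_filter.1 hφ
    obtain ⟨⟨-, G', hG1, hG2⟩, -⟩ := (mem_filter.1 hφA).2
    intro hnil
    rw [hG, List.flatMap_eq_nil_iff] at hnil
    have h3 := hnil φ (mem_toList.2 hφF)
    rw [h3] at hG1 hG2
    rw [List.forall₂_nil_left_iff] at hG1
    subst hG1
    have := hG2.length_eq
    simp at this
    omega
  obtain ⟨s, ts, hst⟩ := List.exists_cons_of_ne_nil hGne
  have hGnd' : (vs s ++ ts.flatMap vs).Nodup := by rw [hst] at hGnd; simpa using hGnd
  obtain ⟨Cs, hCs1, hCs2, hCs3⟩ := hR2 (pairs s ts) (by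
      rw [pairs_length]
      refine le_trans ?_ hGlen
      rw [hst]; simp) (by
      intro pr hpr
      refine ⟨?_, ?_, pairs_nodup ts s hGnd' pr hpr⟩
      all_goals
        obtain ⟨x, hx, y, hy, rfl⟩ := pairs_mem ts s pr hpr
        rw [← hst] at hx hy
      · exact (hGgood x hx).2.1
      · exact (hGgood y hy).1)
  have hCs3' : List.Forall₂ (Conn k d m0 H) (pairs s ts) Cs := hCs3
  have hClen : Cs.length = ts.length := by rw [← hCs3.length_eq, pairs_length]
  have hgs : Good k l d H s := hGgood s (by rw [hst]; simp)
  have hgts : ∀ t ∈ ts, Good k l d H t := fun t ht => hGgood t (by rw [hst]; simp [ht])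
  have hperm := chain_perm ts s Cs hClen
  have hnd2 : (vs s ++ ts.flatMap vs ++ Cs.flatten).Nodup := by
    rw [List.nodup_append']
    refine ⟨hGnd', hCs1, ?_⟩
    intro x hx hy
    exact hGR x (by rw [hst]; simpa using hx) (hCs2 x hy)
  refine ⟨chain s Cs ts, ?_, ?_, ?_, ?_⟩
  · exact (chain_rel hk hm0 (List.forall₂_same.2 (fun t ht => rel_refl (hgts t ht))) s s Cs
      (rel_refl hgs) hCs3').1
  · exact hperm.nodup_iff.2 hnd2
  · rw [hperm.length_eq, List.length_append]
    have h3 : (vs s ++ ts.flatMap vs).length = (G.flatMap vs).length := by rw [hst]; simp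
    have h4 : Cs.flatten.length ≤ R.card := by
      rw [← List.toFinset_card_of_nodup hCs1]
      apply card_le_card
      intro x hx
      exact hCs2 x (List.mem_toFinset.1 hx)
    have h5 : (Cs.flatten.length : ℝ) ≤ R.card := by exact_mod_cast h4
    rw [h3]; push_cast; linarith
  · intro D hD hdvd hDlen
    obtain ⟨q, hq⟩ := hdvd
    obtain ⟨ch, hch1, hch2⟩ := chunks (k * d) q D (by rw [hq, mul_comm])
    have hchnd : ∀ i, (ch i).Nodup := by
      rw [← hch2, List.nodup_flatten] at hD
      intro i
      exact hD.1 _ (List.mem_ofFn.2 ⟨i, rfl⟩)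
    have hJq : ∀ i, ∃ x : J, List.ofFn x.1 = ch i := by
      intro i
      have hofn : List.ofFn (fun j : Fin (k * d) => (ch i).get (j.cast (hch1 i).symm)) = ch i := by
        apply List.ext_getElem
        · simp [hch1]
        · intro i _ _; simp
      exact ⟨⟨_, (List.nodup_iff_injective_get.1 (hchnd i)).comp (Fin.cast_injective _)⟩, hofn⟩
    choose x hx using hJq
    obtain ⟨f, hfinj, hf⟩ := hall_choice (fun i => F.filter (· ∈ A (x i))) (fun i => by
      have h3 := hDlen.trans (hF4 (x i))
      have h4 : D.length ≤ (F.filter (· ∈ A (x i))).card := by exact_mod_cast h3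
      refine le_trans ?_ h4
      rw [hq]; exact Nat.le_mul_of_pos_left _ hkd)
    have hfF : ∀ i, f i ∈ F := fun i => (mem_filter.1 (hf i)).1
    set g := Function.extend f ch (fun _ => []) with hg
    have hG' : ∀ φ ∈ F, ∃ G', List.Forall₂ (Rel k l d H) (segs.map (mapSeg φ)) G' ∧
              (G'.flatMap (fun s => s.2.1)).Perm ((segs.map (mapSeg φ)).flatMap (fun s => s.2.1) ++ g φ) := by
      intro φ hφ
      by_cases h : ∃ i, f i = φ
      · obtain ⟨i, rfl⟩ := h
        obtain ⟨⟨-, hh⟩, -⟩ := (mem_filter.1 (mem_filter.1 (hf i)).2).2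
        rw [hx] at hh
        rw [hg, hfinj.extend_apply]
        exact hh
      · refine ⟨segs.map (mapSeg φ), List.forall₂_same.2 ?_, ?_⟩
        · intro s hs
          obtain ⟨s', hs', rfl⟩ := List.mem_map.1 hs
          exact rel_refl (hFg φ hφ s' hs')
        · rw [hg, Function.extend_apply' _ _ _ h]; simp
    choose! Gf hGf1 hGf2 using hG'
    set G' := F.toList.flatMap Gf with hG'
    have hrel : List.Forall₂ (Rel k l d H) G G' :=
      forall₂_flatMap _ _ _ (fun φ hφ => hGf1 φ (mem_toList.1 hφ))
    have hmid : (G'.flatMap (fun s => s.2.1)).Perm (G.flatMap (fun s => s.2.1) ++ D) := by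
      rw [hG', hG, List.flatMap_assoc, List.flatMap_assoc]
      refine (flatMap_perm _ _ _ (fun φ hφ => hGf2 φ (mem_toList.1 hφ))).trans ?_
      refine (List.flatMap_append_perm _ _ _).symm.trans ?_
      apply List.Perm.append_left
      have := distribute F f hfinj hfF ch
      rwa [hch2] at this
    have hall := mid_perm_vs hrel hmid
    rw [hst] at hrel hall
    obtain ⟨s', ts', hs', hts', e⟩ := List.forall₂_cons_left_iff.1 hrel
    rw [e] at hall
    refine ⟨chain s' Cs ts', chain_rel hk hm0 hts' s s' Cs hs' hCs3', ?_⟩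
    have hperm' := chain_perm ts' s' Cs (by rw [hClen, hts'.length_eq])
    simp only [List.flatMap_cons] at hall
    rw [← Multiset.coe_eq_coe] at *
    simp only [← Multiset.coe_add] at *
    rw [hperm', hperm, hall]; abel

end HC
end

section
namespace HC

theorem trim {V : Type*} [DecidableEq V] {k l d : ℕ} {H : Finset (Finset V)} (hd : 0 < d) (p : List V) (j : ℕ)
    (hlen : 2 * l + d + j * d ≤ p.length) (hp : Win k d H p) :
    ∃ s : Seg V, Good k l d H s ∧ (vs s).Sublist p ∧
      (vs s).length + j * d + (p.length - l) % d = p.length := by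
  have hr := Nat.mod_lt (p.length - l) hd
  have hdm := Nat.div_add_mod (p.length - l) d
  set r := (p.length - l) % d with hrdef
  set q := p.length - r - j * d with hq
  set w := p.take q with hw
  have hwl : w.length = q := by simp [hw]; omega
  have hvs : vs (w.take l, (w.drop l).take (q - 2 * l), (w.drop l).drop (q - 2 * l)) = w := by
    simp only [vs, List.append_assoc, List.take_append_drop]
  refine ⟨(w.take l, (w.drop l).take (q - 2 * l), (w.drop l).drop (q - 2 * l)), ⟨?_, ?_, ?_, ?_⟩, ?_, ?_⟩
  · simp [hwl]; omega
  · simp [hwl]; omega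
  · simp only [List.length_take, List.length_drop, hwl]
    have h3 : l + min (q - 2 * l) (q - l) + j * d = d * ((p.length - l) / d) := by
      rw [min_eq_left (by omega)]; omega
    have h4 : d ∣ l + min (q - 2 * l) (q - l) + j * d := ⟨_, h3⟩
    exact (Nat.dvd_add_left (Dvd.intro_left _ rfl)).1 h4
  · rw [hvs]
    have : Win k d H (w ++ p.drop q) := by rw [hw, List.take_append_drop]; exact hp
    exact WinP.initial this
  · rw [hvs]; exact List.take_sublist _ _
  · rw [hvs, hwl]; omega

theorem trims {V : Type*} [DecidableEq V] {k l d : ℕ} {H : Finset (Finset V)} (hd : 0 < d) (Ps : List (List V))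
    (h : ∀ p ∈ Ps, Win k d H p ∧ 2 * l + d ≤ p.length) :
    ∃ ts : List (Seg V), (∀ t ∈ ts, Good k l d H t) ∧ (ts.flatMap vs).Sublist Ps.flatten ∧
      ts.length = Ps.length ∧
      (ts.flatMap vs).length + (Ps.map (fun p => (p.length - l) % d)).sum = Ps.flatten.length := by
  induction Ps with
  | nil => exact ⟨[], by simp⟩
  | cons p Ps ih =>
    obtain ⟨ts, h1, h2, h3, h4⟩ := ih (fun q hq => h q (by simp [hq]))
    obtain ⟨hw, hl⟩ := h p (by simp)
    obtain ⟨s, g1, g2, g3⟩ := trim (l := l) hd p 0 (by omega) hw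
    refine ⟨s :: ts, ?_, ?_, ?_, ?_⟩
    · simp only [List.mem_cons, forall_eq_or_imp]; exact ⟨g1, h1⟩
    · simp only [List.flatMap_cons, List.flatten_cons]; exact g2.append h2
    · simp [h3]
    · simp only [List.flatMap_cons, List.flatten_cons, List.length_append, List.map_cons, List.sum_cons]
      omega

theorem good_len {V : Type*} [DecidableEq V] {k l d : ℕ} {H : Finset (Finset V)} {s : Seg V}
    (h : Good k l d H s) : ∃ x, (vs s).length = l + d * x := by
  obtain ⟨h1, h2, ⟨x, hx⟩, -⟩ := h
  refine ⟨x, ?_⟩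
  simp only [vs, List.length_append, h1, h2]; omega

theorem goods_len {V : Type*} [DecidableEq V] {k l d : ℕ} {H : Finset (Finset V)} (ts : List (Seg V))
    (h : ∀ t ∈ ts, Good k l d H t) : ∃ x, (ts.flatMap vs).length = ts.length * l + d * x := by
  induction ts with
  | nil => exact ⟨0, by simp⟩
  | cons t ts ih =>
    obtain ⟨x, hx⟩ := ih (fun u hu => h u (by simp [hu]))
    obtain ⟨y, hy⟩ := good_len (h t (by simp))
    refine ⟨x + y, ?_⟩
    simp only [List.flatMap_cons, List.length_append, hx, hy, List.length_cons]; ring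

theorem exists_j {k d n E : ℕ} (hk : 0 < k) (h : (d : ℤ) ∣ (n : ℤ) - E) :
    ∃ j < k, ((k * d : ℕ) : ℤ) ∣ (n : ℤ) - E + j * d := by
  obtain ⟨e, he⟩ := h
  have hk' : (0:ℤ) < k := by exact_mod_cast hk
  have h1 := Int.emod_nonneg (-e) hk'.ne'
  have h2 := Int.emod_lt_of_pos (-e) hk'
  have h3 := Int.emod_add_mul_ediv (-e) k
  refine ⟨((-e) % k).toNat, by omega, ?_⟩
  rw [he, Int.toNat_of_nonneg h1]
  refine ⟨-((-e) / k), ?_⟩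
  push_cast
  linear_combination (d:ℤ) * h3

theorem sum_mod_le {α : Type*} (Ps : List (List α)) (l d : ℕ) (hd : 0 < d) :
    (Ps.map (fun p => (p.length - l) % d)).sum ≤ Ps.length * d := by
  induction Ps with
  | nil => simp
  | cons p Ps ih =>
    simp only [List.map_cons, List.sum_cons, List.length_cons, Nat.succ_mul]
    have := Nat.mod_lt (p.length - l) hd
    omega

theorem len_flatten_ge {α : Type*} (Ps : List (List α)) (N : ℕ) (h : ∀ p ∈ Ps, N ≤ p.length) :
    Ps.length * N ≤ Ps.flatten.length := by
  induction Ps with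
  | nil => simp
  | cons p Ps ih =>
    simp only [List.flatten_cons, List.length_append, List.length_cons, Nat.succ_mul]
    have := h p (by simp)
    have := ih (fun q hq => h q (by simp [hq]))
    omega

theorem conn_len {V : Type*} [DecidableEq V] {k d m0 : ℕ} {H : Finset (Finset V)}
    {prs : List (List V × List V)} {Cs : List (List V)} (h : List.Forall₂ (Conn k d m0 H) prs Cs) :
    Cs.flatten.length = prs.length * m0 := by
  induction h with
  | nil => simp
  | cons a _ ih => simp only [List.flatten_cons, List.length_append, ih, a.1, List.length_cons]; ring

/-- final closing up -/
theorem close_up {n k l d m0 : ℕ} (hk : k = l + d) (hd : 0 < d) (hm : d ∣ l + m0) (hkn : k ≤ n) (hdn : d ∣ n)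
    (H : Finset (Finset (Fin n))) (hH : IsKGraph n k H) (s s' : Seg (Fin n)) (ts : List (Seg (Fin n)))
    (hts : ∀ t ∈ ts, Good k l d H t) (Cs : List (List (Fin n))) (D : List (Fin n))
    (hC : List.Forall₂ (Conn k d m0 H) (pairs s (ts ++ [s])) Cs)
    (hs' : Rel k l d H s s') (hp : (vs s').Perm (vs s ++ D))
    (hnd : (vs s ++ ts.flatMap vs ++ Cs.flatten ++ D).Nodup)
    (hlen : (vs s ++ ts.flatMap vs ++ Cs.flatten ++ D).length = n) : HasHamiltonLCycle n k l H := by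
  have hdl : k - l = d := by omega
  have hCl : Cs.length = ts.length + 1 := by
    rw [← hC.length_eq, pairs_length]; simp
  have hrel := chain_rel hk hm (List.rel_append (List.forall₂_same.2 (fun t ht => rel_refl (hts t ht)))
    (List.Forall₂.cons hs' List.Forall₂.nil)) s s' Cs hs' hC
  obtain ⟨X, hX⟩ := chain_last ts s' s' Cs hCl
  have hperm := chain_perm (ts ++ [s']) s' Cs (by simp [hCl])
  have hwin := hrel.1.2.2.2
  rw [hX] at hperm hwin
  have hw : (vs s' ++ X).Perm (vs s ++ ts.flatMap vs ++ Cs.flatten ++ D) := by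
    rw [← Multiset.coe_eq_coe] at *
    simp only [List.flatMap_append, List.flatMap_cons, List.flatMap_nil, List.append_nil,
      ← Multiset.coe_add] at *
    have : ((vs s' : Multiset (Fin n)) + (X : Multiset (Fin n))) + (vs s' : Multiset (Fin n)) =
       ((vs s' : Multiset (Fin n)) + (ts.flatMap vs : Multiset (Fin n)) + (Cs.flatten : Multiset (Fin n))) +
         (vs s' : Multiset (Fin n)) := by
      rw [hperm]; abel
    rw [add_right_cancel this, hp]; abel
  apply cycle_of_list hkn (by omega) (by rw [hdl]; exact hdn) H hH (vs s' ++ X)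
  · exact hw.nodup_iff.2 hnd
  · rw [hw.length_eq, hlen]
  · rw [hdl]
    have e : (vs s' ++ X).take l = s'.1 := by
      simp only [vs, List.append_assoc]
      exact List.take_left' hs'.1.1
    rw [e]
    have : Win k d H ((vs s' ++ X ++ s'.1) ++ (s'.2.1 ++ s'.2.2)) := by
      simpa [vs, Win] using hwin
    exact WinP.initial this

end HC
end

section
namespace HC

theorem core {k l d b : ℕ} (hk3 : 3 ≤ k) (hk : k = l + d) (hd : 2 ≤ d) (hl : 0 < l) (hnd : ¬ d ∣ k)
    (hb : 0 < b) (h1 : b * d < k) (h2 : k < (b + 1) * d) (η : ℝ) (hη : 0 < η) (hη1 : η ≤ 1 / 2) :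
    ∃ n0 : ℕ, ∀ n ≥ n0, d ∣ n → ∀ H : Finset (Finset (Fin n)), IsKGraph n k H →
      Cod k H ((1 / (((b + 1) * d : ℕ) : ℝ) + η) * n) → HasHamiltonLCycle n k l H := by
  set μ : ℝ := 1 / (((b + 1) * d : ℕ) : ℝ) + η with hμdef
  have hd0 : 0 < d := by omega
  have hbd : (2:ℝ) ≤ (((b + 1) * d : ℕ) : ℝ) := by
    have : 2 ≤ (b + 1) * d := by omega
    exact_mod_cast this
  have hμ : 0 < μ := by rw [hμdef]; positivity
  have hμ1 : μ ≤ 1 := by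
    have : 1 / (((b + 1) * d : ℕ) : ℝ) ≤ 1 / 2 := one_div_le_one_div_of_le (by norm_num) hbd
    rw [hμdef]; linarith
  obtain ⟨m0, hm0, β, hβ, hres⟩ := reservoir hk hd hl hnd μ hμ hμ1
  obtain ⟨α, hα, n1, habs⟩ := abspath hk3 hk hd hl hnd hb h1 h2 μ hμ hμ1 (min β (η / 4))
    (lt_min hβ (by positivity))
  obtain ⟨lam, hlam, n2, hR⟩ := hres (min (η / 4) (α / 4)) (lt_min (by positivity) (by positivity))
  set M : ℕ := 2 * l + d + k * d + ⌈2 / lam⌉₊ + ⌈4 * d / α⌉₊ with hM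
  set N := d * M with hN
  have hMN : M ≤ N := Nat.le_mul_of_pos_left _ hd0
  have hN0 : 0 < N := by omega
  have hNl : 2 / lam ≤ N := (Nat.le_ceil _).trans (by
    have : ⌈2 / lam⌉₊ ≤ N := by omega
    exact_mod_cast this)
  have hNα : 4 * d / α ≤ N := (Nat.le_ceil _).trans (by
    have : ⌈4 * d / α⌉₊ ≤ N := by omega
    exact_mod_cast this)
  rw [div_le_iff₀ hlam] at hNl
  rw [div_le_iff₀ hα] at hNα
  obtain ⟨K, hK⟩ : ∃ K, k = K + 1 := ⟨k - 1, by omega⟩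
  have hcov := cover K d b N (by omega) hd0 (by omega) (by omega) hN0 (Dvd.intro _ rfl) η
    (min (α / 4) (1 / 4)) hη (lt_min (by positivity) (by norm_num))
  rw [← hK] at hcov
  obtain ⟨n3, hcov⟩ := hcov
  refine ⟨max (max n1 n2) (max n3 (k + ⌈2 / lam⌉₊ + ⌈4 * (k * d) / α⌉₊)), fun n hn hdn H hH hcod => ?_⟩
  simp only [ge_iff_le, max_le_iff] at hn
  obtain ⟨⟨hn1, hn2⟩, hn3, hn4⟩ := hn
  have hnpos : (0:ℝ) < n := by
    have : 0 < n := by omega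
    exact_mod_cast this
  have hnl : 2 / lam ≤ n := (Nat.le_ceil _).trans (by
    have : ⌈2 / lam⌉₊ ≤ n := by omega
    exact_mod_cast this)
  have hnα : 4 * (k * d) / α ≤ n := (Nat.le_ceil _).trans (by
    have : ⌈4 * (k * d) / α⌉₊ ≤ n := by omega
    exact_mod_cast this)
  rw [div_le_iff₀ hlam] at hnl
  rw [div_le_iff₀ hα] at hnα
  obtain ⟨s, hsg, hsnd, hslen, hsabs⟩ := habs n hn1 H hcod
  have hsβ : ((vs s).length : ℝ) ≤ β * n := hslen.trans (by gcongr; exact min_le_left _ _)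
  have hsη : ((vs s).length : ℝ) ≤ η / 4 * n := hslen.trans (by gcongr; exact min_le_right _ _)
  have hWc : (vs s).toFinset.card = (vs s).length := List.toFinset_card_of_nodup hsnd
  obtain ⟨R, hRW, hRc, hRcon⟩ := hR n hn2 H hcod (vs s).toFinset (by rw [hWc]; exact hsβ)
  have hRη : (R.card : ℝ) ≤ η / 4 * n := hRc.trans (by gcongr; exact min_le_left _ _)
  have hRα : (R.card : ℝ) ≤ α / 4 * n := hRc.trans (by gcongr; exact min_le_right _ _)
  set U : Finset (Fin n) := ((vs s).toFinset ∪ R)ᶜ with hU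
  have hUc : Uᶜ.card ≤ (vs s).length + R.card := by
    rw [hU, compl_compl, ← hWc]; exact card_union_le _ _
  have hUc' : (Uᶜ.card : ℝ) ≤ (vs s).length + R.card := by exact_mod_cast hUc
  have hUn : (n : ℝ) = U.card + Uᶜ.card := by
    have := card_add_card_compl U
    rw [Fintype.card_fin] at this
    exact_mod_cast this.symm
  obtain ⟨Ps, ⟨hPnd, hPw, hPU⟩, hPε⟩ := hcov n hn3 H hcod U (by linarith)
  have hPε1 : ((U \ Ps.flatten.toFinset).card : ℝ) ≤ α / 4 * n := hPε.trans (by gcongr; exact min_le_left _ _)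
  have hPε2 : ((U \ Ps.flatten.toFinset).card : ℝ) ≤ 1 / 4 * n := hPε.trans (by gcongr; exact min_le_right _ _)
  have hUP : U.card ≤ (U \ Ps.flatten.toFinset).card + Ps.flatten.length := by
    rw [← List.toFinset_card_of_nodup hPnd]
    have := card_le_card_sdiff_add_card (s := U) (t := Ps.flatten.toFinset)
    omega
  have hUP' : (U.card : ℝ) ≤ (U \ Ps.flatten.toFinset).card + Ps.flatten.length := by exact_mod_cast hUP
  have hPne : Ps ≠ [] := by
    rintro rfl
    simp only [List.flatten_nil, List.length_nil, Nat.cast_zero, add_zero] at hUP'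
    simp only [List.flatten_nil] at hPε2
    nlinarith
  have hPn : Ps.flatten.length ≤ n := by
    have := hPnd.length_le_card
    rwa [Fintype.card_fin] at this
  have hrN : (Ps.length : ℝ) * N ≤ n := by
    have := (len_flatten_ge Ps N (fun p hp => (hPw p hp).2.1)).trans hPn
    exact_mod_cast this
  obtain ⟨p0, Ps', rfl⟩ := List.exists_cons_of_ne_nil hPne
  set r := (p0 :: Ps').length with hr
  have hNbig : ∀ p ∈ p0 :: Ps', Win k d H p ∧ 2 * l + d + k * d ≤ p.length := fun p hp =>
    ⟨(hPw p hp).1, by have := (hPw p hp).2.1; omega⟩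
  obtain ⟨ts', ht1, ht2, ht3, ht4⟩ := trims (l := l) hd0 Ps' (fun p hp =>
    ⟨(hNbig p (by simp [hp])).1, by have := (hNbig p (by simp [hp])).2; omega⟩)
  set tl := p0.length - (p0.length - l) % d with htl
  have hp0 := hNbig p0 (by simp)
  have hmod0 := Nat.mod_lt (p0.length - l) hd0
  set E := (vs s).length + tl + (ts'.flatMap vs).length + (r + 1) * m0 with hE
  have hdE : (d : ℤ) ∣ (n : ℤ) - E := by
    obtain ⟨x, hx⟩ := good_len hsg
    obtain ⟨y, hy⟩ := goods_len ts' ht1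
    obtain ⟨z, hz⟩ := hm0
    obtain ⟨u, hu⟩ := hdn
    have hdm := Nat.div_add_mod (p0.length - l) d
    have htl' : tl = l + d * ((p0.length - l) / d) := by omega
    have hr' : r = ts'.length + 1 := by rw [ht3, hr]; simp
    have hEE : E = d * (x + y + (p0.length - l) / d + z * (r + 1)) := by
      rw [hE, hx, hy, htl', hr']
      calc _ = d * x + d * y + d * ((p0.length - l) / d) + (l + m0) * (ts'.length + 1 + 1) := by ring
        _ = _ := by rw [hz]; ring
    have q1 : d ∣ E := ⟨_, hEE⟩
    have q2 : d ∣ n := ⟨u, hu⟩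
    exact dvd_sub (Int.natCast_dvd_natCast.2 q2) (Int.natCast_dvd_natCast.2 q1)
  obtain ⟨j, hjk, hj⟩ := exists_j (k := k) (by omega) hdE
  have hjd : j * d ≤ k * d := Nat.mul_le_mul_right _ hjk.le
  obtain ⟨t0, g1, g2, g3⟩ := trim (l := l) hd0 p0 j (by omega) hp0.1
  set ts := t0 :: ts' with hts
  have htg : ∀ t ∈ ts, Good k l d H t := by
    rw [hts]; simp only [List.mem_cons, forall_eq_or_imp]; exact ⟨g1, ht1⟩
  have htsub : (ts.flatMap vs).Sublist (p0 :: Ps').flatten := by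
    simp only [hts, List.flatMap_cons, List.flatten_cons]; exact g2.append ht2
  have htU : ∀ x ∈ ts.flatMap vs, x ∈ U := fun x hx => hPU x (htsub.subset hx)
  have hstnd : (vs s ++ ts.flatMap vs).Nodup := by
    rw [List.nodup_append']
    refine ⟨hsnd, List.Nodup.sublist htsub hPnd, ?_⟩
    intro x hx hy
    have := htU x hy
    rw [hU, mem_compl] at this
    exact this (mem_union_left _ (List.mem_toFinset.2 hx))
  have htsl : ts.length = r := by rw [hts, hr]; simp [ht3]
  have hallg : ∀ x ∈ s :: (ts ++ [s]), Good k l d H x := by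
    intro x hx
    simp only [List.mem_cons, List.mem_append, List.not_mem_nil, or_false] at hx
    rcases hx with rfl | hx | rfl
    · exact hsg
    · exact htg x hx
    · exact hsg
  obtain ⟨Cs, hCs1, hCs2, hCs3⟩ := hRcon (pairs s (ts ++ [s])) (by
      rw [pairs_length, List.length_append, htsl]
      push_cast
      have : (r : ℝ) * 2 ≤ lam * n := by
        calc (r : ℝ) * 2 ≤ r * (N * lam) := by gcongr
          _ = lam * (r * N) := by ring
          _ ≤ lam * n := by gcongr
      simp only [List.length_cons, List.length_nil]
      push_cast
      linarith) (by
      intro pr hpr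
      refine ⟨?_, ?_, pairs_cyc_nodup ts s hstnd pr hpr⟩
      all_goals obtain ⟨x, hx, y, hy, rfl⟩ := pairs_mem _ s pr hpr
      · exact (hallg x hx).2.1
      · exact (hallg y hy).1)
  have hCs3' : List.Forall₂ (Conn k d m0 H) (pairs s (ts ++ [s])) Cs := hCs3
  have hCl := conn_len hCs3'
  rw [pairs_length, List.length_append, htsl, List.length_singleton] at hCl
  set L0 := vs s ++ ts.flatMap vs ++ Cs.flatten with hL0
  have hL0nd : L0.Nodup := by
    rw [hL0, List.nodup_append']
    refine ⟨hstnd, hCs1, ?_⟩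
    intro x hx hy
    have hxR := hCs2 x hy
    rcases List.mem_append.1 hx with hx | hx
    · exact hRW x hxR (List.mem_toFinset.2 hx)
    · have := htU x hx
      rw [hU, mem_compl] at this
      exact this (mem_union_right _ hxR)
  have hL0len : L0.length + j * d = E := by
    rw [hL0]
    simp only [List.length_append, hCl, hts, List.flatMap_cons]
    omega
  set D := (L0.toFinsetᶜ).toList with hD
  have hDlen : L0.length + D.length = n := by
    rw [hD, length_toList, ← List.toFinset_card_of_nodup hL0nd, card_add_card_compl, Fintype.card_fin]
  have hDnd : D.Nodup := nodup_toList _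
  have hdvd : k * d ∣ D.length := by
    have e : (n : ℤ) - E + j * d = D.length := by
      have a1 : (L0.length : ℤ) + j * d = E := by exact_mod_cast hL0len
      have a2 : (L0.length : ℤ) + D.length = n := by exact_mod_cast hDlen
      linarith
    rw [e] at hj
    exact_mod_cast hj
  have hDα : (D.length : ℝ) ≤ α * n := by
    have hs1 := sum_mod_le Ps' l d hd0
    have hr' : r = Ps'.length + 1 := by rw [hr]; simp
    have hfl : (p0 :: Ps').flatten.length = p0.length + Ps'.flatten.length := by simp
    have hrd : (Ps'.length + 1) * d = Ps'.length * d + d := by ring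
    have hb1 : (p0 :: Ps').flatten.length + (vs s).length ≤ E + r * d := by
      rw [hfl, hE, hr']
      have : 0 ≤ (Ps'.length + 1 + 1) * m0 := Nat.zero_le _
      omega
    have a0 : ((p0 :: Ps').flatten.length : ℝ) + (vs s).length ≤ E + r * d := by exact_mod_cast hb1
    have a1 : (L0.length : ℝ) + j * d = E := by exact_mod_cast hL0len
    have a2 : (L0.length : ℝ) + D.length = n := by exact_mod_cast hDlen
    have a3 : (j : ℝ) * d ≤ k * d := by exact_mod_cast hjd
    have a4 : (r : ℝ) * d * 4 ≤ α * n := by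
      calc (r : ℝ) * d * 4 = r * (4 * d) := by ring
        _ ≤ r * (N * α) := by gcongr
        _ = α * (r * N) := by ring
        _ ≤ α * n := by gcongr
    linarith
  obtain ⟨s', hs', hsp⟩ := hsabs D hDnd hdvd hDα
  apply close_up hk hd0 hm0 (by omega) hdn H hH s s' ts htg Cs D hCs3' hs' hsp
  · rw [List.nodup_append']
    refine ⟨hL0nd, hDnd, ?_⟩
    intro x hx hy
    rw [hD, mem_toList, mem_compl] at hy
    exact hy (List.mem_toFinset.2 hx)
  · rw [List.length_append]; exact hDlen

end HC
end

/-- If `(k-ℓ) ∤ k` then minimum degree `(1/(⌈k/(k-ℓ)⌉(k-ℓ)) + η) n` forces a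
Hamilton `ℓ`-cycle. -/
theorem min_degree_hamilton_cycle_nondiv
    (k ℓ : ℕ) (hk : 3 ≤ k) (hl1 : 1 ≤ ℓ) (hl2 : ℓ ≤ k - 1)
    (hnd : ¬ (k - ℓ) ∣ k) (η : ℝ) (hη : 0 < η) :
    ∃ n₀ : ℕ, ∀ n : ℕ, n₀ < n → (k - ℓ) ∣ n →
      ∀ H : Finset (Finset (Fin n)), IsKGraph n k H →
        MinDegreeGe n k H
          ((1 / ((ceilQuot k (k - ℓ) * (k - ℓ) : ℕ) : ℝ) + η) * n) →
        HasHamiltonLCycle n k ℓ H := by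
  set d := k - ℓ with hd
  have hkl : k = ℓ + d := by omega
  have hd2 : 2 ≤ d := by
    by_contra h
    have : d = 1 := by omega
    rw [this] at hnd
    exact hnd (one_dvd _)
  have hdm := Nat.div_add_mod k d
  have hmod : 0 < k % d := Nat.pos_of_ne_zero (fun h => hnd (Nat.dvd_of_mod_eq_zero h))
  have hmod2 := Nat.mod_lt k (show 0 < d by omega)
  set b := k / d with hb
  have hcq : ceilQuot k d = b + 1 := by
    unfold ceilQuot
    rw [Nat.div_eq_iff (by omega)]
    have : (b + 1) * d = d * b + d := by ring
    omega
  have hb0 : 0 < b := Nat.div_pos (by omega) (by omega)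
  have e1 : b * d = d * b := mul_comm _ _
  have e2 : (b + 1) * d = d * b + d := by ring
  obtain ⟨n0, hn0⟩ := HC.core hk hkl hd2 hl1 hnd hb0 (by omega) (by omega) (min η (1 / 2))
    (lt_min hη (by norm_num)) (min_le_right _ _)
  refine ⟨n0, fun n hn hdn H hH hmin => hn0 n hn.le hdn H hH ?_⟩
  rw [hcq] at hmin
  intro A hA
  refine le_trans ?_ (HC.cod_of_minDegree (by omega) hH hmin A hA)
  gcongr
  exact min_le_left _ _
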